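/- Full completeness of the call-by-name linear-use CPS translation: suppose R̲ is either (i) a computation-type constant different from α̲ for every simply-typed λ-calculus type constant α, or (ii) the type I̲. Then: (1) if Θ ⊢ M, N : τ are simply-typed terms and Θⁿᶜ⊸R̲ ⊢ Mⁿᶜ = Nⁿᶜ : τⁿᶜ ⊸ R̲ in EEC, then Θ ⊢ M =_{βη} N : τ; (2) if Θⁿᶜ⊸R̲ ⊢ t : τⁿᶜ ⊸ R̲ is derivable in EEC, then there exists a simply-typed term Θ ⊢ M : τ such that Θⁿᶜ⊸R̲ ⊢ Mⁿᶜ = t : τⁿᶜ ⊸ R̲ in EEC. -/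

import Mathlib

set_option autoImplicit false

namespace EEC

/-! # The enriched effect calculus (EEC)

A deep embedding of the enriched effect calculus of Egger, Møgelberg and
Simpson: value types and computation types, raw terms (de Bruijn indices for
value variables, together with a designated stoup variable `svar`), typing
derivations with an (at most singleton) stoup, the βη-equational theory, the
simply-typed λ-calculus together with βη-equality and Moggi's computational
λ-calculus equality, the standard cbv/cbn translations of typed λ-calculus
into EEC, Hasegawa's linear-use CPS translations, and the generic linear-use
CPS self-translation of EEC. -/

mutual
  /-- Value types of EEC. -/
  inductive VType : Type
    | base : ℕ → VType                 -- value type constants α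
    | unit : VType                     -- 1
    | prod : VType → VType → VType     -- A × B
    | arr : VType → VType → VType      -- A → B
    | comp : CType → VType             -- every computation type is a value type
    | lin : CType → CType → VType      -- A̲ ⊸ B̲
  /-- Computation types of EEC. -/
  inductive CType : Type
    | base : ℕ → CType                 -- computation type constants α̲
    | cunit : CType                    -- 1̲
    | cand : CType → CType → CType     -- A̲ & B̲
    | carr : VType → CType → CType     -- A ⇒ B̲
    | iunit : CType                    -- I̲
    | bang : VType → CType             -- !A
    | copow : VType → CType → CType    -- !A ⊗ B̲
    | czero : CType                    -- 0̲
    | csum : CType → CType → CType     -- A̲ ⊕ B̲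
end

/-- Raw terms of EEC.  Value variables are de Bruijn indices (`var n`, with
`var 0` the innermost bound variable); the unique stoup variable is `svar`
(the constructs `llam`, `copowlet` (in its body) and `ccase` (in its
branches) bind the stoup variable). -/
inductive Tm : Type
  | var : ℕ → Tm                -- value variable
  | svar : Tm                   -- the stoup variable
  | unit : Tm                   -- * : 1
  | vpair : Tm → Tm → Tm        -- ⟨t,u⟩
  | vfst : Tm → Tm
  | vsnd : Tm → Tm
  | vlam : VType → Tm → Tm      -- λx:A. t
  | vapp : Tm → Tm → Tm
  | cunit : Tm                  -- ⋆ : 1̲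
  | cpair : Tm → Tm → Tm        -- ⟨t,u⟩ : A̲ & B̲
  | cfst : Tm → Tm
  | csnd : Tm → Tm
  | clam : VType → Tm → Tm      -- λx:A ⇒ t
  | capp : Tm → Tm → Tm         -- s ⋅ t
  | top : Tm                    -- ⊤ : I̲
  | ilet : Tm → Tm → Tm         -- t to ⊤. u
  | bang : Tm → Tm              -- !t
  | banglet : Tm → Tm → Tm      -- let !x = t in u   (binds a value variable in u)
  | copow : Tm → Tm → Tm        -- !t ⊗ u
  | copowlet : Tm → Tm → Tm     -- let !x⊗y = s in t (binds a value variable and the stoup variable in t)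
  | cimage : CType → Tm → Tm    -- image_{A̲}(t)
  | cinl : Tm → Tm
  | cinr : Tm → Tm
  | ccase : Tm → Tm → Tm → Tm   -- case s of (x. t | y. u)  (branches bind the stoup variable)
  | llam : CType → Tm → Tm      -- λ°z:A̲. t (binds the stoup variable)
  | lapp : Tm → Tm → Tm         -- s[t]

namespace Tm

/-- Lift a renaming of value variables under a binder. -/
def liftN (f : ℕ → ℕ) : ℕ → ℕ
  | 0 => 0
  | n + 1 => f n + 1

/-- Renaming of value variables. -/
def rename (f : ℕ → ℕ) : Tm → Tm
  | .var n => .var (f n)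
  | .svar => .svar
  | .unit => .unit
  | .vpair t u => .vpair (rename f t) (rename f u)
  | .vfst t => .vfst (rename f t)
  | .vsnd t => .vsnd (rename f t)
  | .vlam A t => .vlam A (rename (liftN f) t)
  | .vapp s t => .vapp (rename f s) (rename f t)
  | .cunit => .cunit
  | .cpair t u => .cpair (rename f t) (rename f u)
  | .cfst t => .cfst (rename f t)
  | .csnd t => .csnd (rename f t)
  | .clam A t => .clam A (rename (liftN f) t)
  | .capp s t => .capp (rename f s) (rename f t)
  | .top => .top
  | .ilet t u => .ilet (rename f t) (rename f u)
  | .bang t => .bang (rename f t)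
  | .banglet t u => .banglet (rename f t) (rename (liftN f) u)
  | .copow t u => .copow (rename f t) (rename f u)
  | .copowlet s t => .copowlet (rename f s) (rename (liftN f) t)
  | .cimage A t => .cimage A (rename f t)
  | .cinl t => .cinl (rename f t)
  | .cinr t => .cinr (rename f t)
  | .ccase s t u => .ccase (rename f s) (rename f t) (rename f u)
  | .llam A t => .llam A (rename f t)
  | .lapp s t => .lapp (rename f s) (rename f t)

/-- Weakening of value variables. -/
def shift (t : Tm) : Tm := rename Nat.succ t

/-- Lift a parallel substitution of value variables under a binder. -/
def liftS (σ : ℕ → Tm) : ℕ → Tm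
  | 0 => .var 0
  | n + 1 => shift (σ n)

/-- Parallel (capture-avoiding) substitution for value variables. -/
def psubst (σ : ℕ → Tm) : Tm → Tm
  | .var n => σ n
  | .svar => .svar
  | .unit => .unit
  | .vpair t u => .vpair (psubst σ t) (psubst σ u)
  | .vfst t => .vfst (psubst σ t)
  | .vsnd t => .vsnd (psubst σ t)
  | .vlam A t => .vlam A (psubst (liftS σ) t)
  | .vapp s t => .vapp (psubst σ s) (psubst σ t)
  | .cunit => .cunit
  | .cpair t u => .cpair (psubst σ t) (psubst σ u)
  | .cfst t => .cfst (psubst σ t)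
  | .csnd t => .csnd (psubst σ t)
  | .clam A t => .clam A (psubst (liftS σ) t)
  | .capp s t => .capp (psubst σ s) (psubst σ t)
  | .top => .top
  | .ilet t u => .ilet (psubst σ t) (psubst σ u)
  | .bang t => .bang (psubst σ t)
  | .banglet t u => .banglet (psubst σ t) (psubst (liftS σ) u)
  | .copow t u => .copow (psubst σ t) (psubst σ u)
  | .copowlet s t => .copowlet (psubst σ s) (psubst (liftS σ) t)
  | .cimage A t => .cimage A (psubst σ t)
  | .cinl t => .cinl (psubst σ t)
  | .cinr t => .cinr (psubst σ t)
  | .ccase s t u => .ccase (psubst σ s) (psubst σ t) (psubst σ u)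
  | .llam A t => .llam A (psubst σ t)
  | .lapp s t => .lapp (psubst σ s) (psubst σ t)

/-- Capture-avoiding substitution `t[u/x]` of a term `u` for the innermost
value variable of `t`. -/
def subst0 (u : Tm) (t : Tm) : Tm :=
  psubst (fun n => match n with | 0 => u | m + 1 => .var m) t

/-- Capture-avoiding substitution `t[u/z]` of a term `u` for the stoup
variable of `t`.  The substitution stops at the stoup-variable binders
(`llam`-bodies, `copowlet`-bodies and `ccase`-branches). -/
def ssubst (u : Tm) : Tm → Tm
  | .var n => .var n
  | .svar => u
  | .unit => .unit
  | .vpair t t' => .vpair (ssubst u t) (ssubst u t')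
  | .vfst t => .vfst (ssubst u t)
  | .vsnd t => .vsnd (ssubst u t)
  | .vlam A t => .vlam A (ssubst (shift u) t)
  | .vapp s t => .vapp (ssubst u s) (ssubst u t)
  | .cunit => .cunit
  | .cpair t t' => .cpair (ssubst u t) (ssubst u t')
  | .cfst t => .cfst (ssubst u t)
  | .csnd t => .csnd (ssubst u t)
  | .clam A t => .clam A (ssubst (shift u) t)
  | .capp s t => .capp (ssubst u s) (ssubst u t)
  | .top => .top
  | .ilet t t' => .ilet (ssubst u t) (ssubst u t')
  | .bang t => .bang (ssubst u t)
  | .banglet t t' => .banglet (ssubst u t) (ssubst (shift u) t')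
  | .copow t t' => .copow (ssubst u t) (ssubst u t')
  | .copowlet s t => .copowlet (ssubst u s) t
  | .cimage A t => .cimage A (ssubst u t)
  | .cinl t => .cinl (ssubst u t)
  | .cinr t => .cinr (ssubst u t)
  | .ccase s t t' => .ccase (ssubst u s) t t'
  | .llam A t => .llam A t
  | .lapp s t => .lapp (ssubst u s) (ssubst u t)

end Tm

/-- Typing derivations of EEC (Figure 1 of the paper).  `Deriv Γ none t A`
is the judgement `Γ ⊢ t : A` (empty stoup); `Deriv Γ (some A̲) t (.comp B̲)`
is the judgement `Γ | z:A̲ ⊢ t : B̲`.  In the rules below `Δ` ranges over an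
arbitrary (possibly empty) stoup. -/
inductive Deriv : List VType → Option CType → Tm → VType → Type
  | var (Γ : List VType) (n : ℕ) (A : VType) :
      Γ[n]? = some A → Deriv Γ none (.var n) A
  | svar (Γ : List VType) (A : CType) : Deriv Γ (some A) .svar (.comp A)
  | unit (Γ : List VType) : Deriv Γ none .unit .unit
  | vpair (Γ : List VType) (t u : Tm) (A B : VType) :
      Deriv Γ none t A → Deriv Γ none u B → Deriv Γ none (.vpair t u) (.prod A B)
  | vfst (Γ : List VType) (t : Tm) (A B : VType) :
      Deriv Γ none t (.prod A B) → Deriv Γ none (.vfst t) A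
  | vsnd (Γ : List VType) (t : Tm) (A B : VType) :
      Deriv Γ none t (.prod A B) → Deriv Γ none (.vsnd t) B
  | vlam (Γ : List VType) (t : Tm) (A B : VType) :
      Deriv (A :: Γ) none t B → Deriv Γ none (.vlam A t) (.arr A B)
  | vapp (Γ : List VType) (s t : Tm) (A B : VType) :
      Deriv Γ none s (.arr A B) → Deriv Γ none t A → Deriv Γ none (.vapp s t) B
  | cunit (Γ : List VType) (Δ : Option CType) : Deriv Γ Δ .cunit (.comp .cunit)
  | cpair (Γ : List VType) (Δ : Option CType) (t u : Tm) (A B : CType) :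
      Deriv Γ Δ t (.comp A) → Deriv Γ Δ u (.comp B) →
      Deriv Γ Δ (.cpair t u) (.comp (.cand A B))
  | cfst (Γ : List VType) (Δ : Option CType) (t : Tm) (A B : CType) :
      Deriv Γ Δ t (.comp (.cand A B)) → Deriv Γ Δ (.cfst t) (.comp A)
  | csnd (Γ : List VType) (Δ : Option CType) (t : Tm) (A B : CType) :
      Deriv Γ Δ t (.comp (.cand A B)) → Deriv Γ Δ (.csnd t) (.comp B)
  | clam (Γ : List VType) (Δ : Option CType) (t : Tm) (A : VType) (B : CType) :
      Deriv (A :: Γ) Δ t (.comp B) → Deriv Γ Δ (.clam A t) (.comp (.carr A B))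
  | capp (Γ : List VType) (Δ : Option CType) (s t : Tm) (A : VType) (B : CType) :
      Deriv Γ Δ s (.comp (.carr A B)) → Deriv Γ none t A →
      Deriv Γ Δ (.capp s t) (.comp B)
  | top (Γ : List VType) : Deriv Γ none .top (.comp .iunit)
  | ilet (Γ : List VType) (Δ : Option CType) (t u : Tm) (A : CType) :
      Deriv Γ Δ t (.comp .iunit) → Deriv Γ none u (.comp A) →
      Deriv Γ Δ (.ilet t u) (.comp A)
  | bang (Γ : List VType) (t : Tm) (A : VType) :
      Deriv Γ none t A → Deriv Γ none (.bang t) (.comp (.bang A))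
  | banglet (Γ : List VType) (Δ : Option CType) (t u : Tm) (A : VType) (B : CType) :
      Deriv Γ Δ t (.comp (.bang A)) → Deriv (A :: Γ) none u (.comp B) →
      Deriv Γ Δ (.banglet t u) (.comp B)
  | copow (Γ : List VType) (Δ : Option CType) (t u : Tm) (A : VType) (B : CType) :
      Deriv Γ none t A → Deriv Γ Δ u (.comp B) →
      Deriv Γ Δ (.copow t u) (.comp (.copow A B))
  | copowlet (Γ : List VType) (Δ : Option CType) (s t : Tm) (A : VType) (B C : CType) :
      Deriv Γ Δ s (.comp (.copow A B)) → Deriv (A :: Γ) (some B) t (.comp C) →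
      Deriv Γ Δ (.copowlet s t) (.comp C)
  | cimage (Γ : List VType) (Δ : Option CType) (t : Tm) (A : CType) :
      Deriv Γ Δ t (.comp .czero) → Deriv Γ Δ (.cimage A t) (.comp A)
  | cinl (Γ : List VType) (Δ : Option CType) (t : Tm) (A B : CType) :
      Deriv Γ Δ t (.comp A) → Deriv Γ Δ (.cinl t) (.comp (.csum A B))
  | cinr (Γ : List VType) (Δ : Option CType) (t : Tm) (A B : CType) :
      Deriv Γ Δ t (.comp B) → Deriv Γ Δ (.cinr t) (.comp (.csum A B))
  | ccase (Γ : List VType) (Δ : Option CType) (s t u : Tm) (A B C : CType) :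
      Deriv Γ Δ s (.comp (.csum A B)) → Deriv Γ (some A) t (.comp C) →
      Deriv Γ (some B) u (.comp C) → Deriv Γ Δ (.ccase s t u) (.comp C)
  | llam (Γ : List VType) (t : Tm) (A B : CType) :
      Deriv Γ (some A) t (.comp B) → Deriv Γ none (.llam A t) (.lin A B)
  | lapp (Γ : List VType) (Δ : Option CType) (s t : Tm) (A B : CType) :
      Deriv Γ none s (.lin A B) → Deriv Γ Δ t (.comp A) →
      Deriv Γ Δ (.lapp s t) (.comp B)

/-- The equational theory of EEC: the smallest type-respecting congruence
containing the βη-equalities of Figure 2 of the paper. -/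
inductive EEq : List VType → Option CType → Tm → Tm → VType → Prop
  -- equivalence
  | refl {Γ Δ t A} : Deriv Γ Δ t A → EEq Γ Δ t t A
  | symm {Γ Δ t u A} : EEq Γ Δ t u A → EEq Γ Δ u t A
  | trans {Γ Δ t u v A} : EEq Γ Δ t u A → EEq Γ Δ u v A → EEq Γ Δ t v A
  -- congruence rules
  | vpair_cong {Γ t t' u u' A B} : EEq Γ none t t' A → EEq Γ none u u' B →
      EEq Γ none (.vpair t u) (.vpair t' u') (.prod A B)
  | vfst_cong {Γ t t' A B} : EEq Γ none t t' (.prod A B) →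
      EEq Γ none (.vfst t) (.vfst t') A
  | vsnd_cong {Γ t t' A B} : EEq Γ none t t' (.prod A B) →
      EEq Γ none (.vsnd t) (.vsnd t') B
  | vlam_cong {Γ t t' A B} : EEq (A :: Γ) none t t' B →
      EEq Γ none (.vlam A t) (.vlam A t') (.arr A B)
  | vapp_cong {Γ s s' t t' A B} : EEq Γ none s s' (.arr A B) → EEq Γ none t t' A →
      EEq Γ none (.vapp s t) (.vapp s' t') B
  | cpair_cong {Γ Δ t t' u u' A B} : EEq Γ Δ t t' (.comp A) → EEq Γ Δ u u' (.comp B) →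
      EEq Γ Δ (.cpair t u) (.cpair t' u') (.comp (.cand A B))
  | cfst_cong {Γ Δ t t' A B} : EEq Γ Δ t t' (.comp (.cand A B)) →
      EEq Γ Δ (.cfst t) (.cfst t') (.comp A)
  | csnd_cong {Γ Δ t t' A B} : EEq Γ Δ t t' (.comp (.cand A B)) →
      EEq Γ Δ (.csnd t) (.csnd t') (.comp B)
  | clam_cong {Γ Δ t t' A B} : EEq (A :: Γ) Δ t t' (.comp B) →
      EEq Γ Δ (.clam A t) (.clam A t') (.comp (.carr A B))
  | capp_cong {Γ Δ s s' t t' A B} : EEq Γ Δ s s' (.comp (.carr A B)) → EEq Γ none t t' A →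
      EEq Γ Δ (.capp s t) (.capp s' t') (.comp B)
  | ilet_cong {Γ Δ t t' u u' A} : EEq Γ Δ t t' (.comp .iunit) → EEq Γ none u u' (.comp A) →
      EEq Γ Δ (.ilet t u) (.ilet t' u') (.comp A)
  | bang_cong {Γ t t' A} : EEq Γ none t t' A →
      EEq Γ none (.bang t) (.bang t') (.comp (.bang A))
  | banglet_cong {Γ Δ t t' u u' A B} : EEq Γ Δ t t' (.comp (.bang A)) →
      EEq (A :: Γ) none u u' (.comp B) →
      EEq Γ Δ (.banglet t u) (.banglet t' u') (.comp B)
  | copow_cong {Γ Δ t t' u u' A B} : EEq Γ none t t' A → EEq Γ Δ u u' (.comp B) →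
      EEq Γ Δ (.copow t u) (.copow t' u') (.comp (.copow A B))
  | copowlet_cong {Γ Δ s s' t t' A B C} : EEq Γ Δ s s' (.comp (.copow A B)) →
      EEq (A :: Γ) (some B) t t' (.comp C) →
      EEq Γ Δ (.copowlet s t) (.copowlet s' t') (.comp C)
  | cimage_cong {Γ Δ t t' A} : EEq Γ Δ t t' (.comp .czero) →
      EEq Γ Δ (.cimage A t) (.cimage A t') (.comp A)
  | cinl_cong {Γ Δ t t' A B} : EEq Γ Δ t t' (.comp A) →
      EEq Γ Δ (.cinl t) (.cinl t') (.comp (.csum A B))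
  | cinr_cong {Γ Δ t t' A B} : EEq Γ Δ t t' (.comp B) →
      EEq Γ Δ (.cinr t) (.cinr t') (.comp (.csum A B))
  | ccase_cong {Γ Δ s s' t t' u u' A B C} : EEq Γ Δ s s' (.comp (.csum A B)) →
      EEq Γ (some A) t t' (.comp C) → EEq Γ (some B) u u' (.comp C) →
      EEq Γ Δ (.ccase s t u) (.ccase s' t' u') (.comp C)
  | llam_cong {Γ t t' A B} : EEq Γ (some A) t t' (.comp B) →
      EEq Γ none (.llam A t) (.llam A t') (.lin A B)
  | lapp_cong {Γ Δ s s' t t' A B} : EEq Γ none s s' (.lin A B) → EEq Γ Δ t t' (.comp A) →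
      EEq Γ Δ (.lapp s t) (.lapp s' t') (.comp B)
  -- the equalities of Figure 2
  | unit_eta {Γ t} : Deriv Γ none t .unit → EEq Γ none t .unit .unit
  | vfst_beta {Γ t u A B} : Deriv Γ none t A → Deriv Γ none u B →
      EEq Γ none (.vfst (.vpair t u)) t A
  | vsnd_beta {Γ t u A B} : Deriv Γ none t A → Deriv Γ none u B →
      EEq Γ none (.vsnd (.vpair t u)) u B
  | vpair_eta {Γ t A B} : Deriv Γ none t (.prod A B) →
      EEq Γ none (.vpair (.vfst t) (.vsnd t)) t (.prod A B)
  | vlam_beta {Γ t u A B} : Deriv (A :: Γ) none t B → Deriv Γ none u A →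
      EEq Γ none (.vapp (.vlam A t) u) (Tm.subst0 u t) B
  | vlam_eta {Γ t A B} : Deriv Γ none t (.arr A B) →
      EEq Γ none (.vlam A (.vapp (Tm.shift t) (.var 0))) t (.arr A B)
  | cunit_eta {Γ Δ t} : Deriv Γ Δ t (.comp .cunit) → EEq Γ Δ t .cunit (.comp .cunit)
  | cfst_beta {Γ Δ t u A B} : Deriv Γ Δ t (.comp A) → Deriv Γ Δ u (.comp B) →
      EEq Γ Δ (.cfst (.cpair t u)) t (.comp A)
  | csnd_beta {Γ Δ t u A B} : Deriv Γ Δ t (.comp A) → Deriv Γ Δ u (.comp B) →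
      EEq Γ Δ (.csnd (.cpair t u)) u (.comp B)
  | cpair_eta {Γ Δ t A B} : Deriv Γ Δ t (.comp (.cand A B)) →
      EEq Γ Δ (.cpair (.cfst t) (.csnd t)) t (.comp (.cand A B))
  | clam_beta {Γ Δ t u A B} : Deriv (A :: Γ) Δ t (.comp B) → Deriv Γ none u A →
      EEq Γ Δ (.capp (.clam A t) u) (Tm.subst0 u t) (.comp B)
  | clam_eta {Γ Δ t A B} : Deriv Γ Δ t (.comp (.carr A B)) →
      EEq Γ Δ (.clam A (.capp (Tm.shift t) (.var 0))) t (.comp (.carr A B))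
  | ilet_beta {Γ t A} : Deriv Γ none t (.comp A) →
      EEq Γ none (.ilet .top t) t (.comp A)
  | ilet_eta {Γ Δ t u A} : Deriv Γ Δ t (.comp .iunit) → Deriv Γ (some .iunit) u (.comp A) →
      EEq Γ Δ (.ilet t (Tm.ssubst .top u)) (Tm.ssubst t u) (.comp A)
  | bang_beta {Γ t u A B} : Deriv Γ none t A → Deriv (A :: Γ) none u (.comp B) →
      EEq Γ none (.banglet (.bang t) u) (Tm.subst0 t u) (.comp B)
  | bang_eta {Γ Δ t u A B} : Deriv Γ Δ t (.comp (.bang A)) →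
      Deriv Γ (some (.bang A)) u (.comp B) →
      EEq Γ Δ (.banglet t (Tm.ssubst (.bang (.var 0)) (Tm.shift u))) (Tm.ssubst t u) (.comp B)
  | copow_beta {Γ Δ t s u A B C} : Deriv Γ none t A → Deriv Γ Δ s (.comp B) →
      Deriv (A :: Γ) (some B) u (.comp C) →
      EEq Γ Δ (.copowlet (.copow t s) u) (Tm.ssubst s (Tm.subst0 t u)) (.comp C)
  | copow_eta {Γ Δ t u A B C} : Deriv Γ Δ t (.comp (.copow A B)) →
      Deriv Γ (some (.copow A B)) u (.comp C) →
      EEq Γ Δ (.copowlet t (Tm.ssubst (.copow (.var 0) .svar) (Tm.shift u))) (Tm.ssubst t u) (.comp C)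
  | czero_eta {Γ Δ t u A} : Deriv Γ Δ t (.comp .czero) → Deriv Γ (some .czero) u (.comp A) →
      EEq Γ Δ (.cimage A t) (Tm.ssubst t u) (.comp A)
  | csum_beta_inl {Γ Δ t u u' A B C} : Deriv Γ (some A) u (.comp C) →
      Deriv Γ (some B) u' (.comp C) → Deriv Γ Δ t (.comp A) →
      EEq Γ Δ (.ccase (.cinl t) u u') (Tm.ssubst t u) (.comp C)
  | csum_beta_inr {Γ Δ t u u' A B C} : Deriv Γ (some A) u (.comp C) →
      Deriv Γ (some B) u' (.comp C) → Deriv Γ Δ t (.comp B) →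
      EEq Γ Δ (.ccase (.cinr t) u u') (Tm.ssubst t u') (.comp C)
  | csum_eta {Γ Δ t u A B C} : Deriv Γ Δ t (.comp (.csum A B)) →
      Deriv Γ (some (.csum A B)) u (.comp C) →
      EEq Γ Δ (.ccase t (Tm.ssubst (.cinl .svar) u) (Tm.ssubst (.cinr .svar) u)) (Tm.ssubst t u) (.comp C)
  | llam_beta {Γ Δ t u A B} : Deriv Γ (some A) t (.comp B) → Deriv Γ Δ u (.comp A) →
      EEq Γ Δ (.lapp (.llam A t) u) (Tm.ssubst u t) (.comp B)
  | llam_eta {Γ t A B} : Deriv Γ none t (.lin A B) →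
      EEq Γ none (.llam A (.lapp t .svar)) t (.lin A B)

end EEC

namespace EEC

/-! ## The generic linear-use CPS self-translation of EEC (Figures 4–6) -/

mutual
  /-- CPS translation `Aᶜ` of value types, relative to the result type `R̲`. -/
  def cpsV (R : CType) : VType → VType
    | .base a => .base a
    | .unit => .unit
    | .prod A B => .prod (cpsV R A) (cpsV R B)
    | .arr A B => .arr (cpsV R A) (cpsV R B)
    | .comp A => .lin (cpsC R A) R
    | .lin A B => .lin (cpsC R B) (cpsC R A)
  /-- CPS translation `A̲ᶜ` of computation types, relative to the result type
  `R̲` (a computation-type constant equal to `R̲` is translated to `I̲`). -/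
  def cpsC (R : CType) : CType → CType
    | .base a =>
        match R with
        | .base b => if b = a then .iunit else .base a
        | _ => .base a
    | .cunit => .czero
    | .cand A B => .csum (cpsC R A) (cpsC R B)
    | .carr A B => .copow (cpsV R A) (cpsC R B)
    | .iunit => R
    | .bang A => .carr (cpsV R A) R
    | .copow A B => .carr (cpsV R A) (cpsC R B)
    | .czero => .cunit
    | .csum A B => .cand (cpsC R A) (cpsC R B)
end

/-- Pointwise CPS translation `Γᶜ` of a context. -/
def cpsCtx (R : CType) (Γ : List VType) : List VType := Γ.map (cpsV R)

/-- The generic linear-use CPS self-translation on terms (Figures 5 and 6 of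
the paper), defined by recursion on typing derivations.  A value judgement
`Γ ⊢ t : A` is sent to a term `tᶜ` with `Γᶜ ⊢ tᶜ : Aᶜ`, and a stoup
judgement `Γ | z:A̲ ⊢ t : B̲` is sent (contravariantly) to a term `tᶜ` with
`Γᶜ | k_z:B̲ᶜ ⊢ tᶜ : A̲ᶜ`. -/
def cps (R : CType) : {Γ : List VType} → {Δ : Option CType} → {t : Tm} → {A : VType} →
    Deriv Γ Δ t A → Tm
  | _, _, _, _, .var _ n _ _ => .var n
  | _, _, _, _, .svar _ _ => .svar
  | _, _, _, _, .unit _ => .unit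
  | _, _, _, _, .vpair _ _ _ _ _ d1 d2 => .vpair (cps R d1) (cps R d2)
  | _, _, _, _, .vfst _ _ _ _ d => .vfst (cps R d)
  | _, _, _, _, .vsnd _ _ _ _ d => .vsnd (cps R d)
  | _, _, _, _, .vlam _ _ A _ d => .vlam (cpsV R A) (cps R d)
  | _, _, _, _, .vapp _ _ _ _ _ d1 d2 => .vapp (cps R d1) (cps R d2)
  | _, _, _, _, .cunit _ none => .llam .czero (.cimage R .svar)
  | _, _, _, _, .cunit _ (some D) => .cimage (cpsC R D) .svar
  | _, _, _, _, .cpair _ none _ _ A B d1 d2 =>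
      .llam (.csum (cpsC R A) (cpsC R B))
        (.ccase .svar (.lapp (cps R d1) .svar) (.lapp (cps R d2) .svar))
  | _, _, _, _, .cpair _ (some _) _ _ _ _ d1 d2 => .ccase .svar (cps R d1) (cps R d2)
  | _, _, _, _, .cfst _ none _ A _ d => .llam (cpsC R A) (.lapp (cps R d) (.cinl .svar))
  | _, _, _, _, .cfst _ (some _) _ _ _ d => Tm.ssubst (.cinl .svar) (cps R d)
  | _, _, _, _, .csnd _ none _ _ B d => .llam (cpsC R B) (.lapp (cps R d) (.cinr .svar))
  | _, _, _, _, .csnd _ (some _) _ _ _ d => Tm.ssubst (.cinr .svar) (cps R d)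
  | _, _, _, _, .clam _ none _ A B d =>
      .llam (.copow (cpsV R A) (cpsC R B)) (.copowlet .svar (.lapp (cps R d) .svar))
  | _, _, _, _, .clam _ (some _) _ _ _ d => .copowlet .svar (cps R d)
  | _, _, _, _, .capp _ none _ _ _ B d1 d2 =>
      .llam (cpsC R B) (.lapp (cps R d1) (.copow (cps R d2) .svar))
  | _, _, _, _, .capp _ (some _) _ _ _ _ d1 d2 =>
      Tm.ssubst (.copow (cps R d2) .svar) (cps R d1)
  | _, _, _, _, .top _ => .llam R .svar
  | _, _, _, _, .ilet _ none _ _ A d1 d2 =>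
      .llam (cpsC R A) (.lapp (cps R d1) (.lapp (cps R d2) .svar))
  | _, _, _, _, .ilet _ (some _) _ _ _ d1 d2 =>
      Tm.ssubst (.lapp (cps R d2) .svar) (cps R d1)
  | _, _, _, _, .bang _ _ A d => .llam (.carr (cpsV R A) R) (.capp .svar (cps R d))
  | _, _, _, _, .banglet _ none _ _ A B d1 d2 =>
      .llam (cpsC R B) (.lapp (cps R d1) (.clam (cpsV R A) (.lapp (cps R d2) .svar)))
  | _, _, _, _, .banglet _ (some _) _ _ A _ d1 d2 =>
      Tm.ssubst (.clam (cpsV R A) (.lapp (cps R d2) .svar)) (cps R d1)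
  | _, _, _, _, .copow _ none _ _ A B d1 d2 =>
      .llam (.carr (cpsV R A) (cpsC R B)) (.lapp (cps R d2) (.capp .svar (cps R d1)))
  | _, _, _, _, .copow _ (some _) _ _ _ _ d1 d2 =>
      Tm.ssubst (.capp .svar (cps R d1)) (cps R d2)
  | _, _, _, _, .copowlet _ none _ _ A _ C d1 d2 =>
      .llam (cpsC R C) (.lapp (cps R d1) (.clam (cpsV R A) (cps R d2)))
  | _, _, _, _, .copowlet _ (some _) _ _ A _ _ d1 d2 =>
      Tm.ssubst (.clam (cpsV R A) (cps R d2)) (cps R d1)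
  | _, _, _, _, .cimage _ none _ A d => .llam (cpsC R A) (.lapp (cps R d) .cunit)
  | _, _, _, _, .cimage _ (some _) _ _ d => Tm.ssubst .cunit (cps R d)
  | _, _, _, _, .cinl _ none _ A B d =>
      .llam (.cand (cpsC R A) (cpsC R B)) (.lapp (cps R d) (.cfst .svar))
  | _, _, _, _, .cinl _ (some _) _ _ _ d => Tm.ssubst (.cfst .svar) (cps R d)
  | _, _, _, _, .cinr _ none _ A B d =>
      .llam (.cand (cpsC R A) (cpsC R B)) (.lapp (cps R d) (.csnd .svar))
  | _, _, _, _, .cinr _ (some _) _ _ _ d => Tm.ssubst (.csnd .svar) (cps R d)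
  | _, _, _, _, .ccase _ none _ _ _ _ _ C d1 d2 d3 =>
      .llam (cpsC R C) (.lapp (cps R d1) (.cpair (cps R d2) (cps R d3)))
  | _, _, _, _, .ccase _ (some _) _ _ _ _ _ _ d1 d2 d3 =>
      Tm.ssubst (.cpair (cps R d2) (cps R d3)) (cps R d1)
  | _, _, _, _, .llam _ _ _ B d => .llam (cpsC R B) (cps R d)
  | _, _, _, _, .lapp _ none _ _ _ B d1 d2 =>
      .llam (cpsC R B) (.lapp (cps R d2) (.lapp (cps R d1) .svar))
  | _, _, _, _, .lapp _ (some _) _ _ _ _ d1 d2 =>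
      Tm.ssubst (.lapp (cps R d1) .svar) (cps R d2)

end EEC

namespace EEC

/-! ## The type isomorphisms `ι` of Figure 7, with explicit inverses -/

mutual
  /-- The closed term `ι_A : (Aᶜ)ᶜ → A` (Figure 7). -/
  def iotaV (R : CType) : VType → Tm
    | .base a => .vlam (.base a) (.var 0)
    | .unit => .vlam .unit .unit
    | .prod A B => .vlam (cpsV R (cpsV R (.prod A B)))
        (.vpair (.vapp (iotaV R A) (.vfst (.var 0))) (.vapp (iotaV R B) (.vsnd (.var 0))))
    | .arr A B => .vlam (cpsV R (cpsV R (.arr A B)))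
        (.vlam A (.vapp (iotaV R B) (.vapp (.var 1) (.vapp (iotaVinv R A) (.var 0)))))
    | .comp A => .vlam (cpsV R (cpsV R (.comp A)))
        (.lapp (iotaC R A) (.lapp (.var 0) .top))
    | .lin A B => .vlam (cpsV R (cpsV R (.lin A B)))
        (.llam A (.lapp (iotaC R B) (.lapp (.var 0) (.lapp (iotaCinv R A) .svar))))
  /-- The closed term `ι_A⁻¹ : A → (Aᶜ)ᶜ`. -/
  def iotaVinv (R : CType) : VType → Tm
    | .base a => .vlam (.base a) (.var 0)
    | .unit => .vlam .unit .unit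
    | .prod A B => .vlam (.prod A B)
        (.vpair (.vapp (iotaVinv R A) (.vfst (.var 0))) (.vapp (iotaVinv R B) (.vsnd (.var 0))))
    | .arr A B => .vlam (.arr A B)
        (.vlam (cpsV R (cpsV R A)) (.vapp (iotaVinv R B) (.vapp (.var 1) (.vapp (iotaV R A) (.var 0)))))
    | .comp A => .vlam (.comp A)
        (.llam .iunit (.ilet .svar (.lapp (iotaCinv R A) (.var 0))))
    | .lin A B => .vlam (.lin A B)
        (.llam (cpsC R (cpsC R A)) (.lapp (iotaCinv R B) (.lapp (.var 0) (.lapp (iotaC R A) .svar))))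
  /-- The closed term `ι_A̲ : (A̲ᶜ)ᶜ ⊸ A̲` (Figure 7). -/
  def iotaC (R : CType) : CType → Tm
    | .base a => .llam (cpsC R (cpsC R (.base a))) .svar
    | .cunit => .llam (cpsC R (cpsC R .cunit)) .cunit
    | .cand A B => .llam (cpsC R (cpsC R (.cand A B)))
        (.cpair (.lapp (iotaC R A) (.cfst .svar)) (.lapp (iotaC R B) (.csnd .svar)))
    | .carr A B => .llam (cpsC R (cpsC R (.carr A B)))
        (.clam A (.lapp (iotaC R B) (.capp .svar (.vapp (iotaVinv R A) (.var 0)))))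
    | .iunit => .llam (cpsC R (cpsC R .iunit)) .svar
    | .bang A => .llam (cpsC R (cpsC R (.bang A)))
        (.copowlet .svar (.ilet .svar (.bang (.vapp (iotaV R A) (.var 0)))))
    | .copow A B => .llam (cpsC R (cpsC R (.copow A B)))
        (.copowlet .svar (.copow (.vapp (iotaV R A) (.var 0)) (.lapp (iotaC R B) .svar)))
    | .czero => .llam (cpsC R (cpsC R .czero)) .svar
    | .csum A B => .llam (cpsC R (cpsC R (.csum A B)))
        (.ccase .svar (.cinl (.lapp (iotaC R A) .svar)) (.cinr (.lapp (iotaC R B) .svar)))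
  /-- The closed term `ι_A̲⁻¹ : A̲ ⊸ (A̲ᶜ)ᶜ`. -/
  def iotaCinv (R : CType) : CType → Tm
    | .base a => .llam (.base a) .svar
    | .cunit => .llam .cunit .cunit
    | .cand A B => .llam (.cand A B)
        (.cpair (.lapp (iotaCinv R A) (.cfst .svar)) (.lapp (iotaCinv R B) (.csnd .svar)))
    | .carr A B => .llam (.carr A B)
        (.clam (cpsV R (cpsV R A)) (.lapp (iotaCinv R B) (.capp .svar (.vapp (iotaV R A) (.var 0)))))
    | .iunit => .llam .iunit .svar
    | .bang A => .llam (.bang A)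
        (.banglet .svar (.copow (.vapp (iotaVinv R A) (.var 0)) .top))
    | .copow A B => .llam (.copow A B)
        (.copowlet .svar (.copow (.vapp (iotaVinv R A) (.var 0)) (.lapp (iotaCinv R B) .svar)))
    | .czero => .llam .czero .svar
    | .csum A B => .llam (.csum A B)
        (.ccase .svar (.cinl (.lapp (iotaCinv R A) .svar)) (.cinr (.lapp (iotaCinv R B) .svar)))
end

/-- The substitution `[ι⁻¹(Γ)]`, replacing each variable `xᵢ : Cᵢ` of `Γ` by
`ι_{Cᵢ}⁻¹(xᵢ)`. -/
def iotaSubst (R : CType) (Γ : List VType) (t : Tm) : Tm :=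
  Tm.psubst (fun n =>
    match Γ[n]? with
    | some C => .vapp (iotaVinv R C) (.var n)
    | none => .var n) t

/-! ## The simply-typed λ-calculus -/

/-- Simple types. -/
inductive STy : Type
  | base : ℕ → STy
  | unit : STy
  | prod : STy → STy → STy
  | arr : STy → STy → STy

/-- Raw simply-typed λ-terms (de Bruijn indices). -/
inductive LTm : Type
  | var : ℕ → LTm
  | unit : LTm
  | pair : LTm → LTm → LTm
  | fst : LTm → LTm
  | snd : LTm → LTm
  | lam : STy → LTm → LTm
  | app : LTm → LTm → LTm

namespace LTm

/-- Renaming of variables. -/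
def rename (f : ℕ → ℕ) : LTm → LTm
  | .var n => .var (f n)
  | .unit => .unit
  | .pair M N => .pair (rename f M) (rename f N)
  | .fst M => .fst (rename f M)
  | .snd M => .snd (rename f M)
  | .lam σ M => .lam σ (rename (Tm.liftN f) M)
  | .app M N => .app (rename f M) (rename f N)

/-- Weakening. -/
def shift (M : LTm) : LTm := rename Nat.succ M

/-- Parallel capture-avoiding substitution. -/
def psubst (σ : ℕ → LTm) : LTm → LTm
  | .var n => σ n
  | .unit => .unit
  | .pair M N => .pair (psubst σ M) (psubst σ N)
  | .fst M => .fst (psubst σ M)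
  | .snd M => .snd (psubst σ M)
  | .lam τ M => .lam τ (psubst (fun n => match n with | 0 => .var 0 | m + 1 => shift (σ m)) M)
  | .app M N => .app (psubst σ M) (psubst σ N)

/-- Capture-avoiding substitution `M[N/x]` for the innermost variable. -/
def subst0 (N : LTm) (M : LTm) : LTm :=
  psubst (fun n => match n with | 0 => N | m + 1 => .var m) M

end LTm

/-- Typing derivations of the simply-typed λ-calculus (Figure 3). -/
inductive LDeriv : List STy → LTm → STy → Type
  | var (Θ : List STy) (n : ℕ) (σ : STy) : Θ[n]? = some σ → LDeriv Θ (.var n) σ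
  | unit (Θ : List STy) : LDeriv Θ .unit .unit
  | pair (Θ : List STy) (M N : LTm) (σ τ : STy) :
      LDeriv Θ M σ → LDeriv Θ N τ → LDeriv Θ (.pair M N) (.prod σ τ)
  | fst (Θ : List STy) (M : LTm) (σ τ : STy) :
      LDeriv Θ M (.prod σ τ) → LDeriv Θ (.fst M) σ
  | snd (Θ : List STy) (M : LTm) (σ τ : STy) :
      LDeriv Θ M (.prod σ τ) → LDeriv Θ (.snd M) τ
  | lam (Θ : List STy) (M : LTm) (σ τ : STy) :
      LDeriv (σ :: Θ) M τ → LDeriv Θ (.lam σ M) (.arr σ τ)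
  | app (Θ : List STy) (M N : LTm) (σ τ : STy) :
      LDeriv Θ M (.arr σ τ) → LDeriv Θ N σ → LDeriv Θ (.app M N) τ

/-- Values of the (call-by-value) λ-calculus. -/
inductive LVal : LTm → Prop
  | var (n : ℕ) : LVal (.var n)
  | unit : LVal .unit
  | lam (σ : STy) (M : LTm) : LVal (.lam σ M)
  | pair {M N : LTm} : LVal M → LVal N → LVal (.pair M N)

/-- βη-equality of the simply-typed λ-calculus. -/
inductive LBetaEta : List STy → LTm → LTm → STy → Prop
  | refl {Θ M σ} : LDeriv Θ M σ → LBetaEta Θ M M σ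
  | symm {Θ M N σ} : LBetaEta Θ M N σ → LBetaEta Θ N M σ
  | trans {Θ M N P σ} : LBetaEta Θ M N σ → LBetaEta Θ N P σ → LBetaEta Θ M P σ
  | pair_cong {Θ M M' N N' σ τ} : LBetaEta Θ M M' σ → LBetaEta Θ N N' τ →
      LBetaEta Θ (.pair M N) (.pair M' N') (.prod σ τ)
  | fst_cong {Θ M M' σ τ} : LBetaEta Θ M M' (.prod σ τ) → LBetaEta Θ (.fst M) (.fst M') σ
  | snd_cong {Θ M M' σ τ} : LBetaEta Θ M M' (.prod σ τ) → LBetaEta Θ (.snd M) (.snd M') τ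
  | lam_cong {Θ M M' σ τ} : LBetaEta (σ :: Θ) M M' τ →
      LBetaEta Θ (.lam σ M) (.lam σ M') (.arr σ τ)
  | app_cong {Θ M M' N N' σ τ} : LBetaEta Θ M M' (.arr σ τ) → LBetaEta Θ N N' σ →
      LBetaEta Θ (.app M N) (.app M' N') τ
  | beta {Θ M N σ τ} : LDeriv (σ :: Θ) M τ → LDeriv Θ N σ →
      LBetaEta Θ (.app (.lam σ M) N) (LTm.subst0 N M) τ
  | eta {Θ M σ τ} : LDeriv Θ M (.arr σ τ) →
      LBetaEta Θ (.lam σ (.app (LTm.shift M) (.var 0))) M (.arr σ τ)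
  | fst_beta {Θ M N σ τ} : LDeriv Θ M σ → LDeriv Θ N τ →
      LBetaEta Θ (.fst (.pair M N)) M σ
  | snd_beta {Θ M N σ τ} : LDeriv Θ M σ → LDeriv Θ N τ →
      LBetaEta Θ (.snd (.pair M N)) N τ
  | pair_eta {Θ M σ τ} : LDeriv Θ M (.prod σ τ) →
      LBetaEta Θ (.pair (.fst M) (.snd M)) M (.prod σ τ)
  | unit_eta {Θ M} : LDeriv Θ M .unit → LBetaEta Θ M .unit .unit

/-- Equality in Moggi's computational λ-calculus `λc` (call-by-value
βη-equalities restricted to values, together with the `let`-laws, expressed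
via the standard encoding `let x = M in N := (λx.N) M`). -/
inductive LamC : List STy → LTm → LTm → STy → Prop
  | refl {Θ M σ} : LDeriv Θ M σ → LamC Θ M M σ
  | symm {Θ M N σ} : LamC Θ M N σ → LamC Θ N M σ
  | trans {Θ M N P σ} : LamC Θ M N σ → LamC Θ N P σ → LamC Θ M P σ
  | pair_cong {Θ M M' N N' σ τ} : LamC Θ M M' σ → LamC Θ N N' τ →
      LamC Θ (.pair M N) (.pair M' N') (.prod σ τ)
  | fst_cong {Θ M M' σ τ} : LamC Θ M M' (.prod σ τ) → LamC Θ (.fst M) (.fst M') σ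
  | snd_cong {Θ M M' σ τ} : LamC Θ M M' (.prod σ τ) → LamC Θ (.snd M) (.snd M') τ
  | lam_cong {Θ M M' σ τ} : LamC (σ :: Θ) M M' τ →
      LamC Θ (.lam σ M) (.lam σ M') (.arr σ τ)
  | app_cong {Θ M M' N N' σ τ} : LamC Θ M M' (.arr σ τ) → LamC Θ N N' σ →
      LamC Θ (.app M N) (.app M' N') τ
  | beta_v {Θ M V σ τ} : LDeriv (σ :: Θ) M τ → LDeriv Θ V σ → LVal V →
      LamC Θ (.app (.lam σ M) V) (LTm.subst0 V M) τ
  | eta_v {Θ V σ τ} : LVal V → LDeriv Θ V (.arr σ τ) →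
      LamC Θ (.lam σ (.app (LTm.shift V) (.var 0))) V (.arr σ τ)
  | fst_beta_v {Θ V W σ τ} : LVal V → LVal W → LDeriv Θ V σ → LDeriv Θ W τ →
      LamC Θ (.fst (.pair V W)) V σ
  | snd_beta_v {Θ V W σ τ} : LVal V → LVal W → LDeriv Θ V σ → LDeriv Θ W τ →
      LamC Θ (.snd (.pair V W)) W τ
  | pair_eta_v {Θ V σ τ} : LVal V → LDeriv Θ V (.prod σ τ) →
      LamC Θ (.pair (.fst V) (.snd V)) V (.prod σ τ)
  | unit_eta_v {Θ V} : LVal V → LDeriv Θ V .unit → LamC Θ V .unit .unit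
  | let_eta {Θ M σ} : LDeriv Θ M σ → LamC Θ (.app (.lam σ (.var 0)) M) M σ
  | let_assoc {Θ M N L σ ρ τ} : LDeriv (σ :: Θ) M τ → LDeriv (ρ :: Θ) N σ →
      LDeriv Θ L ρ →
      LamC Θ (.app (.lam σ M) (.app (.lam ρ N) L))
        (.app (.lam ρ (.app (.lam σ (LTm.rename (Tm.liftN Nat.succ) M)) N)) L) τ
  | app_left {Θ M N σ τ} : LDeriv Θ M (.arr σ τ) → LDeriv Θ N σ →
      LamC Θ (.app M N) (.app (.lam (.arr σ τ) (.app (.var 0) (LTm.shift N))) M) τ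
  | app_right {Θ V N σ τ} : LVal V → LDeriv Θ V (.arr σ τ) → LDeriv Θ N σ →
      LamC Θ (.app V N) (.app (.lam σ (.app (LTm.shift V) (.var 0))) N) τ
  | pair_left {Θ M N σ τ} : LDeriv Θ M σ → LDeriv Θ N τ →
      LamC Θ (.pair M N) (.app (.lam σ (.pair (.var 0) (LTm.shift N))) M) (.prod σ τ)
  | pair_right {Θ V N σ τ} : LVal V → LDeriv Θ V σ → LDeriv Θ N τ →
      LamC Θ (.pair V N) (.app (.lam τ (.pair (LTm.shift V) (.var 0))) N) (.prod σ τ)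
  | fst_cc {Θ M σ τ} : LDeriv Θ M (.prod σ τ) →
      LamC Θ (.fst M) (.app (.lam (.prod σ τ) (.fst (.var 0))) M) σ
  | snd_cc {Θ M σ τ} : LDeriv Θ M (.prod σ τ) →
      LamC Θ (.snd M) (.app (.lam (.prod σ τ) (.snd (.var 0))) M) τ

end EEC

namespace EEC

/-! ## The standard cbv and cbn translations of typed λ-calculus into EEC -/

/-- The computation-type constant `α̲` associated with a simply-typed
λ-calculus type constant `α` (the association is injective but not
surjective, so that some computation-type constants of EEC are different
from `α̲` for every λ-calculus type constant `α`). -/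
def assocC (a : ℕ) : CType := .base (a + 1)

/-- The call-by-value translation `σᵛ` on types. -/
def cbvT : STy → VType
  | .base a => .base a
  | .unit => .unit
  | .prod σ τ => .prod (cbvT σ) (cbvT τ)
  | .arr σ τ => .arr (cbvT σ) (.comp (.bang (cbvT τ)))

/-- The call-by-value translation `Θᵛ` on contexts. -/
def cbvCtx (Θ : List STy) : List VType := Θ.map cbvT

/-- The call-by-value translation on terms: `Θ ⊢ M : τ` is sent to
`Θᵛ ⊢ Mᵛ : !(τᵛ)`. -/
def cbvTm : LTm → Tm
  | .var n => .bang (.var n)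
  | .unit => .bang .unit
  | .pair M N => .banglet (cbvTm M) (.banglet (Tm.shift (cbvTm N)) (.bang (.vpair (.var 1) (.var 0))))
  | .fst M => .banglet (cbvTm M) (.bang (.vfst (.var 0)))
  | .snd M => .banglet (cbvTm M) (.bang (.vsnd (.var 0)))
  | .lam σ M => .bang (.vlam (cbvT σ) (cbvTm M))
  | .app M N => .banglet (cbvTm M) (.banglet (Tm.shift (cbvTm N)) (.vapp (.var 1) (.var 0)))

/-- The call-by-name translation `σⁿ` on types. -/
def cbnT : STy → CType
  | .base a => assocC a
  | .unit => .cunit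
  | .prod σ τ => .cand (cbnT σ) (cbnT τ)
  | .arr σ τ => .carr (.comp (cbnT σ)) (cbnT τ)

/-- The call-by-name translation `Θⁿ` on contexts. -/
def cbnCtx (Θ : List STy) : List VType := Θ.map (fun σ => .comp (cbnT σ))

/-- The call-by-name translation on terms: `Θ ⊢ M : τ` is sent to
`Θⁿ ⊢ Mⁿ : τⁿ`, mimicking each construct by the corresponding
computation-type construct of EEC. -/
def cbnTm : LTm → Tm
  | .var n => .var n
  | .unit => .cunit
  | .pair M N => .cpair (cbnTm M) (cbnTm N)
  | .fst M => .cfst (cbnTm M)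
  | .snd M => .csnd (cbnTm M)
  | .lam σ M => .clam (.comp (cbnT σ)) (cbnTm M)
  | .app M N => .capp (cbnTm M) (cbnTm N)

/-! ## Hasegawa's linear-use CPS translations (Section 4) -/

/-- The call-by-value linear-use CPS translation `σᵛᶜ` on types. -/
def cbvcpsT (R : CType) : STy → VType
  | .base a => .base a
  | .unit => .unit
  | .prod σ τ => .prod (cbvcpsT R σ) (cbvcpsT R τ)
  | .arr σ τ => .arr (cbvcpsT R σ) (.lin (.carr (cbvcpsT R τ) R) R)

/-- `Θᵛᶜ`. -/
def cbvcpsCtx (R : CType) (Θ : List STy) : List VType := Θ.map (cbvcpsT R)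

/-- The call-by-value linear-use CPS translation on terms: `Θ ⊢ M : τ` is
sent to `Θᵛᶜ ⊢ Mᵛᶜ : (τᵛᶜ ⇒ R̲) ⊸ R̲`. -/
def cbvcps (R : CType) : {Θ : List STy} → {M : LTm} → {σ : STy} → LDeriv Θ M σ → Tm
  | _, _, _, .var _ n σ _ => .llam (.carr (cbvcpsT R σ) R) (.capp .svar (.var n))
  | _, _, _, .unit _ => .llam (.carr .unit R) (.capp .svar .unit)
  | _, _, _, .pair _ _ _ σ τ dM dN =>
      .llam (.carr (.prod (cbvcpsT R σ) (cbvcpsT R τ)) R)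
        (.lapp (cbvcps R dM)
          (.clam (cbvcpsT R σ)
            (.lapp (Tm.shift (cbvcps R dN))
              (.clam (cbvcpsT R τ) (.capp .svar (.vpair (.var 1) (.var 0)))))))
  | _, _, _, .fst _ _ σ τ dM =>
      .llam (.carr (cbvcpsT R σ) R)
        (.lapp (cbvcps R dM)
          (.clam (.prod (cbvcpsT R σ) (cbvcpsT R τ)) (.capp .svar (.vfst (.var 0)))))
  | _, _, _, .snd _ _ σ τ dM =>
      .llam (.carr (cbvcpsT R τ) R)
        (.lapp (cbvcps R dM)
          (.clam (.prod (cbvcpsT R σ) (cbvcpsT R τ)) (.capp .svar (.vsnd (.var 0)))))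
  | _, _, _, .lam _ _ σ τ dM =>
      .llam (.carr (.arr (cbvcpsT R σ) (.lin (.carr (cbvcpsT R τ) R) R)) R)
        (.capp .svar (.vlam (cbvcpsT R σ) (cbvcps R dM)))
  | _, _, _, .app _ _ _ σ τ dM dN =>
      .llam (.carr (cbvcpsT R τ) R)
        (.lapp (cbvcps R dM)
          (.clam (.arr (cbvcpsT R σ) (.lin (.carr (cbvcpsT R τ) R) R))
            (.lapp (Tm.shift (cbvcps R dN))
              (.clam (cbvcpsT R σ) (.lapp (.vapp (.var 1) (.var 0)) .svar)))))

/-- The call-by-name linear-use CPS translation `σⁿᶜ` on types. -/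
def cbncpsT (R : CType) : STy → CType
  | .base a => assocC a
  | .unit => .czero
  | .prod σ τ => .csum (cbncpsT R σ) (cbncpsT R τ)
  | .arr σ τ => .copow (.lin (cbncpsT R σ) R) (cbncpsT R τ)

/-- `Θⁿᶜ ⊸ R̲`, assigning each variable `xᵢ : σᵢ` the type `σᵢⁿᶜ ⊸ R̲`. -/
def cbncpsCtx (R : CType) (Θ : List STy) : List VType :=
  Θ.map (fun σ => .lin (cbncpsT R σ) R)

/-- The call-by-name linear-use CPS translation on terms: `Θ ⊢ M : τ` is
sent to `Θⁿᶜ ⊸ R̲ ⊢ Mⁿᶜ : τⁿᶜ ⊸ R̲`. -/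
def cbncps (R : CType) : {Θ : List STy} → {M : LTm} → {σ : STy} → LDeriv Θ M σ → Tm
  | _, _, _, .var _ n _ _ => .var n
  | _, _, _, .unit _ => .llam .czero (.cimage R .svar)
  | _, _, _, .pair _ _ _ σ τ dM dN =>
      .llam (.csum (cbncpsT R σ) (cbncpsT R τ))
        (.ccase .svar (.lapp (cbncps R dM) .svar) (.lapp (cbncps R dN) .svar))
  | _, _, _, .fst _ _ σ _τ dM => .llam (cbncpsT R σ) (.lapp (cbncps R dM) (.cinl .svar))
  | _, _, _, .snd _ _ _ τ dM => .llam (cbncpsT R τ) (.lapp (cbncps R dM) (.cinr .svar))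
  | _, _, _, .lam _ _ σ τ dM =>
      .llam (.copow (.lin (cbncpsT R σ) R) (cbncpsT R τ))
        (.copowlet .svar (.lapp (cbncps R dM) .svar))
  | _, _, _, .app _ _ _ σ τ dM dN =>
      .llam (cbncpsT R τ) (.lapp (cbncps R dM) (.copow (cbncps R dN) .svar))

end EEC

namespace EEC

/-! ## Substitution calculus for raw EEC terms -/

namespace Tm

/-- The substitution sending variable `0` to `u` and variable `n + 1` to `σ n`. -/
def scons (u : Tm) (σ : ℕ → Tm) : ℕ → Tm
  | 0 => u
  | n + 1 => σ n

theorem subst0_eq (u t : Tm) : subst0 u t = psubst (scons u .var) t := by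
  unfold subst0
  congr 1

theorem liftN_id : liftN id = id := by
  funext n
  cases n <;> rfl

theorem liftN_comp (f g : ℕ → ℕ) : liftN f ∘ liftN g = liftN (f ∘ g) := by
  funext n
  cases n <;> rfl

theorem rename_id (t : Tm) : rename id t = t := by
  induction t <;> simp_all [rename, liftN_id]

theorem rename_rename (t : Tm) (f g : ℕ → ℕ) :
    rename f (rename g t) = rename (f ∘ g) t := by
  induction t generalizing f g <;> simp_all [rename, ← liftN_comp]

theorem rename_liftN_shift (f : ℕ → ℕ) (t : Tm) :
    rename (liftN f) (shift t) = shift (rename f t) := by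
  simp only [shift, rename_rename]
  rfl

theorem liftS_comp_liftN (σ : ℕ → Tm) (f : ℕ → ℕ) :
    liftS σ ∘ liftN f = liftS (σ ∘ f) := by
  funext n
  cases n <;> rfl

theorem psubst_rename (t : Tm) (σ : ℕ → Tm) (f : ℕ → ℕ) :
    psubst σ (rename f t) = psubst (σ ∘ f) t := by
  induction t generalizing σ f <;> simp_all [rename, psubst, ← liftS_comp_liftN]

theorem rename_comp_liftS (f : ℕ → ℕ) (σ : ℕ → Tm) :
    rename (liftN f) ∘ liftS σ = liftS (rename f ∘ σ) := by
  funext n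
  cases n
  · rfl
  · exact rename_liftN_shift f _

theorem rename_psubst (t : Tm) (f : ℕ → ℕ) (σ : ℕ → Tm) :
    rename f (psubst σ t) = psubst (rename f ∘ σ) t := by
  induction t generalizing σ f <;> simp_all [rename, psubst, ← rename_comp_liftS]

theorem psubst_liftS_shift (σ : ℕ → Tm) (t : Tm) :
    psubst (liftS σ) (shift t) = shift (psubst σ t) := by
  simp only [shift, rename_psubst, psubst_rename]
  rfl

theorem psubst_comp_liftS (τ σ : ℕ → Tm) :
    psubst (liftS τ) ∘ liftS σ = liftS (psubst τ ∘ σ) := by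
  funext n
  cases n
  · rfl
  · exact psubst_liftS_shift τ _

theorem psubst_psubst (t : Tm) (τ σ : ℕ → Tm) :
    psubst τ (psubst σ t) = psubst (psubst τ ∘ σ) t := by
  induction t generalizing τ σ <;> simp_all [psubst, ← psubst_comp_liftS]

theorem liftS_var : liftS .var = .var := by
  funext n
  cases n <;> rfl

theorem psubst_var (t : Tm) : psubst .var t = t := by
  induction t <;> simp_all [psubst, liftS_var]

theorem scons_comp_succ (u : Tm) (σ : ℕ → Tm) : scons u σ ∘ Nat.succ = σ := rfl

theorem subst0_shift (u t : Tm) : subst0 u (shift t) = t := by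
  rw [subst0_eq, shift, psubst_rename, scons_comp_succ, psubst_var]

theorem subst0_psubst_liftS (u t : Tm) (σ : ℕ → Tm) :
    subst0 u (psubst (liftS σ) t) = psubst (scons u σ) t := by
  rw [subst0_eq, psubst_psubst]
  congr 1
  funext n
  cases n with
  | zero => rfl
  | succ n =>
    have := subst0_shift u (σ n)
    rwa [subst0_eq] at this

theorem rename_subst0 (f : ℕ → ℕ) (u t : Tm) :
    rename f (subst0 u t) = subst0 (rename f u) (rename (liftN f) t) := by
  rw [subst0_eq, subst0_eq, rename_psubst, psubst_rename]
  congr 1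
  funext n
  cases n <;> rfl

theorem shift_rename (f : ℕ → ℕ) (t : Tm) : shift (rename f t) = rename (liftN f) (shift t) :=
  (rename_liftN_shift f t).symm

theorem rename_ssubst (t : Tm) (f : ℕ → ℕ) (u : Tm) :
    rename f (ssubst u t) = ssubst (rename f u) (rename f t) := by
  induction t generalizing f u <;> simp_all [rename, ssubst, shift_rename]

theorem ssubst_svar (t : Tm) : ssubst .svar t = t := by
  have h : shift .svar = .svar := rfl
  induction t <;> simp_all [ssubst]

end Tm

/-- Derivability of a typing judgement. -/
abbrev Has (Γ : List VType) (Δ : Option CType) (t : Tm) (A : VType) : Prop :=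
  Nonempty (Deriv Γ Δ t A)

/-- `f` renames the variables of `Γ` to variables of `Γ'` of the same type. -/
def IsRen {T : Type} (Γ Γ' : List T) (f : ℕ → ℕ) : Prop :=
  ∀ n A, Γ[n]? = some A → Γ'[f n]? = some A

theorem IsRen.lift {T : Type} {Γ Γ' : List T} {f : ℕ → ℕ} (h : IsRen Γ Γ' f) (A : T) :
    IsRen (A :: Γ) (A :: Γ') (Tm.liftN f) := by
  intro n B hn
  cases n with
  | zero => simpa [Tm.liftN] using hn
  | succ n => simpa [Tm.liftN] using h n B (by simpa using hn)

theorem IsRen.succ {T : Type} (Γ : List T) (A : T) : IsRen Γ (A :: Γ) Nat.succ := by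
  intro n B hn
  simpa using hn

theorem IsRen.of_isPrefix {T : Type} {Γ Γ' : List T} (h : Γ <+: Γ') : IsRen Γ Γ' id := by
  intro n B hn
  obtain ⟨Ξ, rfl⟩ := h
  rw [id, List.getElem?_append_left, hn]
  exact (List.getElem?_eq_some_iff.mp hn).1

theorem Has.rename {Γ Γ' : List VType} {Δ : Option CType} {t : Tm} {A : VType} {f : ℕ → ℕ}
    (h : Has Γ Δ t A) (hf : IsRen Γ Γ' f) : Has Γ' Δ (t.rename f) A := by
  obtain ⟨d⟩ := h
  induction d generalizing Γ' f with
  | var Γ n A h => exact ⟨.var _ _ _ (hf _ _ h)⟩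
  | svar => exact ⟨.svar _ _⟩
  | unit => exact ⟨.unit _⟩
  | vpair _ _ _ _ _ _ _ i1 i2 => exact ⟨.vpair _ _ _ _ _ (i1 hf).some (i2 hf).some⟩
  | vfst _ _ _ _ _ i => exact ⟨.vfst _ _ _ _ (i hf).some⟩
  | vsnd _ _ _ _ _ i => exact ⟨.vsnd _ _ _ _ (i hf).some⟩
  | vlam _ _ _ _ _ i => exact ⟨.vlam _ _ _ _ (i (hf.lift _)).some⟩
  | vapp _ _ _ _ _ _ _ i1 i2 => exact ⟨.vapp _ _ _ _ _ (i1 hf).some (i2 hf).some⟩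
  | cunit => exact ⟨.cunit _ _⟩
  | cpair _ _ _ _ _ _ _ _ i1 i2 => exact ⟨.cpair _ _ _ _ _ _ (i1 hf).some (i2 hf).some⟩
  | cfst _ _ _ _ _ _ i => exact ⟨.cfst _ _ _ _ _ (i hf).some⟩
  | csnd _ _ _ _ _ _ i => exact ⟨.csnd _ _ _ _ _ (i hf).some⟩
  | clam _ _ _ _ _ _ i => exact ⟨.clam _ _ _ _ _ (i (hf.lift _)).some⟩
  | capp _ _ _ _ _ _ _ _ i1 i2 => exact ⟨.capp _ _ _ _ _ _ (i1 hf).some (i2 hf).some⟩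
  | top => exact ⟨.top _⟩
  | ilet _ _ _ _ _ _ _ i1 i2 => exact ⟨.ilet _ _ _ _ _ (i1 hf).some (i2 hf).some⟩
  | bang _ _ _ _ i => exact ⟨.bang _ _ _ (i hf).some⟩
  | banglet _ _ _ _ _ _ _ _ i1 i2 =>
    exact ⟨.banglet _ _ _ _ _ _ (i1 hf).some (i2 (hf.lift _)).some⟩
  | copow _ _ _ _ _ _ _ _ i1 i2 => exact ⟨.copow _ _ _ _ _ _ (i1 hf).some (i2 hf).some⟩
  | copowlet _ _ _ _ _ _ _ _ _ i1 i2 =>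
    exact ⟨.copowlet _ _ _ _ _ _ _ (i1 hf).some (i2 (hf.lift _)).some⟩
  | cimage _ _ _ _ _ i => exact ⟨.cimage _ _ _ _ (i hf).some⟩
  | cinl _ _ _ _ _ _ i => exact ⟨.cinl _ _ _ _ _ (i hf).some⟩
  | cinr _ _ _ _ _ _ i => exact ⟨.cinr _ _ _ _ _ (i hf).some⟩
  | ccase _ _ _ _ _ _ _ _ _ _ _ i1 i2 i3 =>
    exact ⟨.ccase _ _ _ _ _ _ _ _ (i1 hf).some (i2 hf).some (i3 hf).some⟩
  | llam _ _ _ _ _ i => exact ⟨.llam _ _ _ _ (i hf).some⟩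
  | lapp _ _ _ _ _ _ _ _ i1 i2 => exact ⟨.lapp _ _ _ _ _ _ (i1 hf).some (i2 hf).some⟩

theorem Has.shift {Γ : List VType} {Δ : Option CType} {t : Tm} {A : VType}
    (h : Has Γ Δ t A) (B : VType) : Has (B :: Γ) Δ t.shift A :=
  h.rename (IsRen.succ Γ B)

/-- `σ` is a well-typed substitution for the variables of `Γ` by value terms over `Γ'`. -/
def IsSub (Γ Γ' : List VType) (σ : ℕ → Tm) : Prop :=
  ∀ n A, Γ[n]? = some A → Has Γ' none (σ n) A

theorem IsSub.lift {Γ Γ' : List VType} {σ : ℕ → Tm} (h : IsSub Γ Γ' σ) (A : VType) :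
    IsSub (A :: Γ) (A :: Γ') (Tm.liftS σ) := by
  intro n B hn
  cases n with
  | zero => exact ⟨.var _ _ _ hn⟩
  | succ n => exact (h n B (by simpa using hn)).shift A

theorem IsSub.scons {Γ Γ' : List VType} {σ : ℕ → Tm} (h : IsSub Γ Γ' σ) {A : VType} {u : Tm}
    (hu : Has Γ' none u A) : IsSub (A :: Γ) Γ' (Tm.scons u σ) := by
  intro n B hn
  cases n with
  | zero =>
    obtain rfl : A = B := by simpa using hn
    exact hu
  | succ n => exact h n B (by simpa using hn)

theorem IsSub.var (Γ : List VType) : IsSub Γ Γ .var := fun _ _ h => ⟨.var _ _ _ h⟩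

theorem Has.psubst {Γ Γ' : List VType} {Δ : Option CType} {t : Tm} {A : VType} {σ : ℕ → Tm}
    (h : Has Γ Δ t A) (hf : IsSub Γ Γ' σ) : Has Γ' Δ (t.psubst σ) A := by
  obtain ⟨d⟩ := h
  induction d generalizing Γ' σ with
  | var Γ n A h => exact hf _ _ h
  | svar => exact ⟨.svar _ _⟩
  | unit => exact ⟨.unit _⟩
  | vpair _ _ _ _ _ _ _ i1 i2 => exact ⟨.vpair _ _ _ _ _ (i1 hf).some (i2 hf).some⟩
  | vfst _ _ _ _ _ i => exact ⟨.vfst _ _ _ _ (i hf).some⟩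
  | vsnd _ _ _ _ _ i => exact ⟨.vsnd _ _ _ _ (i hf).some⟩
  | vlam _ _ _ _ _ i => exact ⟨.vlam _ _ _ _ (i (hf.lift _)).some⟩
  | vapp _ _ _ _ _ _ _ i1 i2 => exact ⟨.vapp _ _ _ _ _ (i1 hf).some (i2 hf).some⟩
  | cunit => exact ⟨.cunit _ _⟩
  | cpair _ _ _ _ _ _ _ _ i1 i2 => exact ⟨.cpair _ _ _ _ _ _ (i1 hf).some (i2 hf).some⟩
  | cfst _ _ _ _ _ _ i => exact ⟨.cfst _ _ _ _ _ (i hf).some⟩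
  | csnd _ _ _ _ _ _ i => exact ⟨.csnd _ _ _ _ _ (i hf).some⟩
  | clam _ _ _ _ _ _ i => exact ⟨.clam _ _ _ _ _ (i (hf.lift _)).some⟩
  | capp _ _ _ _ _ _ _ _ i1 i2 => exact ⟨.capp _ _ _ _ _ _ (i1 hf).some (i2 hf).some⟩
  | top => exact ⟨.top _⟩
  | ilet _ _ _ _ _ _ _ i1 i2 => exact ⟨.ilet _ _ _ _ _ (i1 hf).some (i2 hf).some⟩
  | bang _ _ _ _ i => exact ⟨.bang _ _ _ (i hf).some⟩
  | banglet _ _ _ _ _ _ _ _ i1 i2 =>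
    exact ⟨.banglet _ _ _ _ _ _ (i1 hf).some (i2 (hf.lift _)).some⟩
  | copow _ _ _ _ _ _ _ _ i1 i2 => exact ⟨.copow _ _ _ _ _ _ (i1 hf).some (i2 hf).some⟩
  | copowlet _ _ _ _ _ _ _ _ _ i1 i2 =>
    exact ⟨.copowlet _ _ _ _ _ _ _ (i1 hf).some (i2 (hf.lift _)).some⟩
  | cimage _ _ _ _ _ i => exact ⟨.cimage _ _ _ _ (i hf).some⟩
  | cinl _ _ _ _ _ _ i => exact ⟨.cinl _ _ _ _ _ (i hf).some⟩
  | cinr _ _ _ _ _ _ i => exact ⟨.cinr _ _ _ _ _ (i hf).some⟩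
  | ccase _ _ _ _ _ _ _ _ _ _ _ i1 i2 i3 =>
    exact ⟨.ccase _ _ _ _ _ _ _ _ (i1 hf).some (i2 hf).some (i3 hf).some⟩
  | llam _ _ _ _ _ i => exact ⟨.llam _ _ _ _ (i hf).some⟩
  | lapp _ _ _ _ _ _ _ _ i1 i2 => exact ⟨.lapp _ _ _ _ _ _ (i1 hf).some (i2 hf).some⟩

theorem Has.subst0 {Γ : List VType} {Δ : Option CType} {t u : Tm} {A B : VType}
    (h : Has (A :: Γ) Δ t B) (hu : Has Γ none u A) : Has Γ Δ (Tm.subst0 u t) B := by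
  rw [Tm.subst0_eq]
  exact h.psubst ((IsSub.var Γ).scons hu)

/-- A term typed with an empty stoup does not mention the stoup variable. -/
theorem Has.ssubst_eq {Γ : List VType} {t : Tm} {A : VType} (h : Has Γ none t A) (u : Tm) :
    Tm.ssubst u t = t := by
  obtain ⟨d⟩ := h
  generalize hD : (none : Option CType) = D at d
  induction d generalizing u <;> subst_vars <;> simp_all [Tm.ssubst]

theorem Has.ssubst {Γ : List VType} {Δ : Option CType} {t u : Tm} {B : VType} {C : CType}
    (h : Has Γ (some C) t B) (hu : Has Γ Δ u (.comp C)) : Has Γ Δ (Tm.ssubst u t) B := by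
  obtain ⟨d⟩ := h
  generalize hD : some C = D at d
  induction d generalizing u C with
  | svar => cases hD; exact hu
  | cunit => exact ⟨.cunit _ _⟩
  | cpair _ _ _ _ _ _ _ _ i1 i2 =>
    exact ⟨.cpair _ _ _ _ _ _ (i1 hu hD).some (i2 hu hD).some⟩
  | cfst _ _ _ _ _ _ i => exact ⟨.cfst _ _ _ _ _ (i hu hD).some⟩
  | csnd _ _ _ _ _ _ i => exact ⟨.csnd _ _ _ _ _ (i hu hD).some⟩
  | clam _ _ _ _ _ _ i => exact ⟨.clam _ _ _ _ _ (i (hu.shift _) hD).some⟩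
  | capp _ _ _ _ _ _ _ d i1 =>
    rw [Tm.ssubst, Has.ssubst_eq ⟨d⟩]
    exact ⟨.capp _ _ _ _ _ _ (i1 hu hD).some d⟩
  | ilet _ _ _ _ _ _ d i1 =>
    rw [Tm.ssubst, Has.ssubst_eq ⟨d⟩]
    exact ⟨.ilet _ _ _ _ _ (i1 hu hD).some d⟩
  | banglet _ _ _ _ _ _ _ d i1 =>
    rw [Tm.ssubst, Has.ssubst_eq ⟨d⟩]
    exact ⟨.banglet _ _ _ _ _ _ (i1 hu hD).some d⟩
  | copow _ _ _ _ _ _ d _ _ i2 =>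
    rw [Tm.ssubst, Has.ssubst_eq ⟨d⟩]
    exact ⟨.copow _ _ _ _ _ _ d (i2 hu hD).some⟩
  | copowlet _ _ _ _ _ _ _ _ d i1 =>
    exact ⟨.copowlet _ _ _ _ _ _ _ (i1 hu hD).some d⟩
  | cimage _ _ _ _ _ i => exact ⟨.cimage _ _ _ _ (i hu hD).some⟩
  | cinl _ _ _ _ _ _ i => exact ⟨.cinl _ _ _ _ _ (i hu hD).some⟩
  | cinr _ _ _ _ _ _ i => exact ⟨.cinr _ _ _ _ _ (i hu hD).some⟩
  | ccase _ _ _ _ _ _ _ _ _ d2 d3 i1 =>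
    exact ⟨.ccase _ _ _ _ _ _ _ _ (i1 hu hD).some d2 d3⟩
  | lapp _ _ _ _ _ _ d _ _ i2 =>
    rw [Tm.ssubst, Has.ssubst_eq ⟨d⟩]
    exact ⟨.lapp _ _ _ _ _ _ d (i2 hu hD).some⟩
  | _ => cases hD

/-- Both sides of a derivable equation are well typed. -/
theorem EEq.has {Γ : List VType} {Δ : Option CType} {t u : Tm} {A : VType}
    (h : EEq Γ Δ t u A) : Has Γ Δ t A ∧ Has Γ Δ u A := by
  induction h with
  | refl d => exact ⟨⟨d⟩, ⟨d⟩⟩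
  | symm _ i => exact i.symm
  | trans _ _ i1 i2 => exact ⟨i1.1, i2.2⟩
  | vpair_cong _ _ i1 i2 =>
    exact ⟨⟨.vpair _ _ _ _ _ i1.1.some i2.1.some⟩, ⟨.vpair _ _ _ _ _ i1.2.some i2.2.some⟩⟩
  | vfst_cong _ i => exact ⟨⟨.vfst _ _ _ _ i.1.some⟩, ⟨.vfst _ _ _ _ i.2.some⟩⟩
  | vsnd_cong _ i => exact ⟨⟨.vsnd _ _ _ _ i.1.some⟩, ⟨.vsnd _ _ _ _ i.2.some⟩⟩
  | vlam_cong _ i => exact ⟨⟨.vlam _ _ _ _ i.1.some⟩, ⟨.vlam _ _ _ _ i.2.some⟩⟩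
  | vapp_cong _ _ i1 i2 =>
    exact ⟨⟨.vapp _ _ _ _ _ i1.1.some i2.1.some⟩, ⟨.vapp _ _ _ _ _ i1.2.some i2.2.some⟩⟩
  | cpair_cong _ _ i1 i2 =>
    exact ⟨⟨.cpair _ _ _ _ _ _ i1.1.some i2.1.some⟩, ⟨.cpair _ _ _ _ _ _ i1.2.some i2.2.some⟩⟩
  | cfst_cong _ i => exact ⟨⟨.cfst _ _ _ _ _ i.1.some⟩, ⟨.cfst _ _ _ _ _ i.2.some⟩⟩
  | csnd_cong _ i => exact ⟨⟨.csnd _ _ _ _ _ i.1.some⟩, ⟨.csnd _ _ _ _ _ i.2.some⟩⟩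
  | clam_cong _ i => exact ⟨⟨.clam _ _ _ _ _ i.1.some⟩, ⟨.clam _ _ _ _ _ i.2.some⟩⟩
  | capp_cong _ _ i1 i2 =>
    exact ⟨⟨.capp _ _ _ _ _ _ i1.1.some i2.1.some⟩, ⟨.capp _ _ _ _ _ _ i1.2.some i2.2.some⟩⟩
  | ilet_cong _ _ i1 i2 =>
    exact ⟨⟨.ilet _ _ _ _ _ i1.1.some i2.1.some⟩, ⟨.ilet _ _ _ _ _ i1.2.some i2.2.some⟩⟩
  | bang_cong _ i => exact ⟨⟨.bang _ _ _ i.1.some⟩, ⟨.bang _ _ _ i.2.some⟩⟩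
  | banglet_cong _ _ i1 i2 =>
    exact ⟨⟨.banglet _ _ _ _ _ _ i1.1.some i2.1.some⟩,
      ⟨.banglet _ _ _ _ _ _ i1.2.some i2.2.some⟩⟩
  | copow_cong _ _ i1 i2 =>
    exact ⟨⟨.copow _ _ _ _ _ _ i1.1.some i2.1.some⟩, ⟨.copow _ _ _ _ _ _ i1.2.some i2.2.some⟩⟩
  | copowlet_cong _ _ i1 i2 =>
    exact ⟨⟨.copowlet _ _ _ _ _ _ _ i1.1.some i2.1.some⟩,
      ⟨.copowlet _ _ _ _ _ _ _ i1.2.some i2.2.some⟩⟩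
  | cimage_cong _ i => exact ⟨⟨.cimage _ _ _ _ i.1.some⟩, ⟨.cimage _ _ _ _ i.2.some⟩⟩
  | cinl_cong _ i => exact ⟨⟨.cinl _ _ _ _ _ i.1.some⟩, ⟨.cinl _ _ _ _ _ i.2.some⟩⟩
  | cinr_cong _ i => exact ⟨⟨.cinr _ _ _ _ _ i.1.some⟩, ⟨.cinr _ _ _ _ _ i.2.some⟩⟩
  | ccase_cong _ _ _ i1 i2 i3 =>
    exact ⟨⟨.ccase _ _ _ _ _ _ _ _ i1.1.some i2.1.some i3.1.some⟩,
      ⟨.ccase _ _ _ _ _ _ _ _ i1.2.some i2.2.some i3.2.some⟩⟩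
  | llam_cong _ i => exact ⟨⟨.llam _ _ _ _ i.1.some⟩, ⟨.llam _ _ _ _ i.2.some⟩⟩
  | lapp_cong _ _ i1 i2 =>
    exact ⟨⟨.lapp _ _ _ _ _ _ i1.1.some i2.1.some⟩, ⟨.lapp _ _ _ _ _ _ i1.2.some i2.2.some⟩⟩
  | unit_eta d => exact ⟨⟨d⟩, ⟨.unit _⟩⟩
  | vfst_beta d1 d2 => exact ⟨⟨.vfst _ _ _ _ (.vpair _ _ _ _ _ d1 d2)⟩, ⟨d1⟩⟩
  | vsnd_beta d1 d2 => exact ⟨⟨.vsnd _ _ _ _ (.vpair _ _ _ _ _ d1 d2)⟩, ⟨d2⟩⟩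
  | vpair_eta d => exact ⟨⟨.vpair _ _ _ _ _ (.vfst _ _ _ _ d) (.vsnd _ _ _ _ d)⟩, ⟨d⟩⟩
  | vlam_beta d1 d2 =>
    exact ⟨⟨.vapp _ _ _ _ _ (.vlam _ _ _ _ d1) d2⟩, Has.subst0 ⟨d1⟩ ⟨d2⟩⟩
  | vlam_eta d =>
    exact ⟨⟨.vlam _ _ _ _ (.vapp _ _ _ _ _ (Has.shift ⟨d⟩ _).some (.var _ _ _ rfl))⟩, ⟨d⟩⟩
  | cunit_eta d => exact ⟨⟨d⟩, ⟨.cunit _ _⟩⟩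
  | cfst_beta d1 d2 => exact ⟨⟨.cfst _ _ _ _ _ (.cpair _ _ _ _ _ _ d1 d2)⟩, ⟨d1⟩⟩
  | csnd_beta d1 d2 => exact ⟨⟨.csnd _ _ _ _ _ (.cpair _ _ _ _ _ _ d1 d2)⟩, ⟨d2⟩⟩
  | cpair_eta d => exact ⟨⟨.cpair _ _ _ _ _ _ (.cfst _ _ _ _ _ d) (.csnd _ _ _ _ _ d)⟩, ⟨d⟩⟩
  | clam_beta d1 d2 =>
    exact ⟨⟨.capp _ _ _ _ _ _ (.clam _ _ _ _ _ d1) d2⟩, Has.subst0 ⟨d1⟩ ⟨d2⟩⟩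
  | clam_eta d =>
    exact ⟨⟨.clam _ _ _ _ _ (.capp _ _ _ _ _ _ (Has.shift ⟨d⟩ _).some (.var _ _ _ rfl))⟩, ⟨d⟩⟩
  | ilet_beta d => exact ⟨⟨.ilet _ _ _ _ _ (.top _) d⟩, ⟨d⟩⟩
  | ilet_eta d1 d2 =>
    exact ⟨⟨.ilet _ _ _ _ _ d1 (Has.ssubst ⟨d2⟩ ⟨.top _⟩).some⟩, Has.ssubst ⟨d2⟩ ⟨d1⟩⟩
  | bang_beta d1 d2 =>
    exact ⟨⟨.banglet _ _ _ _ _ _ (.bang _ _ _ d1) d2⟩, Has.subst0 ⟨d2⟩ ⟨d1⟩⟩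
  | bang_eta d1 d2 =>
    exact ⟨⟨.banglet _ _ _ _ _ _ d1
      ((Has.shift ⟨d2⟩ _).ssubst ⟨.bang _ _ _ (.var _ _ _ rfl)⟩).some⟩, Has.ssubst ⟨d2⟩ ⟨d1⟩⟩
  | copow_beta d1 d2 d3 =>
    exact ⟨⟨.copowlet _ _ _ _ _ _ _ (.copow _ _ _ _ _ _ d1 d2) d3⟩,
      (Has.subst0 ⟨d3⟩ ⟨d1⟩).ssubst ⟨d2⟩⟩
  | copow_eta d1 d2 =>
    exact ⟨⟨.copowlet _ _ _ _ _ _ _ d1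
      ((Has.shift ⟨d2⟩ _).ssubst ⟨.copow _ _ _ _ _ _ (.var _ _ _ rfl) (.svar _ _)⟩).some⟩,
      Has.ssubst ⟨d2⟩ ⟨d1⟩⟩
  | czero_eta d1 d2 => exact ⟨⟨.cimage _ _ _ _ d1⟩, Has.ssubst ⟨d2⟩ ⟨d1⟩⟩
  | csum_beta_inl d1 d2 d3 =>
    exact ⟨⟨.ccase _ _ _ _ _ _ _ _ (.cinl _ _ _ _ _ d3) d1 d2⟩, Has.ssubst ⟨d1⟩ ⟨d3⟩⟩
  | csum_beta_inr d1 d2 d3 =>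
    exact ⟨⟨.ccase _ _ _ _ _ _ _ _ (.cinr _ _ _ _ _ d3) d1 d2⟩, Has.ssubst ⟨d2⟩ ⟨d3⟩⟩
  | csum_eta d1 d2 =>
    exact ⟨⟨.ccase _ _ _ _ _ _ _ _ d1
      (Has.ssubst ⟨d2⟩ ⟨.cinl _ _ _ _ _ (.svar _ _)⟩).some
      (Has.ssubst ⟨d2⟩ ⟨.cinr _ _ _ _ _ (.svar _ _)⟩).some⟩, Has.ssubst ⟨d2⟩ ⟨d1⟩⟩
  | llam_beta d1 d2 =>
    exact ⟨⟨.lapp _ _ _ _ _ _ (.llam _ _ _ _ d1) d2⟩, Has.ssubst ⟨d1⟩ ⟨d2⟩⟩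
  | llam_eta d => exact ⟨⟨.llam _ _ _ _ (.lapp _ _ _ _ _ _ d (.svar _ _))⟩, ⟨d⟩⟩

/-- Derivable equations are closed under renaming. -/
theorem EEq.rename {Γ Γ' : List VType} {Δ : Option CType} {t u : Tm} {A : VType} {f : ℕ → ℕ}
    (h : EEq Γ Δ t u A) (hf : IsRen Γ Γ' f) : EEq Γ' Δ (t.rename f) (u.rename f) A := by
  have R : ∀ {Γ Γ' : List VType} {Δ : Option CType} {t : Tm} {A : VType} {f : ℕ → ℕ},
      Deriv Γ Δ t A → IsRen Γ Γ' f → Nonempty (Deriv Γ' Δ (t.rename f) A) :=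
    fun d hf => Has.rename ⟨d⟩ hf
  induction h generalizing Γ' f with
  | refl d => exact .refl (R d hf).some
  | symm _ i => exact (i hf).symm
  | trans _ _ i1 i2 => exact (i1 hf).trans (i2 hf)
  | vpair_cong _ _ i1 i2 => exact .vpair_cong (i1 hf) (i2 hf)
  | vfst_cong _ i => exact .vfst_cong (i hf)
  | vsnd_cong _ i => exact .vsnd_cong (i hf)
  | vlam_cong _ i => exact .vlam_cong (i (hf.lift _))
  | vapp_cong _ _ i1 i2 => exact .vapp_cong (i1 hf) (i2 hf)
  | cpair_cong _ _ i1 i2 => exact .cpair_cong (i1 hf) (i2 hf)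
  | cfst_cong _ i => exact .cfst_cong (i hf)
  | csnd_cong _ i => exact .csnd_cong (i hf)
  | clam_cong _ i => exact .clam_cong (i (hf.lift _))
  | capp_cong _ _ i1 i2 => exact .capp_cong (i1 hf) (i2 hf)
  | ilet_cong _ _ i1 i2 => exact .ilet_cong (i1 hf) (i2 hf)
  | bang_cong _ i => exact .bang_cong (i hf)
  | banglet_cong _ _ i1 i2 => exact .banglet_cong (i1 hf) (i2 (hf.lift _))
  | copow_cong _ _ i1 i2 => exact .copow_cong (i1 hf) (i2 hf)
  | copowlet_cong _ _ i1 i2 => exact .copowlet_cong (i1 hf) (i2 (hf.lift _))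
  | cimage_cong _ i => exact .cimage_cong (i hf)
  | cinl_cong _ i => exact .cinl_cong (i hf)
  | cinr_cong _ i => exact .cinr_cong (i hf)
  | ccase_cong _ _ _ i1 i2 i3 => exact .ccase_cong (i1 hf) (i2 hf) (i3 hf)
  | llam_cong _ i => exact .llam_cong (i hf)
  | lapp_cong _ _ i1 i2 => exact .lapp_cong (i1 hf) (i2 hf)
  | unit_eta d => exact .unit_eta (R d hf).some
  | vfst_beta d1 d2 => exact .vfst_beta (R d1 hf).some (R d2 hf).some
  | vsnd_beta d1 d2 => exact .vsnd_beta (R d1 hf).some (R d2 hf).some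
  | vpair_eta d => exact .vpair_eta (R d hf).some
  | vlam_beta d1 d2 =>
    rw [Tm.rename_subst0]
    exact .vlam_beta (R d1 (hf.lift _)).some (R d2 hf).some
  | vlam_eta d =>
    have := EEq.vlam_eta (R d hf).some
    rwa [Tm.shift_rename] at this
  | cunit_eta d => exact .cunit_eta (R d hf).some
  | cfst_beta d1 d2 => exact .cfst_beta (R d1 hf).some (R d2 hf).some
  | csnd_beta d1 d2 => exact .csnd_beta (R d1 hf).some (R d2 hf).some
  | cpair_eta d => exact .cpair_eta (R d hf).some
  | clam_beta d1 d2 =>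
    rw [Tm.rename_subst0]
    exact .clam_beta (R d1 (hf.lift _)).some (R d2 hf).some
  | clam_eta d =>
    have := EEq.clam_eta (R d hf).some
    rwa [Tm.shift_rename] at this
  | ilet_beta d => exact .ilet_beta (R d hf).some
  | ilet_eta d1 d2 =>
    rw [Tm.rename, Tm.rename_ssubst, Tm.rename_ssubst]
    exact .ilet_eta (R d1 hf).some (R d2 hf).some
  | bang_beta d1 d2 =>
    rw [Tm.rename_subst0]
    exact .bang_beta (R d1 hf).some (R d2 (hf.lift _)).some
  | bang_eta d1 d2 =>
    rw [Tm.rename, Tm.rename_ssubst, Tm.rename_ssubst, ← Tm.shift_rename]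
    exact .bang_eta (R d1 hf).some (R d2 hf).some
  | copow_beta d1 d2 d3 =>
    rw [Tm.rename_ssubst, Tm.rename_subst0]
    exact .copow_beta (R d1 hf).some (R d2 hf).some (R d3 (hf.lift _)).some
  | copow_eta d1 d2 =>
    rw [Tm.rename, Tm.rename_ssubst, Tm.rename_ssubst, ← Tm.shift_rename]
    exact .copow_eta (R d1 hf).some (R d2 hf).some
  | czero_eta d1 d2 =>
    rw [Tm.rename_ssubst]
    exact .czero_eta (R d1 hf).some (R d2 hf).some
  | csum_beta_inl d1 d2 d3 =>
    rw [Tm.rename_ssubst]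
    exact .csum_beta_inl (R d1 hf).some (R d2 hf).some (R d3 hf).some
  | csum_beta_inr d1 d2 d3 =>
    rw [Tm.rename_ssubst]
    exact .csum_beta_inr (R d1 hf).some (R d2 hf).some (R d3 hf).some
  | csum_eta d1 d2 =>
    rw [Tm.rename, Tm.rename_ssubst, Tm.rename_ssubst, Tm.rename_ssubst]
    exact .csum_eta (R d1 hf).some (R d2 hf).some
  | llam_beta d1 d2 =>
    rw [Tm.rename_ssubst]
    exact .llam_beta (R d1 hf).some (R d2 hf).some
  | llam_eta d => exact .llam_eta (R d hf).some

theorem EEq.mono {Γ Γ' : List VType} {Δ : Option CType} {t u : Tm} {A : VType}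
    (h : EEq Γ Δ t u A) (hp : Γ <+: Γ') : EEq Γ' Δ t u A := by
  simpa only [Tm.rename_id] using h.rename (IsRen.of_isPrefix hp)

theorem Has.mono {Γ Γ' : List VType} {Δ : Option CType} {t : Tm} {A : VType}
    (h : Has Γ Δ t A) (hp : Γ <+: Γ') : Has Γ' Δ t A := by
  simpa only [Tm.rename_id] using h.rename (IsRen.of_isPrefix hp)

/-! ## Simply-typed terms: renaming, substitution and equality -/

namespace LTm

/-- Lift a parallel substitution under a binder. -/
def liftS (σ : ℕ → LTm) : ℕ → LTm
  | 0 => .var 0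
  | n + 1 => shift (σ n)

/-- The substitution sending variable `0` to `u` and variable `n + 1` to `σ n`. -/
def scons (u : LTm) (σ : ℕ → LTm) : ℕ → LTm
  | 0 => u
  | n + 1 => σ n

theorem subst0_eq (u t : LTm) : subst0 u t = psubst (scons u .var) t := by
  unfold subst0
  congr 1

theorem psubst_lam (σ : ℕ → LTm) (τ : STy) (M : LTm) :
    psubst σ (.lam τ M) = .lam τ (psubst (liftS σ) M) := by
  rw [psubst]
  congr 2

theorem rename_id (t : LTm) : rename id t = t := by
  induction t <;> simp_all [rename, Tm.liftN_id]

theorem rename_rename (t : LTm) (f g : ℕ → ℕ) :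
    rename f (rename g t) = rename (f ∘ g) t := by
  induction t generalizing f g <;> simp_all [rename, ← Tm.liftN_comp]

theorem rename_liftN_shift (f : ℕ → ℕ) (t : LTm) :
    rename (Tm.liftN f) (shift t) = shift (rename f t) := by
  simp only [shift, rename_rename]
  rfl

theorem liftS_comp_liftN (σ : ℕ → LTm) (f : ℕ → ℕ) :
    liftS σ ∘ Tm.liftN f = liftS (σ ∘ f) := by
  funext n
  cases n <;> rfl

theorem psubst_rename (t : LTm) (σ : ℕ → LTm) (f : ℕ → ℕ) :
    psubst σ (rename f t) = psubst (σ ∘ f) t := by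
  induction t generalizing σ f with
  | lam τ M ih => simp_all [rename, psubst_lam, ← liftS_comp_liftN]
  | _ => simp_all [rename, psubst]

theorem rename_comp_liftS (f : ℕ → ℕ) (σ : ℕ → LTm) :
    rename (Tm.liftN f) ∘ liftS σ = liftS (rename f ∘ σ) := by
  funext n
  cases n
  · rfl
  · exact rename_liftN_shift f _

theorem rename_psubst (t : LTm) (f : ℕ → ℕ) (σ : ℕ → LTm) :
    rename f (psubst σ t) = psubst (rename f ∘ σ) t := by
  induction t generalizing σ f with
  | lam τ M ih => simp_all [rename, psubst_lam, ← rename_comp_liftS]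
  | _ => simp_all [rename, psubst]

theorem psubst_liftS_shift (σ : ℕ → LTm) (t : LTm) :
    psubst (liftS σ) (shift t) = shift (psubst σ t) := by
  simp only [shift, rename_psubst, psubst_rename]
  rfl

theorem psubst_comp_liftS (τ σ : ℕ → LTm) :
    psubst (liftS τ) ∘ liftS σ = liftS (psubst τ ∘ σ) := by
  funext n
  cases n
  · rfl
  · exact psubst_liftS_shift τ _

theorem psubst_psubst (t : LTm) (τ σ : ℕ → LTm) :
    psubst τ (psubst σ t) = psubst (psubst τ ∘ σ) t := by
  induction t generalizing τ σ with
  | lam τ M ih => simp_all [psubst_lam, ← psubst_comp_liftS]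
  | _ => simp_all [psubst]

theorem liftS_var : liftS .var = .var := by
  funext n
  cases n <;> rfl

theorem psubst_var (t : LTm) : psubst .var t = t := by
  induction t with
  | lam τ M ih => simp_all [psubst_lam, liftS_var]
  | _ => simp_all [psubst]

theorem scons_comp_succ (u : LTm) (σ : ℕ → LTm) : scons u σ ∘ Nat.succ = σ := rfl

theorem subst0_psubst_liftS (u t : LTm) (σ : ℕ → LTm) :
    subst0 u (psubst (liftS σ) t) = psubst (scons u σ) t := by
  rw [subst0_eq, psubst_psubst]
  congr 1
  funext n
  cases n with
  | zero => rfl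
  | succ n =>
    change psubst (scons u .var) (shift (σ n)) = σ n
    rw [shift, psubst_rename, scons_comp_succ, psubst_var]

theorem rename_subst0 (f : ℕ → ℕ) (u t : LTm) :
    rename f (subst0 u t) = subst0 (rename f u) (rename (Tm.liftN f) t) := by
  rw [subst0_eq, subst0_eq, rename_psubst, psubst_rename]
  congr 1
  funext n
  cases n <;> rfl

end LTm

/-- Typability of a simply-typed term. -/
abbrev LHas (Θ : List STy) (M : LTm) (σ : STy) : Prop := Nonempty (LDeriv Θ M σ)

theorem LHas.rename {Θ Θ' : List STy} {M : LTm} {σ : STy} {f : ℕ → ℕ}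
    (h : LHas Θ M σ) (hf : IsRen Θ Θ' f) : LHas Θ' (M.rename f) σ := by
  obtain ⟨d⟩ := h
  induction d generalizing Θ' f with
  | var _ _ _ h => exact ⟨.var _ _ _ (hf _ _ h)⟩
  | unit => exact ⟨.unit _⟩
  | pair _ _ _ _ _ _ _ i1 i2 => exact ⟨.pair _ _ _ _ _ (i1 hf).some (i2 hf).some⟩
  | fst _ _ _ _ _ i => exact ⟨.fst _ _ _ _ (i hf).some⟩
  | snd _ _ _ _ _ i => exact ⟨.snd _ _ _ _ (i hf).some⟩
  | lam _ _ _ _ _ i => exact ⟨.lam _ _ _ _ (i (hf.lift _)).some⟩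
  | app _ _ _ _ _ _ _ i1 i2 => exact ⟨.app _ _ _ _ _ (i1 hf).some (i2 hf).some⟩

/-- Two renamings that agree on the variables of the context act equally on typed terms. -/
theorem LHas.rename_congr {Θ : List STy} {M : LTm} {σ : STy} {f g : ℕ → ℕ}
    (h : LHas Θ M σ) (hfg : ∀ n, n < Θ.length → f n = g n) : M.rename f = M.rename g := by
  obtain ⟨d⟩ := h
  induction d generalizing f g with
  | var _ _ _ h => simp [LTm.rename, hfg _ (List.getElem?_eq_some_iff.mp h).1]
  | unit => rfl
  | pair _ _ _ _ _ _ _ i1 i2 => simp [LTm.rename, i1 hfg, i2 hfg]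
  | fst _ _ _ _ _ i => simp [LTm.rename, i hfg]
  | snd _ _ _ _ _ i => simp [LTm.rename, i hfg]
  | lam _ _ _ _ _ i =>
    rw [LTm.rename, LTm.rename, i]
    intro n hn
    cases n with
    | zero => rfl
    | succ n => simp [Tm.liftN, hfg n (by simpa using hn)]
  | app _ _ _ _ _ _ _ i1 i2 => simp [LTm.rename, i1 hfg, i2 hfg]

theorem LHas.psubst {Θ Θ' : List STy} {M : LTm} {σ : STy} {γ : ℕ → LTm}
    (h : LHas Θ M σ) (hf : ∀ n τ, Θ[n]? = some τ → LHas Θ' (γ n) τ) :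
    LHas Θ' (M.psubst γ) σ := by
  obtain ⟨d⟩ := h
  induction d generalizing Θ' γ with
  | var _ _ _ h => exact hf _ _ h
  | unit => exact ⟨.unit _⟩
  | pair _ _ _ _ _ _ _ i1 i2 => exact ⟨.pair _ _ _ _ _ (i1 hf).some (i2 hf).some⟩
  | fst _ _ _ _ _ i => exact ⟨.fst _ _ _ _ (i hf).some⟩
  | snd _ _ _ _ _ i => exact ⟨.snd _ _ _ _ (i hf).some⟩
  | lam _ _ σ _ _ i =>
    rw [LTm.psubst_lam]
    refine ⟨.lam _ _ _ _ (i ?_).some⟩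
    intro n τ hn
    cases n with
    | zero => exact ⟨.var _ _ _ hn⟩
    | succ n => exact (hf n τ (by simpa using hn)).rename (IsRen.succ _ _)
  | app _ _ _ _ _ _ _ i1 i2 => exact ⟨.app _ _ _ _ _ (i1 hf).some (i2 hf).some⟩

theorem LHas.subst0 {Θ : List STy} {M N : LTm} {σ τ : STy}
    (h : LHas (σ :: Θ) M τ) (hN : LHas Θ N σ) : LHas Θ (LTm.subst0 N M) τ := by
  rw [LTm.subst0_eq]
  refine h.psubst fun n ρ hn => ?_
  cases n with
  | zero =>
    obtain rfl : σ = ρ := by simpa using hn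
    exact hN
  | succ n => exact ⟨.var _ _ _ (by simpa using hn)⟩

theorem LBetaEta.has {Θ : List STy} {M N : LTm} {σ : STy} (h : LBetaEta Θ M N σ) :
    LHas Θ M σ ∧ LHas Θ N σ := by
  induction h with
  | refl d => exact ⟨⟨d⟩, ⟨d⟩⟩
  | symm _ i => exact i.symm
  | trans _ _ i1 i2 => exact ⟨i1.1, i2.2⟩
  | pair_cong _ _ i1 i2 =>
    exact ⟨⟨.pair _ _ _ _ _ i1.1.some i2.1.some⟩, ⟨.pair _ _ _ _ _ i1.2.some i2.2.some⟩⟩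
  | fst_cong _ i => exact ⟨⟨.fst _ _ _ _ i.1.some⟩, ⟨.fst _ _ _ _ i.2.some⟩⟩
  | snd_cong _ i => exact ⟨⟨.snd _ _ _ _ i.1.some⟩, ⟨.snd _ _ _ _ i.2.some⟩⟩
  | lam_cong _ i => exact ⟨⟨.lam _ _ _ _ i.1.some⟩, ⟨.lam _ _ _ _ i.2.some⟩⟩
  | app_cong _ _ i1 i2 =>
    exact ⟨⟨.app _ _ _ _ _ i1.1.some i2.1.some⟩, ⟨.app _ _ _ _ _ i1.2.some i2.2.some⟩⟩
  | beta d1 d2 => exact ⟨⟨.app _ _ _ _ _ (.lam _ _ _ _ d1) d2⟩, LHas.subst0 ⟨d1⟩ ⟨d2⟩⟩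
  | eta d =>
    exact ⟨⟨.lam _ _ _ _ (.app _ _ _ _ _ (LHas.rename ⟨d⟩ (IsRen.succ _ _)).some
      (.var _ _ _ rfl))⟩, ⟨d⟩⟩
  | fst_beta d1 d2 => exact ⟨⟨.fst _ _ _ _ (.pair _ _ _ _ _ d1 d2)⟩, ⟨d1⟩⟩
  | snd_beta d1 d2 => exact ⟨⟨.snd _ _ _ _ (.pair _ _ _ _ _ d1 d2)⟩, ⟨d2⟩⟩
  | pair_eta d => exact ⟨⟨.pair _ _ _ _ _ (.fst _ _ _ _ d) (.snd _ _ _ _ d)⟩, ⟨d⟩⟩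
  | unit_eta d => exact ⟨⟨d⟩, ⟨.unit _⟩⟩

theorem LBetaEta.rename {Θ Θ' : List STy} {M N : LTm} {σ : STy} {f : ℕ → ℕ}
    (h : LBetaEta Θ M N σ) (hf : IsRen Θ Θ' f) :
    LBetaEta Θ' (M.rename f) (N.rename f) σ := by
  have R : ∀ {Θ Θ' : List STy} {M : LTm} {σ : STy} {f : ℕ → ℕ},
      LDeriv Θ M σ → IsRen Θ Θ' f → Nonempty (LDeriv Θ' (M.rename f) σ) :=
    fun d hf => LHas.rename ⟨d⟩ hf
  induction h generalizing Θ' f with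
  | refl d => exact .refl (R d hf).some
  | symm _ i => exact (i hf).symm
  | trans _ _ i1 i2 => exact (i1 hf).trans (i2 hf)
  | pair_cong _ _ i1 i2 => exact .pair_cong (i1 hf) (i2 hf)
  | fst_cong _ i => exact .fst_cong (i hf)
  | snd_cong _ i => exact .snd_cong (i hf)
  | lam_cong _ i => exact .lam_cong (i (hf.lift _))
  | app_cong _ _ i1 i2 => exact .app_cong (i1 hf) (i2 hf)
  | beta d1 d2 =>
    rw [LTm.rename_subst0]
    exact .beta (R d1 (hf.lift _)).some (R d2 hf).some
  | eta d =>
    have := LBetaEta.eta (R d hf).some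
    rwa [← LTm.rename_liftN_shift] at this
  | fst_beta d1 d2 => exact .fst_beta (R d1 hf).some (R d2 hf).some
  | snd_beta d1 d2 => exact .snd_beta (R d1 hf).some (R d2 hf).some
  | pair_eta d => exact .pair_eta (R d hf).some
  | unit_eta d => exact .unit_eta (R d hf).some

theorem LBetaEta.mono {Θ Θ' : List STy} {M N : LTm} {σ : STy} (h : LBetaEta Θ M N σ)
    (hp : Θ <+: Θ') : LBetaEta Θ' M N σ := by
  simpa only [LTm.rename_id] using h.rename (IsRen.of_isPrefix hp)

theorem LHas.mono {Θ Θ' : List STy} {M : LTm} {σ : STy} (h : LHas Θ M σ)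
    (hp : Θ <+: Θ') : LHas Θ' M σ := by
  simpa only [LTm.rename_id] using h.rename (IsRen.of_isPrefix hp)

/-- The renaming that turns variable `n` into the innermost variable, shifting the others. -/
def closeRen (n i : ℕ) : ℕ := if i = n then 0 else i + 1

theorem isRen_closeRen {T : Type} (Θ : List T) (σ : T) :
    IsRen (Θ ++ [σ]) (σ :: Θ) (closeRen Θ.length) := by
  intro i τ hi
  have hlt := (List.getElem?_eq_some_iff.mp hi).1
  simp only [List.length_append, List.length_singleton] at hlt
  unfold closeRen
  split
  · next h =>
    subst h
    simpa using hi
  · next h =>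
    rw [List.getElem?_append_left (by omega)] at hi
    simpa using hi

theorem Has.rename_congr {Γ : List VType} {Δ : Option CType} {t : Tm} {A : VType} {f g : ℕ → ℕ}
    (h : Has Γ Δ t A) (hfg : ∀ n, n < Γ.length → f n = g n) : t.rename f = t.rename g := by
  obtain ⟨d⟩ := h
  have lift : ∀ {Γ : List VType} {f g : ℕ → ℕ} (A : VType), (∀ n, n < Γ.length → f n = g n) →
      ∀ n, n < (A :: Γ).length → Tm.liftN f n = Tm.liftN g n := by
    intro Γ f g A h n hn
    cases n with
    | zero => rfl
    | succ n => simp [Tm.liftN, h n (by simpa using hn)]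
  induction d generalizing f g with
  | var Γ n A hn =>
    have := (List.getElem?_eq_some_iff.mp hn).1
    simp [Tm.rename, hfg n this]
  | vlam Γ t A B d ih => simp only [Tm.rename, ih (lift A hfg)]
  | clam Γ Δ t A B d ih => simp only [Tm.rename, ih (lift A hfg)]
  | banglet Γ Δ t u A B d1 d2 ih1 ih2 => simp only [Tm.rename, ih1 hfg, ih2 (lift A hfg)]
  | copowlet Γ Δ t u A B C d1 d2 ih1 ih2 => simp only [Tm.rename, ih1 hfg, ih2 (lift A hfg)]
  | vpair Γ t u A B d1 d2 ih1 ih2 => simp only [Tm.rename, ih1 hfg, ih2 hfg]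
  | vapp Γ t u A B d1 d2 ih1 ih2 => simp only [Tm.rename, ih1 hfg, ih2 hfg]
  | cpair Γ Δ t u A B d1 d2 ih1 ih2 => simp only [Tm.rename, ih1 hfg, ih2 hfg]
  | capp Γ Δ t u A B d1 d2 ih1 ih2 => simp only [Tm.rename, ih1 hfg, ih2 hfg]
  | ilet Γ Δ t u A d1 d2 ih1 ih2 => simp only [Tm.rename, ih1 hfg, ih2 hfg]
  | copow Γ Δ t u A B d1 d2 ih1 ih2 => simp only [Tm.rename, ih1 hfg, ih2 hfg]
  | lapp Γ Δ t u A B d1 d2 ih1 ih2 => simp only [Tm.rename, ih1 hfg, ih2 hfg]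
  | ccase Γ Δ s t u A B C d1 d2 d3 ih1 ih2 ih3 =>
    simp only [Tm.rename, ih1 hfg, ih2 hfg, ih3 hfg]
  | _ => first | rfl | (rename_i ih; simp only [Tm.rename, ih hfg])

theorem cbncpsCtx_isPrefix {R : CType} {Θ Θ' : List STy} (h : Θ <+: Θ') :
    cbncpsCtx R Θ <+: cbncpsCtx R Θ' := h.map _

theorem has_cbncps (R : CType) {Θ : List STy} {M : LTm} {σ : STy} (d : LDeriv Θ M σ) :
    Has (cbncpsCtx R Θ) none (cbncps R d) (.lin (cbncpsT R σ) R) := by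
  induction d with
  | var Θ n σ h => exact ⟨.var _ _ _ (by simp [cbncpsCtx, h])⟩
  | unit Θ => exact ⟨.llam _ _ _ _ (.cimage _ _ _ _ (.svar _ _))⟩
  | pair Θ M N σ τ d1 d2 ih1 ih2 =>
    obtain ⟨e1⟩ := ih1
    obtain ⟨e2⟩ := ih2
    exact ⟨.llam _ _ _ _ (.ccase _ _ _ _ _ _ _ _ (.svar _ _)
      (.lapp _ _ _ _ _ _ e1 (.svar _ _)) (.lapp _ _ _ _ _ _ e2 (.svar _ _)))⟩
  | fst Θ M σ τ d ih =>
    obtain ⟨e⟩ := ih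
    exact ⟨.llam _ _ _ _ (.lapp _ _ _ _ _ _ e (.cinl _ _ _ _ _ (.svar _ _)))⟩
  | snd Θ M σ τ d ih =>
    obtain ⟨e⟩ := ih
    exact ⟨.llam _ _ _ _ (.lapp _ _ _ _ _ _ e (.cinr _ _ _ _ _ (.svar _ _)))⟩
  | lam Θ M σ τ d ih =>
    obtain ⟨e⟩ := ih
    exact ⟨.llam _ _ _ _ (.copowlet _ _ _ _ _ _ _ (.svar _ _)
      (.lapp _ _ _ _ _ _ e (.svar _ _)))⟩
  | app Θ M N σ τ d1 d2 ih1 ih2 =>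
    obtain ⟨e1⟩ := ih1
    obtain ⟨e2⟩ := ih2
    exact ⟨.llam _ _ _ _ (.lapp _ _ _ _ _ _ e1 (.copow _ _ _ _ _ _ e2 (.svar _ _)))⟩

theorem exists_rename_cbncps (R : CType) {Θ Θ' : List STy} {M : LTm} {σ : STy} {f : ℕ → ℕ}
    (d : LDeriv Θ M σ) (hf : IsRen Θ Θ' f) :
    ∃ d' : LDeriv Θ' (M.rename f) σ, cbncps R d' = (cbncps R d).rename f := by
  induction d generalizing Θ' f with
  | var Θ n σ h => exact ⟨.var _ _ _ (hf _ _ h), rfl⟩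
  | unit Θ => exact ⟨.unit _, rfl⟩
  | pair Θ M N σ τ d1 d2 ih1 ih2 =>
    obtain ⟨e1, h1⟩ := ih1 hf
    obtain ⟨e2, h2⟩ := ih2 hf
    exact ⟨.pair _ _ _ _ _ e1 e2, by simp [cbncps, Tm.rename, h1, h2]⟩
  | fst Θ M σ τ d ih =>
    obtain ⟨e, h⟩ := ih hf
    exact ⟨.fst _ _ _ _ e, by simp [cbncps, Tm.rename, h]⟩
  | snd Θ M σ τ d ih =>
    obtain ⟨e, h⟩ := ih hf
    exact ⟨.snd _ _ _ _ e, by simp [cbncps, Tm.rename, h]⟩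
  | lam Θ M σ τ d ih =>
    obtain ⟨e, h⟩ := ih (hf.lift σ)
    exact ⟨.lam _ _ _ _ e, by simp [cbncps, Tm.rename, h]⟩
  | app Θ M N σ τ d1 d2 ih1 ih2 =>
    obtain ⟨e1, h1⟩ := ih1 hf
    obtain ⟨e2, h2⟩ := ih2 hf
    exact ⟨.app _ _ _ _ _ e1 e2, by simp [cbncps, Tm.rename, h1, h2]⟩

/-! ## Definability by a Kripke logical predicate -/

/-- `k` is equal to the translation of a simply-typed term of type `τ`. -/
def Definable (R : CType) (τ : STy) (Θ : List STy) (k : Tm) : Prop :=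
  ∃ (M : LTm) (d : LDeriv Θ M τ),
    EEq (cbncpsCtx R Θ) none (cbncps R d) k (.lin (cbncpsT R τ) R)

theorem Definable.congr {R : CType} {τ : STy} {Θ : List STy} {k k' : Tm}
    (h : Definable R τ Θ k) (e : EEq (cbncpsCtx R Θ) none k k' (.lin (cbncpsT R τ) R)) :
    Definable R τ Θ k' := by
  obtain ⟨M, d, hd⟩ := h
  exact ⟨M, d, hd.trans e⟩

theorem Definable.mono {R : CType} {τ : STy} {Θ Θ' : List STy} {k : Tm}
    (h : Definable R τ Θ k) (hp : Θ <+: Θ') : Definable R τ Θ' k := by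
  obtain ⟨M, d, hd⟩ := h
  obtain ⟨d', hd'⟩ := exists_rename_cbncps R d (IsRen.of_isPrefix hp)
  rw [Tm.rename_id] at hd'
  exact ⟨_, d', hd' ▸ hd.mono (cbncpsCtx_isPrefix hp)⟩

/-- The predicate on answers, i.e. on terms of type `R`. -/
def Ans (R : CType) (Θ : List STy) (t : Tm) : Prop :=
  Has (cbncpsCtx R Θ) none t (.comp R) ∧
    (R = .iunit → EEq (cbncpsCtx R Θ) none t .top (.comp .iunit))

mutual
  /-- The logical predicate on terms of value types. -/
  def SV (R : CType) : VType → List STy → Tm → Prop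
    | .base _, _, _ => True
    | .unit, _, _ => True
    | .prod A B, Θ, t => SV R A Θ (.vfst t) ∧ SV R B Θ (.vsnd t)
    | .arr A B, Θ, t => ∀ Θ', Θ <+: Θ' → ∀ a, Has (cbncpsCtx R Θ') none a A →
        SV R A Θ' a → SV R B Θ' (.vapp t a)
    | .comp A, Θ, t => ∀ Θ', Θ <+: Θ' → ∀ k, Has (cbncpsCtx R Θ') none k (.lin A R) →
        SC R A Θ' k → Ans R Θ' (.lapp k t)
    | .lin A B, Θ, t => ∀ Θ', Θ <+: Θ' → ∀ k, Has (cbncpsCtx R Θ') none k (.lin B R) →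
        SC R B Θ' k → SC R A Θ' (.llam A (.lapp k (.lapp t .svar)))
  /-- The logical predicate on continuations `k : A ⊸ R` of a computation type `A`. -/
  def SC (R : CType) : CType → List STy → Tm → Prop
    | .base 0, Θ, k => R = .base 0 →
        EEq (cbncpsCtx R Θ) none k (.llam R .svar) (.lin (.base 0) R)
    | .base (a + 1), Θ, k => Definable R (.base a) Θ k
    | .cunit, _, _ => False
    | .cand A B, Θ, k =>
        (∃ k', Has (cbncpsCtx R Θ) none k' (.lin A R) ∧ SC R A Θ k' ∧
          EEq (cbncpsCtx R Θ) none k (.llam (.cand A B) (.lapp k' (.cfst .svar)))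
            (.lin (.cand A B) R)) ∨
        (∃ k', Has (cbncpsCtx R Θ) none k' (.lin B R) ∧ SC R B Θ k' ∧
          EEq (cbncpsCtx R Θ) none k (.llam (.cand A B) (.lapp k' (.csnd .svar)))
            (.lin (.cand A B) R))
    | .carr A B, Θ, k => ∃ a k', Has (cbncpsCtx R Θ) none a A ∧
        Has (cbncpsCtx R Θ) none k' (.lin B R) ∧ SV R A Θ a ∧ SC R B Θ k' ∧
        EEq (cbncpsCtx R Θ) none k (.llam (.carr A B) (.lapp k' (.capp .svar a)))
          (.lin (.carr A B) R)
    | .iunit, Θ, k => Ans R Θ (.lapp k .top)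
    | .bang A, Θ, k => ∀ Θ', Θ <+: Θ' → ∀ a, Has (cbncpsCtx R Θ') none a A →
        SV R A Θ' a → Ans R Θ' (.lapp k (.bang a))
    | .copow A B, Θ, k => ∀ Θ', Θ <+: Θ' → ∀ a, Has (cbncpsCtx R Θ') none a A →
        SV R A Θ' a → SC R B Θ' (.llam B (.lapp k (.copow a .svar)))
    | .czero, _, _ => True
    | .csum A B, Θ, k => SC R A Θ (.llam A (.lapp k (.cinl .svar))) ∧
        SC R B Θ (.llam B (.lapp k (.cinr .svar)))
end

theorem Ans.congr {R : CType} {Θ : List STy} {t t' : Tm} (h : Ans R Θ t)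
    (e : EEq (cbncpsCtx R Θ) none t t' (.comp R)) : Ans R Θ t' := by
  refine ⟨e.has.2, fun hR => ?_⟩
  have := h.2 hR
  subst hR
  exact e.symm.trans this

theorem Ans.mono {R : CType} {Θ Θ' : List STy} {t : Tm} (h : Ans R Θ t) (hp : Θ <+: Θ') :
    Ans R Θ' t :=
  ⟨h.1.mono (cbncpsCtx_isPrefix hp), fun hR => (h.2 hR).mono (cbncpsCtx_isPrefix hp)⟩

theorem EEq.of_has {Γ : List VType} {Δ : Option CType} {t : Tm} {A : VType}
    (h : Has Γ Δ t A) : EEq Γ Δ t t A := h.elim .refl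

theorem Has.svar (Γ : List VType) (A : CType) : Has Γ (some A) .svar (.comp A) := ⟨.svar _ _⟩

theorem Has.lapp {Γ : List VType} {Δ : Option CType} {s t : Tm} {A B : CType}
    (hs : Has Γ none s (.lin A B)) (ht : Has Γ Δ t (.comp A)) :
    Has Γ Δ (.lapp s t) (.comp B) :=
  hs.elim fun d => ht.elim fun e => ⟨.lapp _ _ _ _ _ _ d e⟩

theorem Has.llam {Γ : List VType} {t : Tm} {A B : CType}
    (h : Has Γ (some A) t (.comp B)) : Has Γ none (.llam A t) (.lin A B) :=
  h.elim fun d => ⟨.llam _ _ _ _ d⟩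

mutual
  theorem SV.congr {R : CType} : ∀ (A : VType) {Θ : List STy} {t t' : Tm}, SV R A Θ t →
      EEq (cbncpsCtx R Θ) none t t' A → SV R A Θ t'
    | .base _, _, _, _, _, _ => by simp [SV]
    | .unit, _, _, _, _, _ => by simp [SV]
    | .prod A B, Θ, t, t', h, e => by
      rw [SV] at h ⊢
      exact ⟨SV.congr A h.1 (.vfst_cong e), SV.congr B h.2 (.vsnd_cong e)⟩
    | .arr A B, Θ, t, t', h, e => by
      rw [SV] at h ⊢
      exact fun Θ' hp a ha hs => SV.congr B (h Θ' hp a ha hs)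
        (.vapp_cong (e.mono (cbncpsCtx_isPrefix hp)) (.of_has ha))
    | .comp A, Θ, t, t', h, e => by
      rw [SV] at h ⊢
      exact fun Θ' hp k hk hs => (h Θ' hp k hk hs).congr
        (.lapp_cong (.of_has hk) (e.mono (cbncpsCtx_isPrefix hp)))
    | .lin A B, Θ, t, t', h, e => by
      rw [SV] at h ⊢
      exact fun Θ' hp k hk hs => SC.congr A (h Θ' hp k hk hs)
        (.llam_cong (.lapp_cong (.of_has hk)
          (.lapp_cong (e.mono (cbncpsCtx_isPrefix hp)) (.of_has (.svar _ _)))))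
  theorem SC.congr {R : CType} : ∀ (A : CType) {Θ : List STy} {k k' : Tm}, SC R A Θ k →
      EEq (cbncpsCtx R Θ) none k k' (.lin A R) → SC R A Θ k'
    | .base 0, Θ, k, k', h, e => by
      rw [SC] at h ⊢
      exact fun hR => e.symm.trans (h hR)
    | .base (a + 1), Θ, k, k', h, e => by
      rw [SC] at h ⊢
      exact h.congr e
    | .cunit, _, _, _, h, _ => by simp [SC] at h
    | .cand A B, Θ, k, k', h, e => by
      rw [SC] at h ⊢
      rcases h with ⟨k₁, h1, h2, h3⟩ | ⟨k₁, h1, h2, h3⟩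
      · exact Or.inl ⟨k₁, h1, h2, e.symm.trans h3⟩
      · exact Or.inr ⟨k₁, h1, h2, e.symm.trans h3⟩
    | .carr A B, Θ, k, k', h, e => by
      rw [SC] at h ⊢
      obtain ⟨a, k₁, h1, h2, h3, h4, h5⟩ := h
      exact ⟨a, k₁, h1, h2, h3, h4, e.symm.trans h5⟩
    | .iunit, Θ, k, k', h, e => by
      rw [SC] at h ⊢
      exact h.congr (.lapp_cong e (.refl (.top _)))
    | .bang A, Θ, k, k', h, e => by
      rw [SC] at h ⊢
      exact fun Θ' hp a ha hs => (h Θ' hp a ha hs).congr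
        (.lapp_cong (e.mono (cbncpsCtx_isPrefix hp)) (.bang_cong (.of_has ha)))
    | .copow A B, Θ, k, k', h, e => by
      rw [SC] at h ⊢
      exact fun Θ' hp a ha hs => SC.congr B (h Θ' hp a ha hs)
        (.llam_cong (.lapp_cong (e.mono (cbncpsCtx_isPrefix hp))
          (.copow_cong (.of_has ha) (.of_has (.svar _ _)))))
    | .czero, _, _, _, _, _ => by simp [SC]
    | .csum A B, Θ, k, k', h, e => by
      rw [SC] at h ⊢
      exact ⟨SC.congr A h.1 (.llam_cong (.lapp_cong e (.cinl_cong (.of_has (.svar _ _))))),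
        SC.congr B h.2 (.llam_cong (.lapp_cong e (.cinr_cong (.of_has (.svar _ _)))))⟩
end

mutual
  theorem SV.mono {R : CType} : ∀ (A : VType) {Θ Θ' : List STy} {t : Tm}, SV R A Θ t →
      Θ <+: Θ' → SV R A Θ' t
    | .base _, _, _, _, _, _ => by simp [SV]
    | .unit, _, _, _, _, _ => by simp [SV]
    | .prod A B, Θ, Θ', t, h, hp => by
      rw [SV] at h ⊢
      exact ⟨SV.mono A h.1 hp, SV.mono B h.2 hp⟩
    | .arr A B, Θ, Θ', t, h, hp => by
      rw [SV] at h ⊢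
      exact fun Θ'' hp' => h Θ'' (hp.trans hp')
    | .comp A, Θ, Θ', t, h, hp => by
      rw [SV] at h ⊢
      exact fun Θ'' hp' => h Θ'' (hp.trans hp')
    | .lin A B, Θ, Θ', t, h, hp => by
      rw [SV] at h ⊢
      exact fun Θ'' hp' => h Θ'' (hp.trans hp')
  theorem SC.mono {R : CType} : ∀ (A : CType) {Θ Θ' : List STy} {k : Tm}, SC R A Θ k →
      Θ <+: Θ' → SC R A Θ' k
    | .base 0, Θ, Θ', k, h, hp => by
      rw [SC] at h ⊢
      exact fun hR => (h hR).mono (cbncpsCtx_isPrefix hp)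
    | .base (a + 1), Θ, Θ', k, h, hp => by
      rw [SC] at h ⊢
      exact h.mono hp
    | .cunit, _, _, _, h, _ => by simp [SC] at h
    | .cand A B, Θ, Θ', k, h, hp => by
      rw [SC] at h ⊢
      have hq := cbncpsCtx_isPrefix (R := R) hp
      rcases h with ⟨k₁, h1, h2, h3⟩ | ⟨k₁, h1, h2, h3⟩
      · exact Or.inl ⟨k₁, h1.mono hq, SC.mono A h2 hp, h3.mono hq⟩
      · exact Or.inr ⟨k₁, h1.mono hq, SC.mono B h2 hp, h3.mono hq⟩
    | .carr A B, Θ, Θ', k, h, hp => by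
      rw [SC] at h ⊢
      have hq := cbncpsCtx_isPrefix (R := R) hp
      obtain ⟨a, k₁, h1, h2, h3, h4, h5⟩ := h
      exact ⟨a, k₁, h1.mono hq, h2.mono hq, SV.mono A h3 hp, SC.mono B h4 hp, h5.mono hq⟩
    | .iunit, Θ, Θ', k, h, hp => by
      rw [SC] at h ⊢
      exact h.mono hp
    | .bang A, Θ, Θ', k, h, hp => by
      rw [SC] at h ⊢
      exact fun Θ'' hp' => h Θ'' (hp.trans hp')
    | .copow A B, Θ, Θ', k, h, hp => by
      rw [SC] at h ⊢
      exact fun Θ'' hp' => h Θ'' (hp.trans hp')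
    | .czero, _, _, _, _, _ => by simp [SC]
    | .csum A B, Θ, Θ', k, h, hp => by
      rw [SC] at h ⊢
      exact ⟨SC.mono A h.1 hp, SC.mono B h.2 hp⟩
end

/-- The predicate on terms of type `R` over an arbitrary stoup. -/
def SR (R : CType) : Option CType → List STy → Tm → Prop
  | none, Θ, s => Ans R Θ s
  | some C, Θ, s => SC R C Θ (.llam C s)

theorem SR.congr {R : CType} {Δ : Option CType} {Θ : List STy} {s s' : Tm} (h : SR R Δ Θ s)
    (e : EEq (cbncpsCtx R Θ) Δ s s' (.comp R)) : SR R Δ Θ s' := by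
  cases Δ with
  | none => exact Ans.congr h e
  | some C => exact SC.congr C h (.llam_cong e)

/-- `γ` is a well-typed substitution of terms satisfying the logical predicate. -/
def Adm (R : CType) (Γ : List VType) (Θ : List STy) (γ : ℕ → Tm) : Prop :=
  ∀ n A, Γ[n]? = some A → Has (cbncpsCtx R Θ) none (γ n) A ∧ SV R A Θ (γ n)

theorem Adm.isSub {R : CType} {Γ : List VType} {Θ : List STy} {γ : ℕ → Tm}
    (h : Adm R Γ Θ γ) : IsSub Γ (cbncpsCtx R Θ) γ := fun n A hn => (h n A hn).1

theorem Adm.mono {R : CType} {Γ : List VType} {Θ Θ' : List STy} {γ : ℕ → Tm}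
    (h : Adm R Γ Θ γ) (hp : Θ <+: Θ') : Adm R Γ Θ' γ := fun n A hn =>
  ⟨(h n A hn).1.mono (cbncpsCtx_isPrefix hp), SV.mono A (h n A hn).2 hp⟩

theorem Adm.scons {R : CType} {Γ : List VType} {Θ : List STy} {γ : ℕ → Tm} {A : VType} {a : Tm}
    (h : Adm R Γ Θ γ) (ha : Has (cbncpsCtx R Θ) none a A) (hs : SV R A Θ a) :
    Adm R (A :: Γ) Θ (Tm.scons a γ) := by
  intro n B hn
  cases n with
  | zero =>
    obtain rfl : A = B := by simpa using hn
    exact ⟨ha, hs⟩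
  | succ n => exact h n B (by simpa using hn)

/-- A judgement satisfies the logical predicate under all admissible substitutions. -/
def Fnd (R : CType) (Γ : List VType) : Option CType → Tm → VType → Prop
  | none, t, A => ∀ Θ γ, Adm R Γ Θ γ → SV R A Θ (t.psubst γ)
  | some C, t, .comp B => ∀ Θ γ, Adm R Γ Θ γ → ∀ k, Has (cbncpsCtx R Θ) none k (.lin B R) →
      SC R B Θ k → SR R (some C) Θ (.lapp k (t.psubst γ))
  | some _, _, _ => True

theorem fnd_comp {R : CType} {Γ : List VType} {Δ : Option CType} {t : Tm} {B : CType} :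
    Fnd R Γ Δ t (.comp B) ↔ ∀ Θ γ, Adm R Γ Θ γ → ∀ k, Has (cbncpsCtx R Θ) none k (.lin B R) →
      SC R B Θ k → SR R Δ Θ (.lapp k (t.psubst γ)) := by
  cases Δ with
  | none =>
    simp only [Fnd, SV]
    exact ⟨fun h Θ γ hγ k hk hs => h Θ γ hγ Θ List.prefix_rfl k hk hs,
      fun h Θ γ hγ Θ' hp k hk hs => h Θ' γ (hγ.mono hp) k hk hs⟩
  | some C => rfl

/-- Applying the composite of a continuation with an evaluation frame. -/
theorem eeq_plug {R : CType} {Γ : List VType} {Δ : Option CType} {k E t : Tm} {X B : CType}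
    (hk : Has Γ none k (.lin B R)) (hE : Has Γ (some X) E (.comp B)) (ht : Has Γ Δ t (.comp X)) :
    EEq Γ Δ (.lapp (.llam X (.lapp k E)) t) (.lapp k (Tm.ssubst t E)) (.comp R) := by
  obtain ⟨d⟩ := hk.lapp hE
  obtain ⟨e⟩ := ht
  have := EEq.llam_beta d e
  rwa [Tm.ssubst, hk.ssubst_eq] at this

theorem eeq_lin_id {Γ : List VType} {k : Tm} {A B : CType} (hk : Has Γ none k (.lin A B)) :
    EEq Γ none (.llam A (.lapp (.llam B .svar) (.lapp k .svar))) k (.lin A B) := by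
  obtain ⟨e⟩ := hk.lapp (.svar Γ A)
  have h := EEq.llam_beta (.svar Γ B) e
  obtain ⟨d⟩ := hk
  exact (EEq.llam_cong h).trans (.llam_eta d)

theorem sc_id {R : CType} (hR : R = .base 0 ∨ R = .iunit) (Θ : List STy) :
    SC R R Θ (.llam R .svar) := by
  rcases hR with rfl | rfl
  · rw [SC]
    exact fun _ => .of_has (Has.llam (.svar _ _))
  · rw [SC]
    exact ⟨Has.lapp (Has.llam (.svar _ _)) ⟨.top _⟩, fun _ => .llam_beta (.svar _ _) (.top _)⟩

theorem SC.eeq_id {R : CType} (hR : R = .base 0 ∨ R = .iunit) {Θ : List STy} {k : Tm}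
    (hk : Has (cbncpsCtx R Θ) none k (.lin R R)) (h : SC R R Θ k) :
    EEq (cbncpsCtx R Θ) none k (.llam R .svar) (.lin R R) := by
  rcases hR with rfl | rfl
  · rw [SC] at h
    exact h rfl
  · rw [SC] at h
    obtain ⟨d⟩ := hk
    obtain ⟨e⟩ := Has.lapp ⟨d⟩ (.svar (cbncpsCtx .iunit Θ) .iunit)
    refine (EEq.llam_eta d).symm.trans (.llam_cong ?_)
    have h1 := EEq.ilet_eta (.svar _ _) e
    have h2 := EEq.ilet_eta (.svar _ _) (.svar (cbncpsCtx .iunit Θ) .iunit)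
    simp only [Tm.ssubst, Has.ssubst_eq ⟨d⟩] at h1 h2
    exact h1.symm.trans ((EEq.ilet_cong (.of_has (.svar _ _)) (h.2 rfl)).trans h2)

theorem fundamental {R : CType} {Γ : List VType} {Δ : Option CType} {t : Tm} {A : VType}
    (d : Deriv Γ Δ t A) : Fnd R Γ Δ t A := by
  have sub : ∀ {Γ : List VType} {Δ : Option CType} {t : Tm} {A : VType} {Θ : List STy}
      {γ : ℕ → Tm}, Deriv Γ Δ t A → Adm R Γ Θ γ →
      Has (cbncpsCtx R Θ) Δ (t.psubst γ) A := fun d hγ => Has.psubst ⟨d⟩ hγ.isSub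
  have subL : ∀ {Γ : List VType} {Δ : Option CType} {t : Tm} {A B : VType} {Θ : List STy}
      {γ : ℕ → Tm}, Deriv (B :: Γ) Δ t A → Adm R Γ Θ γ →
      Has (B :: cbncpsCtx R Θ) Δ (t.psubst (Tm.liftS γ)) A :=
    fun d hγ => Has.psubst ⟨d⟩ (hγ.isSub.lift _)
  induction d with
  | var Γ n A hn => exact fun Θ γ hγ => (hγ n A hn).2
  | svar Γ A =>
    intro Θ γ hγ k hk hs
    obtain ⟨e⟩ := hk
    exact SC.congr A hs (EEq.llam_eta e).symm
  | unit Γ =>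
    intro Θ γ hγ
    simp [SV]
  | vpair Γ t u A B d1 d2 ih1 ih2 =>
    intro Θ γ hγ
    obtain ⟨e1⟩ := sub d1 hγ
    obtain ⟨e2⟩ := sub d2 hγ
    rw [SV]
    exact ⟨SV.congr A (ih1 Θ γ hγ) (EEq.vfst_beta e1 e2).symm,
      SV.congr B (ih2 Θ γ hγ) (EEq.vsnd_beta e1 e2).symm⟩
  | vfst Γ t A B d ih =>
    intro Θ γ hγ
    have := ih Θ γ hγ
    rw [SV] at this
    exact this.1
  | vsnd Γ t A B d ih =>
    intro Θ γ hγ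
    have := ih Θ γ hγ
    rw [SV] at this
    exact this.2
  | vlam Γ t A B d ih =>
    intro Θ γ hγ
    rw [SV]
    intro Θ' hp a ha hs
    have hγ' := hγ.mono hp
    obtain ⟨e⟩ := subL d hγ'
    have h := ih Θ' _ (hγ'.scons ha hs)
    obtain ⟨ea⟩ := ha
    refine SV.congr B h ?_
    rw [← Tm.subst0_psubst_liftS]
    exact (EEq.vlam_beta e ea).symm
  | vapp Γ s t A B d1 d2 ih1 ih2 =>
    intro Θ γ hγ
    have := ih1 Θ γ hγ
    rw [SV] at this
    exact this Θ List.prefix_rfl _ (sub d2 hγ) (ih2 Θ γ hγ)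
  | cunit Γ Δ =>
    rw [fnd_comp]
    intro Θ γ hγ k hk hs
    simp [SC] at hs
  | cpair Γ Δ t u A B d1 d2 ih1 ih2 =>
    rw [fnd_comp] at ih1 ih2 ⊢
    intro Θ γ hγ k hk hs
    obtain ⟨e1⟩ := sub d1 hγ
    obtain ⟨e2⟩ := sub d2 hγ
    have e := Deriv.cpair _ _ _ _ _ _ e1 e2
    rw [SC] at hs
    rcases hs with ⟨k', hk', hs, h⟩ | ⟨k', hk', hs, h⟩
    · refine (ih1 Θ γ hγ k' hk' hs).congr (EEq.symm ?_)
      have p := eeq_plug hk' ⟨.cfst _ _ _ _ _ (.svar _ _)⟩ ⟨e⟩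
      exact (EEq.lapp_cong h (.refl e)).trans
        (p.trans (.lapp_cong (.of_has hk') (.cfst_beta e1 e2)))
    · refine (ih2 Θ γ hγ k' hk' hs).congr (EEq.symm ?_)
      have p := eeq_plug hk' ⟨.csnd _ _ _ _ _ (.svar _ _)⟩ ⟨e⟩
      exact (EEq.lapp_cong h (.refl e)).trans
        (p.trans (.lapp_cong (.of_has hk') (.csnd_beta e1 e2)))
  | cfst Γ Δ t A B d ih =>
    rw [fnd_comp] at ih ⊢
    intro Θ γ hγ k hk hs
    have hE : Has (cbncpsCtx R Θ) (some (.cand A B)) (.cfst .svar) (.comp A) :=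
      ⟨.cfst _ _ _ _ _ (.svar _ _)⟩
    have hk1 := (hk.lapp hE).llam
    refine (ih Θ γ hγ _ hk1 ?_).congr (eeq_plug hk hE (sub d hγ))
    rw [SC]
    exact Or.inl ⟨k, hk, hs, .of_has hk1⟩
  | csnd Γ Δ t A B d ih =>
    rw [fnd_comp] at ih ⊢
    intro Θ γ hγ k hk hs
    have hE : Has (cbncpsCtx R Θ) (some (.cand A B)) (.csnd .svar) (.comp B) :=
      ⟨.csnd _ _ _ _ _ (.svar _ _)⟩
    have hk1 := (hk.lapp hE).llam
    refine (ih Θ γ hγ _ hk1 ?_).congr (eeq_plug hk hE (sub d hγ))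
    rw [SC]
    exact Or.inr ⟨k, hk, hs, .of_has hk1⟩
  | clam Γ Δ t A B d ih =>
    rw [fnd_comp] at ih ⊢
    intro Θ γ hγ k hk hs
    rw [SC] at hs
    obtain ⟨a, k', ha, hk', hsa, hs, h⟩ := hs
    obtain ⟨e⟩ := subL d hγ
    obtain ⟨ea⟩ := ha
    refine (ih Θ _ (hγ.scons ⟨ea⟩ hsa) k' hk' hs).congr (EEq.symm ?_)
    have p := eeq_plug hk' ⟨.capp _ _ _ _ _ _ (.svar _ _) ea⟩ ⟨.clam _ _ _ _ _ e⟩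
    simp only [Tm.ssubst, Has.ssubst_eq ⟨ea⟩] at p
    rw [← Tm.subst0_psubst_liftS]
    exact (EEq.lapp_cong h (.refl (.clam _ _ _ _ _ e))).trans
      (p.trans (.lapp_cong (.of_has hk') (.clam_beta e ea)))
  | capp Γ Δ s t A B d1 d2 ih1 ih2 =>
    rw [fnd_comp] at ih1 ⊢
    intro Θ γ hγ k hk hs
    have ht := sub d2 hγ
    have hE : Has (cbncpsCtx R Θ) (some (.carr A B)) (.capp .svar (t.psubst γ)) (.comp B) :=
      ht.elim fun e => ⟨.capp _ _ _ _ _ _ (.svar _ _) e⟩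
    have hk1 := (hk.lapp hE).llam
    have p := eeq_plug hk hE (sub d1 hγ)
    simp only [Tm.ssubst, ht.ssubst_eq] at p
    refine (ih1 Θ γ hγ _ hk1 ?_).congr p
    rw [SC]
    exact ⟨_, k, ht, hk, ih2 Θ γ hγ, hs, .of_has hk1⟩
  | top Γ =>
    rw [fnd_comp]
    intro Θ γ hγ k hk hs
    rw [SC] at hs
    exact hs
  | ilet Γ Δ t u A d1 d2 ih1 ih2 =>
    rw [fnd_comp] at ih1 ih2 ⊢
    intro Θ γ hγ k hk hs
    obtain ⟨e2⟩ := sub d2 hγ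
    have hE : Has (cbncpsCtx R Θ) (some .iunit) (.ilet .svar (u.psubst γ)) (.comp A) :=
      ⟨.ilet _ _ _ _ _ (.svar _ _) e2⟩
    have p := eeq_plug hk hE (sub d1 hγ)
    have q := eeq_plug hk hE ⟨.top _⟩
    simp only [Tm.ssubst, Has.ssubst_eq ⟨e2⟩] at p q
    refine (ih1 Θ γ hγ _ (hk.lapp hE).llam ?_).congr p
    rw [SC]
    exact Ans.congr (ih2 Θ γ hγ k hk hs)
      (q.trans (.lapp_cong (.of_has hk) (.ilet_beta e2))).symm
  | bang Γ t A d ih =>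
    rw [fnd_comp]
    intro Θ γ hγ k hk hs
    rw [SC] at hs
    exact hs Θ List.prefix_rfl _ (sub d hγ) (ih Θ γ hγ)
  | banglet Γ Δ t u A B d1 d2 ih1 ih2 =>
    rw [fnd_comp] at ih1 ih2 ⊢
    intro Θ γ hγ k hk hs
    have hE : ∀ {Θ' : List STy}, Θ <+: Θ' → Has (cbncpsCtx R Θ') (some (.bang A))
        (.banglet .svar (u.psubst (Tm.liftS γ))) (.comp B) := fun hp =>
      (subL d2 (hγ.mono hp)).elim fun e => ⟨.banglet _ _ _ _ _ _ (.svar _ _) e⟩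
    have p := eeq_plug hk (hE List.prefix_rfl) (sub d1 hγ)
    simp only [Tm.ssubst, (subL d2 hγ).ssubst_eq] at p
    refine (ih1 Θ γ hγ _ (hk.lapp (hE List.prefix_rfl)).llam ?_).congr p
    rw [SC]
    intro Θ' hp a ha hsa
    have hk' := hk.mono (cbncpsCtx_isPrefix hp)
    obtain ⟨e2⟩ := subL d2 (hγ.mono hp)
    obtain ⟨ea⟩ := ha
    have q := eeq_plug hk' (hE hp) ⟨.bang _ _ _ ea⟩
    simp only [Tm.ssubst, Has.ssubst_eq ⟨e2⟩] at q
    have h := ih2 Θ' _ ((hγ.mono hp).scons ⟨ea⟩ hsa) k hk' (SC.mono B hs hp)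
    rw [← Tm.subst0_psubst_liftS] at h
    exact Ans.congr h (q.trans (.lapp_cong (.of_has hk') (.bang_beta ea e2))).symm
  | copow Γ Δ t u A B d1 d2 ih1 ih2 =>
    rw [fnd_comp] at ih2 ⊢
    intro Θ γ hγ k hk hs
    have ht := sub d1 hγ
    have hE : Has (cbncpsCtx R Θ) (some B) (.copow (t.psubst γ) .svar) (.comp (.copow A B)) :=
      ht.elim fun e => ⟨.copow _ _ _ _ _ _ e (.svar _ _)⟩
    have p := eeq_plug hk hE (sub d2 hγ)
    simp only [Tm.ssubst, ht.ssubst_eq] at p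
    refine (ih2 Θ γ hγ _ (hk.lapp hE).llam ?_).congr p
    rw [SC] at hs
    exact hs Θ List.prefix_rfl _ ht (ih1 Θ γ hγ)
  | copowlet Γ Δ s t A B C d1 d2 ih1 ih2 =>
    rw [fnd_comp] at ih1 ih2 ⊢
    intro Θ γ hγ k hk hs
    have hE : ∀ {Θ' : List STy}, Θ <+: Θ' → Has (cbncpsCtx R Θ') (some (.copow A B))
        (.copowlet .svar (t.psubst (Tm.liftS γ))) (.comp C) := fun hp =>
      (subL d2 (hγ.mono hp)).elim fun e => ⟨.copowlet _ _ _ _ _ _ _ (.svar _ _) e⟩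
    refine (ih1 Θ γ hγ _ (hk.lapp (hE List.prefix_rfl)).llam ?_).congr
      (eeq_plug hk (hE List.prefix_rfl) (sub d1 hγ))
    rw [SC]
    intro Θ' hp a ha hsa
    have hk' := hk.mono (cbncpsCtx_isPrefix hp)
    obtain ⟨e2⟩ := subL d2 (hγ.mono hp)
    obtain ⟨ea⟩ := ha
    have q := eeq_plug hk' (hE hp) ⟨.copow _ _ _ _ _ _ ea (.svar _ B)⟩
    have r := EEq.copow_beta ea (.svar _ B) e2
    have h := ih2 Θ' _ ((hγ.mono hp).scons ⟨ea⟩ hsa) k hk' (SC.mono C hs hp)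
    rw [← Tm.subst0_psubst_liftS] at h
    rw [Tm.ssubst_svar] at r
    exact SC.congr B h (.llam_cong (q.trans (.lapp_cong (.of_has hk') r)).symm)
  | cimage Γ Δ t A d ih =>
    rw [fnd_comp] at ih ⊢
    intro Θ γ hγ k hk hs
    have hE : Has (cbncpsCtx R Θ) (some .czero) (.cimage A .svar) (.comp A) :=
      ⟨.cimage _ _ _ _ (.svar _ _)⟩
    refine (ih Θ γ hγ _ (hk.lapp hE).llam ?_).congr (eeq_plug hk hE (sub d hγ))
    simp [SC]
  | cinl Γ Δ t A B d ih =>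
    rw [fnd_comp] at ih ⊢
    intro Θ γ hγ k hk hs
    have hE : Has (cbncpsCtx R Θ) (some A) (.cinl .svar) (.comp (.csum A B)) :=
      ⟨.cinl _ _ _ _ _ (.svar _ _)⟩
    rw [SC] at hs
    exact (ih Θ γ hγ _ (hk.lapp hE).llam hs.1).congr (eeq_plug hk hE (sub d hγ))
  | cinr Γ Δ t A B d ih =>
    rw [fnd_comp] at ih ⊢
    intro Θ γ hγ k hk hs
    have hE : Has (cbncpsCtx R Θ) (some B) (.cinr .svar) (.comp (.csum A B)) :=
      ⟨.cinr _ _ _ _ _ (.svar _ _)⟩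
    rw [SC] at hs
    exact (ih Θ γ hγ _ (hk.lapp hE).llam hs.2).congr (eeq_plug hk hE (sub d hγ))
  | ccase Γ Δ s t u A B C d1 d2 d3 ih1 ih2 ih3 =>
    rw [fnd_comp] at ih1 ih2 ih3 ⊢
    intro Θ γ hγ k hk hs
    obtain ⟨e2⟩ := sub d2 hγ
    obtain ⟨e3⟩ := sub d3 hγ
    have hE : Has (cbncpsCtx R Θ) (some (.csum A B))
        (.ccase .svar (t.psubst γ) (u.psubst γ)) (.comp C) :=
      ⟨.ccase _ _ _ _ _ _ _ _ (.svar _ _) e2 e3⟩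
    refine (ih1 Θ γ hγ _ (hk.lapp hE).llam ?_).congr (eeq_plug hk hE (sub d1 hγ))
    have ql := eeq_plug hk hE ⟨.cinl _ _ _ _ _ (.svar _ _)⟩
    have qr := eeq_plug hk hE ⟨.cinr _ _ _ _ _ (.svar _ _)⟩
    have rl := EEq.csum_beta_inl e2 e3 (.svar _ _)
    have rr := EEq.csum_beta_inr e2 e3 (.svar _ _)
    rw [Tm.ssubst_svar] at rl rr
    rw [SC]
    exact ⟨SC.congr A (ih2 Θ γ hγ k hk hs)
        (.llam_cong (ql.trans (.lapp_cong (.of_has hk) rl)).symm),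
      SC.congr B (ih3 Θ γ hγ k hk hs)
        (.llam_cong (qr.trans (.lapp_cong (.of_has hk) rr)).symm)⟩
  | llam Γ t A B d ih =>
    rw [fnd_comp] at ih
    intro Θ γ hγ
    rw [SV]
    intro Θ' hp k hk hs
    obtain ⟨e⟩ := sub d (hγ.mono hp)
    refine SC.congr A (ih Θ' γ (hγ.mono hp) k hk hs) (.llam_cong ?_)
    have := EEq.llam_beta e (.svar _ A)
    rw [Tm.ssubst_svar] at this
    exact .lapp_cong (.of_has hk) this.symm
  | lapp Γ Δ s t A B d1 d2 ih1 ih2 =>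
    rw [fnd_comp] at ih2 ⊢
    intro Θ γ hγ k hk hs
    have h1 := sub d1 hγ
    have hE := h1.lapp (.svar _ A)
    have h := ih1 Θ γ hγ
    rw [SV] at h
    have p := eeq_plug hk hE (sub d2 hγ)
    simp only [Tm.ssubst, h1.ssubst_eq] at p
    exact (ih2 Θ γ hγ _ (hk.lapp hE).llam (h Θ List.prefix_rfl k hk hs)).congr p

theorem sv_lin_iff {R : CType} (hR : R = .base 0 ∨ R = .iunit) {A : CType} {Θ : List STy}
    {a : Tm} (ha : Has (cbncpsCtx R Θ) none a (.lin A R)) :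
    SV R (.lin A R) Θ a ↔ SC R A Θ a := by
  rw [SV]
  constructor
  · intro h
    exact SC.congr A (h Θ List.prefix_rfl _ (Has.llam (.svar _ _)) (sc_id hR Θ)) (eeq_lin_id ha)
  · intro h Θ' hp k hk hs
    have ha' := ha.mono (cbncpsCtx_isPrefix hp)
    refine SC.congr A (SC.mono A h hp) (EEq.symm ?_)
    exact (EEq.llam_cong (.lapp_cong (SC.eeq_id hR hk hs)
      (.of_has (ha'.lapp (.svar _ _))))).trans (eeq_lin_id ha')

theorem sc_iff_definable {R : CType} (hR : R = .base 0 ∨ R = .iunit) (τ : STy) :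
    ∀ (Θ : List STy) (k : Tm), Has (cbncpsCtx R Θ) none k (.lin (cbncpsT R τ) R) →
      (SC R (cbncpsT R τ) Θ k ↔ Definable R τ Θ k) := by
  induction τ with
  | base a =>
    intro Θ k hk
    rw [cbncpsT, assocC, SC]
  | unit =>
    rintro Θ k ⟨e⟩
    rw [cbncpsT, SC, true_iff]
    refine ⟨.unit, .unit Θ, ?_⟩
    have h := EEq.czero_eta (.svar _ _) (.lapp _ _ _ _ _ _ e (.svar _ _))
    rw [Tm.ssubst_svar] at h
    exact (EEq.llam_cong h).trans (.llam_eta e)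
  | prod σ τ ih1 ih2 =>
    intro Θ k hk
    have hl : Has (cbncpsCtx R Θ) (some (cbncpsT R σ))
        (.cinl .svar) (.comp (.csum (cbncpsT R σ) (cbncpsT R τ))) :=
      ⟨.cinl _ _ _ _ _ (.svar _ _)⟩
    have hr : Has (cbncpsCtx R Θ) (some (cbncpsT R τ))
        (.cinr .svar) (.comp (.csum (cbncpsT R σ) (cbncpsT R τ))) :=
      ⟨.cinr _ _ _ _ _ (.svar _ _)⟩
    rw [cbncpsT, SC, ih1 Θ _ (hk.lapp hl).llam, ih2 Θ _ (hk.lapp hr).llam]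
    constructor
    · rintro ⟨⟨M, dM, hM⟩, ⟨N, dN, hN⟩⟩
      refine ⟨_, .pair _ _ _ _ _ dM dN, ?_⟩
      obtain ⟨e⟩ := hk
      have h1 := EEq.lapp_cong hM (.of_has (.svar _ _))
      have h2 := EEq.lapp_cong hN (.of_has (.svar _ _))
      have b1 := eeq_plug ⟨e⟩ hl (.svar _ _)
      have b2 := eeq_plug ⟨e⟩ hr (.svar _ _)
      have h := EEq.csum_eta (.svar _ _) (.lapp _ _ _ _ _ _ e (.svar _ _))
      simp only [Tm.ssubst, Has.ssubst_eq ⟨e⟩] at b1 b2 h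
      exact (EEq.llam_cong ((EEq.ccase_cong (.of_has (.svar _ _)) (h1.trans b1)
        (h2.trans b2)).trans h)).trans (.llam_eta e)
    · rintro ⟨M, dM, hM⟩
      exact ⟨⟨_, .fst _ _ _ _ dM, .llam_cong (.lapp_cong hM (.of_has hl))⟩,
        ⟨_, .snd _ _ _ _ dM, .llam_cong (.lapp_cong hM (.of_has hr))⟩⟩
  | arr σ τ ih1 ih2 =>
    intro Θ k hk
    have hE : ∀ {Θ' : List STy} {a : Tm},
        Has (cbncpsCtx R Θ') none a (.lin (cbncpsT R σ) R) →
        Has (cbncpsCtx R Θ') (some (cbncpsT R τ)) (.copow a .svar)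
          (.comp (.copow (.lin (cbncpsT R σ) R) (cbncpsT R τ))) := fun ha =>
      ha.elim fun e => ⟨.copow _ _ _ _ _ _ e (.svar _ _)⟩
    rw [cbncpsT, SC]
    constructor
    · intro h
      have hn : (Θ ++ [σ])[Θ.length]? = some σ := by simp
      have hp : Θ <+: Θ ++ [σ] := List.prefix_append _ _
      have ha : Has (cbncpsCtx R (Θ ++ [σ])) none (.var Θ.length) (.lin (cbncpsT R σ) R) :=
        has_cbncps R (.var _ _ _ hn)
      have hk' := hk.mono (cbncpsCtx_isPrefix hp)
      have hs := h (Θ ++ [σ]) hp _ ha ((sv_lin_iff hR ha).2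
        ((ih1 _ _ ha).2 ⟨_, .var _ _ _ hn, .of_has ha⟩))
      obtain ⟨M, dM, hM⟩ := (ih2 _ _ (hk'.lapp (hE ha)).llam).1 hs
      obtain ⟨dM', hM'⟩ := exists_rename_cbncps R dM (isRen_closeRen Θ σ)
      have hren : IsRen (cbncpsCtx R (Θ ++ [σ])) (cbncpsCtx R (σ :: Θ))
          (closeRen Θ.length) := by
        have := isRen_closeRen (cbncpsCtx R Θ) (.lin (cbncpsT R σ) R)
        simpa [cbncpsCtx] using this
      have hc : k.rename (closeRen Θ.length) = k.shift := hk.rename_congr fun n hn => by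
        have : n < Θ.length := by simpa [cbncpsCtx] using hn
        simp [closeRen, this.ne]
      have hv : Tm.rename (closeRen Θ.length) (.var Θ.length) = .var 0 := by
        simp [Tm.rename, closeRen]
      have hM2 := hM.rename hren
      rw [← hM'] at hM2
      simp only [Tm.rename, hc] at hM2
      rw [show closeRen Θ.length Θ.length = 0 by simp [closeRen]] at hM2
      refine ⟨_, .lam _ _ _ _ dM', ?_⟩
      have hs' := hk.shift (.lin (cbncpsT R σ) R)
      have b := eeq_plug hs' (hE (Θ' := σ :: Θ) (a := .var 0) ⟨.var _ _ _ rfl⟩) (.svar _ _)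
      rw [Tm.ssubst_svar] at b
      obtain ⟨e⟩ := hk
      have c := EEq.copow_eta (.svar _ _) (.lapp _ _ _ _ _ _ e (.svar _ _))
      have hsh : Tm.shift (.lapp k .svar) = .lapp k.shift .svar := rfl
      simp only [hsh, Tm.ssubst, hs'.ssubst_eq, Has.ssubst_eq ⟨e⟩] at c
      exact (EEq.llam_cong ((EEq.copowlet_cong (.of_has (.svar _ _))
        ((EEq.lapp_cong hM2 (.of_has (.svar _ _))).trans b)).trans c)).trans (.llam_eta e)
    · rintro ⟨N, dN, hN⟩ Θ' hp a ha hs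
      obtain ⟨P, dP, hP⟩ := (ih1 _ _ ha).1 ((sv_lin_iff hR ha).1 hs)
      have hk' := hk.mono (cbncpsCtx_isPrefix hp)
      obtain ⟨N', dN', hN'⟩ := Definable.mono ⟨N, dN, hN⟩ hp
      exact (ih2 _ _ (hk'.lapp (hE ha)).llam).2
        ⟨_, .app _ _ _ _ _ dN' dP, .llam_cong (.lapp_cong hN' (.copow_cong hP
          (.of_has (.svar _ _))))⟩

theorem cbncps_full {R : CType} (hR : R = .base 0 ∨ R = .iunit) {Θ : List STy} {τ : STy}
    {t : Tm} (ht : Has (cbncpsCtx R Θ) none t (.lin (cbncpsT R τ) R)) : Definable R τ Θ t := by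
  refine (sc_iff_definable hR τ Θ t ht).1 ((sv_lin_iff hR ht).1 ?_)
  have hγ : Adm R (cbncpsCtx R Θ) Θ .var := by
    intro n A hn
    obtain ⟨σ, hσ, rfl⟩ : ∃ σ, Θ[n]? = some σ ∧ VType.lin (cbncpsT R σ) R = A := by
      simpa [cbncpsCtx] using hn
    have hv := has_cbncps R (.var Θ n σ hσ)
    exact ⟨hv, (sv_lin_iff hR hv).2
      ((sc_iff_definable hR σ Θ _ hv).2 ⟨_, .var Θ n σ hσ, .of_has hv⟩)⟩
  obtain ⟨d⟩ := ht
  simpa only [Tm.psubst_var] using fundamental d Θ .var hγ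

/-! ## A set-theoretic model with contravariant computation types -/

mutual
  /-- Value types denote types; the linear function type `A ⊸ B` denotes functions from
  continuations of `B` to continuations of `A`. -/
  def VD : VType → Type
    | .base _ => Unit
    | .unit => Unit
    | .prod A B => VD A × VD B
    | .arr A B => VD A → VD B
    | .comp _ => Unit
    | .lin A B => CD B → CD A
  /-- Computation types denote the type of their continuations. -/
  def CD : CType → Type
    | .base 0 => Unit
    | .base (_ + 1) => ℕ → LTm
    | .cunit => Empty
    | .cand A B => CD A ⊕ CD B
    | .carr A B => VD A × CD B
    | .iunit => Unit
    | .bang _ => Unit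
    | .copow A B => VD A → CD B
    | .czero => Unit
    | .csum A B => CD A × CD B
end

/-- Environments for a context. -/
def Env (Γ : List VType) : Type :=
  ∀ (n : ℕ) (A : VType), Γ[n]? = some A → VD A

/-- Extension of an environment. -/
def Env.cons {Γ : List VType} {A : VType} (x : VD A) (γ : Env Γ) : Env (A :: Γ)
  | 0, _, h => Option.some.inj h ▸ x
  | n + 1, B, h => γ n B h

/-- The most recent entry of an environment. -/
def Env.head {Γ : List VType} {A : VType} (γ : Env (A :: Γ)) : VD A := γ 0 A rfl

/-- Removal of the most recent entry of an environment. -/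
def Env.tail {Γ : List VType} {A : VType} (γ : Env (A :: Γ)) : Env Γ :=
  fun n B h => γ (n + 1) B h

/-- The type of denotations of judgements. -/
def SemT : Option CType → VType → Type
  | none, A => VD A
  | some C, .comp B => CD B → CD C
  | some _, _ => Unit

/-- `Den Γ Δ t A f` expresses that `f` is the denotation of the term `t`. -/
inductive Den : (Γ : List VType) → (Δ : Option CType) → Tm → (A : VType) →
    (Env Γ → SemT Δ A) → Prop
  | triv {Γ t B} : Has Γ none t (.comp B) → Den Γ none t (.comp B) (fun _ => ())
  | var {Γ n A} (h : Γ[n]? = some A) : Den Γ none (.var n) A (fun γ => γ n A h)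
  | unit {Γ} : Den Γ none .unit .unit (fun _ => ())
  | vpair {Γ t u A B} {f : Env Γ → VD A} {g : Env Γ → VD B} :
      Den Γ none t A f → Den Γ none u B g →
      Den Γ none (.vpair t u) (.prod A B) (fun γ => (f γ, g γ))
  | vfst {Γ t A B} {f : Env Γ → VD A × VD B} : Den Γ none t (.prod A B) f →
      Den Γ none (.vfst t) A (fun γ => (f γ).1)
  | vsnd {Γ t A B} {f : Env Γ → VD A × VD B} : Den Γ none t (.prod A B) f →
      Den Γ none (.vsnd t) B (fun γ => (f γ).2)
  | vlam {Γ t A B} {f : Env (A :: Γ) → VD B} : Den (A :: Γ) none t B f →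
      Den Γ none (.vlam A t) (.arr A B) (fun γ (x : VD A) => f (γ.cons x))
  | vapp {Γ s t A B} {f : Env Γ → VD A → VD B} {g : Env Γ → VD A} :
      Den Γ none s (.arr A B) f → Den Γ none t A g →
      Den Γ none (.vapp s t) B (fun γ => f γ (g γ))
  | llam {Γ t A B} {f : Env Γ → CD B → CD A} : Den Γ (some A) t (.comp B) f →
      Den Γ none (.llam A t) (.lin A B) f
  | svar {Γ A} : Den Γ (some A) .svar (.comp A) (fun _ (k : CD A) => k)
  | cunit {Γ C} : Den Γ (some C) .cunit (.comp .cunit) (fun _ (k : Empty) => k.elim)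
  | cpair {Γ C t u A B} {f : Env Γ → CD A → CD C} {g : Env Γ → CD B → CD C} :
      Den Γ (some C) t (.comp A) f → Den Γ (some C) u (.comp B) g →
      Den Γ (some C) (.cpair t u) (.comp (.cand A B))
        (fun γ (k : CD A ⊕ CD B) => k.elim (f γ) (g γ))
  | cfst {Γ C t A B} {f : Env Γ → CD A ⊕ CD B → CD C} :
      Den Γ (some C) t (.comp (.cand A B)) f →
      Den Γ (some C) (.cfst t) (.comp A) (fun γ (k : CD A) => f γ (.inl k))
  | csnd {Γ C t A B} {f : Env Γ → CD A ⊕ CD B → CD C} :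
      Den Γ (some C) t (.comp (.cand A B)) f →
      Den Γ (some C) (.csnd t) (.comp B) (fun γ (k : CD B) => f γ (.inr k))
  | clam {Γ C t A B} {f : Env (A :: Γ) → CD B → CD C} :
      Den (A :: Γ) (some C) t (.comp B) f →
      Den Γ (some C) (.clam A t) (.comp (.carr A B))
        (fun γ (k : VD A × CD B) => f (γ.cons k.1) k.2)
  | capp {Γ C s t A B} {f : Env Γ → VD A × CD B → CD C} {g : Env Γ → VD A} :
      Den Γ (some C) s (.comp (.carr A B)) f → Den Γ none t A g →
      Den Γ (some C) (.capp s t) (.comp B) (fun γ (k : CD B) => f γ (g γ, k))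
  | ilet {Γ C t u A} {f : Env Γ → Unit → CD C} :
      Den Γ (some C) t (.comp .iunit) f → Has Γ none u (.comp A) →
      Den Γ (some C) (.ilet t u) (.comp A) (fun γ (_ : CD A) => f γ ())
  | banglet {Γ C t u A B} {f : Env Γ → Unit → CD C} :
      Den Γ (some C) t (.comp (.bang A)) f → Has (A :: Γ) none u (.comp B) →
      Den Γ (some C) (.banglet t u) (.comp B) (fun γ (_ : CD B) => f γ ())
  | copow {Γ C t u A B} {f : Env Γ → VD A} {g : Env Γ → CD B → CD C} :
      Den Γ none t A f → Den Γ (some C) u (.comp B) g →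
      Den Γ (some C) (.copow t u) (.comp (.copow A B))
        (fun γ (k : VD A → CD B) => g γ (k (f γ)))
  | copowlet {Γ C s t A B D} {f : Env Γ → (VD A → CD B) → CD C}
      {g : Env (A :: Γ) → CD D → CD B} :
      Den Γ (some C) s (.comp (.copow A B)) f → Den (A :: Γ) (some B) t (.comp D) g →
      Den Γ (some C) (.copowlet s t) (.comp D)
        (fun γ (k : CD D) => f γ (fun a => g (γ.cons a) k))
  | cimage {Γ C t A} {f : Env Γ → Unit → CD C} : Den Γ (some C) t (.comp .czero) f →
      Den Γ (some C) (.cimage A t) (.comp A) (fun γ (_ : CD A) => f γ ())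
  | cinl {Γ C t A B} {f : Env Γ → CD A → CD C} : Den Γ (some C) t (.comp A) f →
      Den Γ (some C) (.cinl t) (.comp (.csum A B)) (fun γ (k : CD A × CD B) => f γ k.1)
  | cinr {Γ C t A B} {f : Env Γ → CD B → CD C} : Den Γ (some C) t (.comp B) f →
      Den Γ (some C) (.cinr t) (.comp (.csum A B)) (fun γ (k : CD A × CD B) => f γ k.2)
  | ccase {Γ C s t u A B D} {f : Env Γ → CD A × CD B → CD C} {g : Env Γ → CD D → CD A}
      {h : Env Γ → CD D → CD B} :
      Den Γ (some C) s (.comp (.csum A B)) f → Den Γ (some A) t (.comp D) g →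
      Den Γ (some B) u (.comp D) h →
      Den Γ (some C) (.ccase s t u) (.comp D) (fun γ (k : CD D) => f γ (g γ k, h γ k))
  | lapp {Γ C s t A B} {f : Env Γ → CD B → CD A} {g : Env Γ → CD A → CD C} :
      Den Γ none s (.lin A B) f → Den Γ (some C) t (.comp A) g →
      Den Γ (some C) (.lapp s t) (.comp B) (fun γ (k : CD B) => g γ (f γ k))

theorem exists_den {Γ : List VType} {Δ : Option CType} {t : Tm} {A : VType}
    (d : Deriv Γ Δ t A) : ∃ f, Den Γ Δ t A f := by
  have key := d
  induction d with
  | var Γ n A h => exact ⟨_, .var h⟩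
  | unit Γ => exact ⟨_, .unit⟩
  | vpair Γ t u A B d1 d2 ih1 ih2 =>
    obtain ⟨f, hf⟩ := ih1 d1
    obtain ⟨g, hg⟩ := ih2 d2
    exact ⟨_, .vpair hf hg⟩
  | vfst Γ t A B d ih => exact (ih d).elim fun f hf => ⟨_, .vfst hf⟩
  | vsnd Γ t A B d ih => exact (ih d).elim fun f hf => ⟨_, .vsnd hf⟩
  | vlam Γ t A B d ih => exact (ih d).elim fun f hf => ⟨_, .vlam hf⟩
  | vapp Γ s t A B d1 d2 ih1 ih2 =>
    obtain ⟨f, hf⟩ := ih1 d1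
    obtain ⟨g, hg⟩ := ih2 d2
    exact ⟨_, .vapp hf hg⟩
  | llam Γ t A B d ih => exact (ih d).elim fun f hf => ⟨_, .llam hf⟩
  | svar Γ A => exact ⟨_, .svar⟩
  | top Γ => exact ⟨_, .triv ⟨key⟩⟩
  | bang Γ t A d ih => exact ⟨_, .triv ⟨key⟩⟩
  | cunit Γ Δ =>
    cases Δ with
    | none => exact ⟨_, .triv ⟨key⟩⟩
    | some C => exact ⟨_, .cunit⟩
  | cpair Γ Δ t u A B d1 d2 ih1 ih2 =>
    cases Δ with
    | none => exact ⟨_, .triv ⟨key⟩⟩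
    | some C =>
      obtain ⟨f, hf⟩ := ih1 d1
      obtain ⟨g, hg⟩ := ih2 d2
      exact ⟨_, .cpair hf hg⟩
  | cfst Γ Δ t A B d ih =>
    cases Δ with
    | none => exact ⟨_, .triv ⟨key⟩⟩
    | some C => exact (ih d).elim fun f hf => ⟨_, .cfst hf⟩
  | csnd Γ Δ t A B d ih =>
    cases Δ with
    | none => exact ⟨_, .triv ⟨key⟩⟩
    | some C => exact (ih d).elim fun f hf => ⟨_, .csnd hf⟩
  | clam Γ Δ t A B d ih =>
    cases Δ with
    | none => exact ⟨_, .triv ⟨key⟩⟩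
    | some C => exact (ih d).elim fun f hf => ⟨_, .clam hf⟩
  | capp Γ Δ s t A B d1 d2 ih1 ih2 =>
    cases Δ with
    | none => exact ⟨_, .triv ⟨key⟩⟩
    | some C =>
      obtain ⟨f, hf⟩ := ih1 d1
      obtain ⟨g, hg⟩ := ih2 d2
      exact ⟨_, .capp hf hg⟩
  | ilet Γ Δ t u A d1 d2 ih1 ih2 =>
    cases Δ with
    | none => exact ⟨_, .triv ⟨key⟩⟩
    | some C => exact (ih1 d1).elim fun f hf => ⟨_, .ilet hf ⟨d2⟩⟩
  | banglet Γ Δ t u A B d1 d2 ih1 ih2 =>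
    cases Δ with
    | none => exact ⟨_, .triv ⟨key⟩⟩
    | some C => exact (ih1 d1).elim fun f hf => ⟨_, .banglet hf ⟨d2⟩⟩
  | copow Γ Δ t u A B d1 d2 ih1 ih2 =>
    cases Δ with
    | none => exact ⟨_, .triv ⟨key⟩⟩
    | some C =>
      obtain ⟨f, hf⟩ := ih1 d1
      obtain ⟨g, hg⟩ := ih2 d2
      exact ⟨_, .copow hf hg⟩
  | copowlet Γ Δ s t A B D d1 d2 ih1 ih2 =>
    cases Δ with
    | none => exact ⟨_, .triv ⟨key⟩⟩
    | some C =>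
      obtain ⟨f, hf⟩ := ih1 d1
      obtain ⟨g, hg⟩ := ih2 d2
      exact ⟨_, .copowlet hf hg⟩
  | cimage Γ Δ t A d ih =>
    cases Δ with
    | none => exact ⟨_, .triv ⟨key⟩⟩
    | some C => exact (ih d).elim fun f hf => ⟨_, .cimage hf⟩
  | cinl Γ Δ t A B d ih =>
    cases Δ with
    | none => exact ⟨_, .triv ⟨key⟩⟩
    | some C => exact (ih d).elim fun f hf => ⟨_, .cinl hf⟩
  | cinr Γ Δ t A B d ih =>
    cases Δ with
    | none => exact ⟨_, .triv ⟨key⟩⟩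
    | some C => exact (ih d).elim fun f hf => ⟨_, .cinr hf⟩
  | ccase Γ Δ s t u A B D d1 d2 d3 ih1 ih2 ih3 =>
    cases Δ with
    | none => exact ⟨_, .triv ⟨key⟩⟩
    | some C =>
      obtain ⟨f, hf⟩ := ih1 d1
      obtain ⟨g, hg⟩ := ih2 d2
      obtain ⟨h, hh⟩ := ih3 d3
      exact ⟨_, .ccase hf hg hh⟩
  | lapp Γ Δ s t A B d1 d2 ih1 ih2 =>
    cases Δ with
    | none => exact ⟨_, .triv ⟨key⟩⟩
    | some C =>
      obtain ⟨f, hf⟩ := ih1 d1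
      obtain ⟨g, hg⟩ := ih2 d2
      exact ⟨_, .lapp hf hg⟩

theorem Den.congr {Γ : List VType} {Δ : Option CType} {t : Tm} {A : VType}
    {f g : Env Γ → SemT Δ A} (h : Den Γ Δ t A f) (e : f = g) : Den Γ Δ t A g := e ▸ h

theorem Den.has {Γ : List VType} {Δ : Option CType} {t : Tm} {A : VType} {f : Env Γ → SemT Δ A}
    (h : Den Γ Δ t A f) : Has Γ Δ t A := by
  induction h with
  | triv h => exact h
  | var h => exact ⟨.var _ _ _ h⟩
  | unit => exact ⟨.unit _⟩
  | vpair _ _ ih1 ih2 => exact ih1.elim fun d => ih2.elim fun e => ⟨.vpair _ _ _ _ _ d e⟩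
  | vfst _ ih => exact ih.elim fun d => ⟨.vfst _ _ _ _ d⟩
  | vsnd _ ih => exact ih.elim fun d => ⟨.vsnd _ _ _ _ d⟩
  | vlam _ ih => exact ih.elim fun d => ⟨.vlam _ _ _ _ d⟩
  | vapp _ _ ih1 ih2 => exact ih1.elim fun d => ih2.elim fun e => ⟨.vapp _ _ _ _ _ d e⟩
  | llam _ ih => exact ih.elim fun d => ⟨.llam _ _ _ _ d⟩
  | svar => exact ⟨.svar _ _⟩
  | cunit => exact ⟨.cunit _ _⟩
  | cpair _ _ ih1 ih2 => exact ih1.elim fun d => ih2.elim fun e => ⟨.cpair _ _ _ _ _ _ d e⟩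
  | cfst _ ih => exact ih.elim fun d => ⟨.cfst _ _ _ _ _ d⟩
  | csnd _ ih => exact ih.elim fun d => ⟨.csnd _ _ _ _ _ d⟩
  | clam _ ih => exact ih.elim fun d => ⟨.clam _ _ _ _ _ d⟩
  | capp _ _ ih1 ih2 => exact ih1.elim fun d => ih2.elim fun e => ⟨.capp _ _ _ _ _ _ d e⟩
  | ilet _ h ih => exact ih.elim fun d => h.elim fun e => ⟨.ilet _ _ _ _ _ d e⟩
  | banglet _ h ih => exact ih.elim fun d => h.elim fun e => ⟨.banglet _ _ _ _ _ _ d e⟩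
  | copow _ _ ih1 ih2 => exact ih1.elim fun d => ih2.elim fun e => ⟨.copow _ _ _ _ _ _ d e⟩
  | copowlet _ _ ih1 ih2 =>
    exact ih1.elim fun d => ih2.elim fun e => ⟨.copowlet _ _ _ _ _ _ _ d e⟩
  | cimage _ ih => exact ih.elim fun d => ⟨.cimage _ _ _ _ d⟩
  | cinl _ ih => exact ih.elim fun d => ⟨.cinl _ _ _ _ _ d⟩
  | cinr _ ih => exact ih.elim fun d => ⟨.cinr _ _ _ _ _ d⟩
  | ccase _ _ _ ih1 ih2 ih3 =>
    exact ih1.elim fun d => ih2.elim fun e => ih3.elim fun e' => ⟨.ccase _ _ _ _ _ _ _ _ d e e'⟩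
  | lapp _ _ ih1 ih2 => exact ih1.elim fun d => ih2.elim fun e => ⟨.lapp _ _ _ _ _ _ d e⟩

/-- The map of environments `S` denotes the substitution `σ`. -/
def DenSub (Γ Γ' : List VType) (σ : ℕ → Tm) (S : Env Γ' → Env Γ) : Prop :=
  ∀ (n : ℕ) (A : VType) (h : Γ[n]? = some A), Den Γ' none (σ n) A (fun γ => S γ n A h)

/-- The map of environments `S` denotes the renaming `ρ`. -/
def DenRen (Γ Γ' : List VType) (ρ : ℕ → ℕ) (S : Env Γ' → Env Γ) : Prop :=
  ∀ (n : ℕ) (A : VType) (h : Γ[n]? = some A), ∃ k : Γ'[ρ n]? = some A, ∀ γ, S γ n A h = γ (ρ n) A k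

/-- The extension of a map of environments along a binder. -/
def liftEnv {Γ Γ' : List VType} (A : VType) (S : Env Γ' → Env Γ) :
    Env (A :: Γ') → Env (A :: Γ) := fun γ => (S γ.tail).cons γ.head

theorem DenRen.isRen {Γ Γ' : List VType} {ρ : ℕ → ℕ} {S : Env Γ' → Env Γ}
    (h : DenRen Γ Γ' ρ S) : IsRen Γ Γ' ρ := fun n A hn => (h n A hn).1

theorem DenRen.lift {Γ Γ' : List VType} {ρ : ℕ → ℕ} {S : Env Γ' → Env Γ}
    (h : DenRen Γ Γ' ρ S) (A : VType) :
    DenRen (A :: Γ) (A :: Γ') (Tm.liftN ρ) (liftEnv A S) := by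
  intro n B hn
  cases n with
  | zero =>
    obtain rfl : A = B := by simpa using hn
    exact ⟨rfl, fun γ => rfl⟩
  | succ n =>
    obtain ⟨h', hS⟩ := h n B hn
    exact ⟨h', fun γ => hS γ.tail⟩

theorem Den.rename {Γ Γ' : List VType} {Δ : Option CType} {t : Tm} {A : VType}
    {f : Env Γ → SemT Δ A} {ρ : ℕ → ℕ} {S : Env Γ' → Env Γ} (h : Den Γ Δ t A f)
    (hS : DenRen Γ Γ' ρ S) : Den Γ' Δ (t.rename ρ) A (fun γ => f (S γ)) := by
  induction h generalizing Γ' ρ with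
  | triv h => exact .triv (h.rename hS.isRen)
  | @var Γ n A h =>
    obtain ⟨h', e⟩ := hS n A h
    simp only [e]
    exact .var h'
  | unit => exact .unit
  | vpair _ _ ih1 ih2 => exact .vpair (ih1 hS) (ih2 hS)
  | vfst _ ih => exact .vfst (ih hS)
  | vsnd _ ih => exact .vsnd (ih hS)
  | vlam _ ih => exact .vlam (ih (hS.lift _))
  | vapp _ _ ih1 ih2 => exact .vapp (ih1 hS) (ih2 hS)
  | llam _ ih => exact .llam (ih hS)
  | svar => exact .svar
  | cunit => exact .cunit
  | cpair _ _ ih1 ih2 => exact .cpair (ih1 hS) (ih2 hS)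
  | cfst _ ih => exact .cfst (ih hS)
  | csnd _ ih => exact .csnd (ih hS)
  | clam _ ih => exact .clam (ih (hS.lift _))
  | capp _ _ ih1 ih2 => exact .capp (ih1 hS) (ih2 hS)
  | ilet _ h ih => exact .ilet (ih hS) (h.rename hS.isRen)
  | banglet _ h ih => exact .banglet (ih hS) (h.rename (hS.isRen.lift _))
  | copow _ _ ih1 ih2 => exact .copow (ih1 hS) (ih2 hS)
  | copowlet _ _ ih1 ih2 => exact .copowlet (ih1 hS) (ih2 (hS.lift _))
  | cimage _ ih => exact .cimage (ih hS)
  | cinl _ ih => exact .cinl (ih hS)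
  | cinr _ ih => exact .cinr (ih hS)
  | ccase _ _ _ ih1 ih2 ih3 => exact .ccase (ih1 hS) (ih2 hS) (ih3 hS)
  | lapp _ _ ih1 ih2 => exact .lapp (ih1 hS) (ih2 hS)

theorem Den.shift {Γ : List VType} {Δ : Option CType} {t : Tm} {A : VType}
    {f : Env Γ → SemT Δ A} (h : Den Γ Δ t A f) (B : VType) :
    Den (B :: Γ) Δ t.shift A (fun γ => f γ.tail) :=
  h.rename fun _ _ hn => ⟨hn, fun _ => rfl⟩

theorem DenSub.isSub {Γ Γ' : List VType} {σ : ℕ → Tm} {S : Env Γ' → Env Γ}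
    (h : DenSub Γ Γ' σ S) : IsSub Γ Γ' σ := fun n A hn => (h n A hn).has

theorem DenSub.lift {Γ Γ' : List VType} {σ : ℕ → Tm} {S : Env Γ' → Env Γ}
    (h : DenSub Γ Γ' σ S) (A : VType) :
    DenSub (A :: Γ) (A :: Γ') (Tm.liftS σ) (liftEnv A S) := by
  intro n B hn
  cases n with
  | zero =>
    obtain rfl : A = B := by simpa using hn
    exact .var rfl
  | succ n => exact (h n B hn).shift A

theorem Den.psubst {Γ Γ' : List VType} {Δ : Option CType} {t : Tm} {A : VType}
    {f : Env Γ → SemT Δ A} {σ : ℕ → Tm} {S : Env Γ' → Env Γ} (h : Den Γ Δ t A f)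
    (hS : DenSub Γ Γ' σ S) : Den Γ' Δ (t.psubst σ) A (fun γ => f (S γ)) := by
  induction h generalizing Γ' σ with
  | triv h => exact .triv (h.psubst hS.isSub)
  | @var Γ n A h => exact hS n A h
  | unit => exact .unit
  | vpair _ _ ih1 ih2 => exact .vpair (ih1 hS) (ih2 hS)
  | vfst _ ih => exact .vfst (ih hS)
  | vsnd _ ih => exact .vsnd (ih hS)
  | vlam _ ih => exact .vlam (ih (hS.lift _))
  | vapp _ _ ih1 ih2 => exact .vapp (ih1 hS) (ih2 hS)
  | llam _ ih => exact .llam (ih hS)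
  | svar => exact .svar
  | cunit => exact .cunit
  | cpair _ _ ih1 ih2 => exact .cpair (ih1 hS) (ih2 hS)
  | cfst _ ih => exact .cfst (ih hS)
  | csnd _ ih => exact .csnd (ih hS)
  | clam _ ih => exact .clam (ih (hS.lift _))
  | capp _ _ ih1 ih2 => exact .capp (ih1 hS) (ih2 hS)
  | ilet _ h ih => exact .ilet (ih hS) (h.psubst hS.isSub)
  | banglet _ h ih => exact .banglet (ih hS) (h.psubst (hS.isSub.lift _))
  | copow _ _ ih1 ih2 => exact .copow (ih1 hS) (ih2 hS)
  | copowlet _ _ ih1 ih2 => exact .copowlet (ih1 hS) (ih2 (hS.lift _))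
  | cimage _ ih => exact .cimage (ih hS)
  | cinl _ ih => exact .cinl (ih hS)
  | cinr _ ih => exact .cinr (ih hS)
  | ccase _ _ _ ih1 ih2 ih3 => exact .ccase (ih1 hS) (ih2 hS) (ih3 hS)
  | lapp _ _ ih1 ih2 => exact .lapp (ih1 hS) (ih2 hS)

theorem Den.subst0 {Γ : List VType} {Δ : Option CType} {t u : Tm} {A B : VType}
    {f : Env (A :: Γ) → SemT Δ B} {g : Env Γ → VD A} (h : Den (A :: Γ) Δ t B f)
    (hu : Den Γ none u A g) : Den Γ Δ (Tm.subst0 u t) B (fun γ => f (γ.cons (g γ))) := by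
  rw [Tm.subst0_eq]
  refine h.psubst (S := fun γ => γ.cons (g γ)) fun n C hn => ?_
  cases n with
  | zero =>
    obtain rfl : A = C := by simpa using hn
    exact hu
  | succ n => exact Den.var (Γ := Γ) (n := n) hn

/-- Substitution for the stoup variable is composition of denotations. -/
def StoupSubst (Γ : List VType) : (Δ : Option CType) → (t : Tm) → (A : VType) →
    (Env Γ → SemT Δ A) → Prop
  | some C, t, .comp B, f => ∀ D u (g : Env Γ → CD C → CD D), Den Γ (some D) u (.comp C) g →
      Den Γ (some D) (Tm.ssubst u t) (.comp B) (fun γ (k : CD B) => g γ (f γ k))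
  | _, _, _, _ => True

theorem Den.stoupSubst {Γ : List VType} {Δ : Option CType} {t : Tm} {A : VType}
    {f : Env Γ → SemT Δ A} (h : Den Γ Δ t A f) : StoupSubst Γ Δ t A f := by
  induction h with
  | svar => exact fun D u g hu => hu
  | cunit =>
    intro D u g hu
    exact Den.cunit.congr (funext fun _ => funext fun k => Empty.elim k)
  | cpair _ _ ih1 ih2 =>
    intro D u g hu
    exact (Den.cpair (ih1 D u g hu) (ih2 D u g hu)).congr
      (funext fun γ => funext fun k => by cases k <;> rfl)
  | cfst _ ih => exact fun D u g hu => .cfst (ih D u g hu)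
  | csnd _ ih => exact fun D u g hu => .csnd (ih D u g hu)
  | clam _ ih => exact fun D u g hu => .clam (ih D _ _ (hu.shift _))
  | capp _ h2 ih1 ih2 =>
    intro D u g hu
    have := Den.capp (ih1 D u g hu) h2
    rwa [← h2.has.ssubst_eq u] at this
  | ilet _ h ih =>
    intro D u g hu
    have := Den.ilet (ih D u g hu) h
    rwa [← h.ssubst_eq u] at this
  | banglet _ h ih =>
    intro D u g hu
    have := Den.banglet (ih D u g hu) h
    rwa [← h.ssubst_eq u.shift] at this
  | copow h1 _ ih1 ih2 =>
    intro D u g hu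
    have := Den.copow h1 (ih2 D u g hu)
    rwa [← h1.has.ssubst_eq u] at this
  | copowlet _ h2 ih1 ih2 => exact fun D u g hu => .copowlet (ih1 D u g hu) h2
  | cimage _ ih => exact fun D u g hu => .cimage (ih D u g hu)
  | cinl _ ih => exact fun D u g hu => .cinl (ih D u g hu)
  | cinr _ ih => exact fun D u g hu => .cinr (ih D u g hu)
  | ccase _ h2 h3 ih1 ih2 ih3 => exact fun D u g hu => .ccase (ih1 D u g hu) h2 h3
  | lapp h1 _ ih1 ih2 =>
    intro D u g hu
    have := Den.lapp h1 (ih2 D u g hu)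
    rwa [← h1.has.ssubst_eq u] at this
  | _ => trivial

theorem Den.ssubst {Γ : List VType} {C D : CType} {t u : Tm} {B : CType}
    {f : Env Γ → CD B → CD C} {g : Env Γ → CD C → CD D} (h : Den Γ (some C) t (.comp B) f)
    (hu : Den Γ (some D) u (.comp C) g) :
    Den Γ (some D) (Tm.ssubst u t) (.comp B) (fun γ (k : CD B) => g γ (f γ k)) :=
  h.stoupSubst D u g hu

/-! ### Coherence: a term has at most one denotation

Since the raw terms do not determine the types of all their subterms, denotations at
different types have to be compared. -/

mutual
  /-- Heterogeneous equality of elements of denotations of value types, imposing nothing on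
  types of different shapes. -/
  def HV : (A A' : VType) → VD A → VD A' → Prop
    | .prod A B, .prod A' B', x, y => HV A A' x.1 y.1 ∧ HV B B' x.2 y.2
    | .arr A B, .arr A' B', x, y => ∀ a a', HV A A' a a' → HV B B' (x a) (y a')
    | .lin A B, .lin A' B', x, y => ∀ k k', HC B B' k k' → HC A A' (x k) (y k')
    | _, _, _, _ => True
  /-- Heterogeneous equality of continuations, imposing nothing on types of different
  shapes. -/
  def HC : (A A' : CType) → CD A → CD A' → Prop
    | .base (_ + 1), .base (_ + 1), x, y => x = y
    | .cand A B, .cand A' B', x, y =>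
      match x, y with
      | .inl k, .inl k' => HC A A' k k'
      | .inr k, .inr k' => HC B B' k k'
      | _, _ => False
    | .carr A B, .carr A' B', x, y => HV A A' x.1 y.1 ∧ HC B B' x.2 y.2
    | .copow A B, .copow A' B', x, y => ∀ a a', HV A A' a a' → HC B B' (x a) (y a')
    | .csum A B, .csum A' B', x, y => HC A A' x.1 y.1 ∧ HC B B' x.2 y.2
    | _, _, _, _ => True
end

theorem hV_comp (A : VType) (B : CType) (x : VD A) (y : VD (.comp B)) :
    HV A (.comp B) x y := by
  cases A <;> trivial

set_option linter.unusedVariables false in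
mutual
  theorem hV_iff : ∀ (A : VType) (x y : VD A), HV A A x y ↔ x = y
    | .base _, _, _ => ⟨fun _ => rfl, fun _ => trivial⟩
    | .unit, _, _ => ⟨fun _ => rfl, fun _ => trivial⟩
    | .comp _, _, _ => ⟨fun _ => rfl, fun _ => trivial⟩
    | .prod A B, x, y =>
      ⟨fun h => Prod.ext ((hV_iff A _ _).1 h.1) ((hV_iff B _ _).1 h.2),
        fun h => ⟨(hV_iff A _ _).2 (congrArg Prod.fst h), (hV_iff B _ _).2 (congrArg Prod.snd h)⟩⟩
    | .arr A B, x, y =>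
      ⟨fun h => funext fun a => (hV_iff B _ _).1 (h a a ((hV_iff A _ _).2 rfl)),
        fun h a a' e => (hV_iff B _ _).2 (congr h ((hV_iff A _ _).1 e))⟩
    | .lin A B, x, y =>
      ⟨fun h => funext fun k => (hC_iff A _ _).1 (h k k ((hC_iff B _ _).2 rfl)),
        fun h k k' e => (hC_iff A _ _).2 (congr h ((hC_iff B _ _).1 e))⟩
  theorem hC_iff : ∀ (A : CType) (x y : CD A), HC A A x y ↔ x = y
    | .base 0, _, _ => ⟨fun _ => rfl, fun _ => trivial⟩
    | .base (_ + 1), _, _ => Iff.rfl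
    | .cunit, x, _ => Empty.elim x
    | .iunit, _, _ => ⟨fun _ => rfl, fun _ => trivial⟩
    | .bang _, _, _ => ⟨fun _ => rfl, fun _ => trivial⟩
    | .czero, _, _ => ⟨fun _ => rfl, fun _ => trivial⟩
    | .cand A _, .inl x, .inl y =>
      ⟨fun h => congrArg Sum.inl ((hC_iff A x y).1 h),
        fun h => (hC_iff A x y).2 (Sum.inl.inj h)⟩
    | .cand _ B, .inr x, .inr y =>
      ⟨fun h => congrArg Sum.inr ((hC_iff B x y).1 h),
        fun h => (hC_iff B x y).2 (Sum.inr.inj h)⟩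
    | .cand _ _, .inl _, .inr _ => ⟨False.elim, fun h => nomatch h⟩
    | .cand _ _, .inr _, .inl _ => ⟨False.elim, fun h => nomatch h⟩
    | .carr A B, x, y =>
      ⟨fun h => Prod.ext ((hV_iff A _ _).1 h.1) ((hC_iff B _ _).1 h.2),
        fun h => ⟨(hV_iff A _ _).2 (congrArg Prod.fst h), (hC_iff B _ _).2 (congrArg Prod.snd h)⟩⟩
    | .copow A B, x, y =>
      ⟨fun h => funext fun a => (hC_iff B _ _).1 (h a a ((hV_iff A _ _).2 rfl)),
        fun h a a' e => (hC_iff B _ _).2 (congr h ((hV_iff A _ _).1 e))⟩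
    | .csum A B, x, y =>
      ⟨fun h => Prod.ext ((hC_iff A _ _).1 h.1) ((hC_iff B _ _).1 h.2),
        fun h => ⟨(hC_iff A _ _).2 (congrArg Prod.fst h), (hC_iff B _ _).2 (congrArg Prod.snd h)⟩⟩
end

/-- Heterogeneous equality of denotations of judgements. -/
def HSem : (Δ : Option CType) → (A : VType) → SemT Δ A → (Δ' : Option CType) → (A' : VType) →
    SemT Δ' A' → Prop
  | none, A, x, none, A', y => HV A A' x y
  | some C, .comp B, x, some C', .comp B', y => ∀ k k', HC B B' k k' → HC C C' (x k) (y k')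
  | _, _, _, _, _, _ => True

/-- Heterogeneous equality of environments. -/
def HEnv (Γ Γ' : List VType) (γ : Env Γ) (γ' : Env Γ') : Prop :=
  ∀ (n : ℕ) (A A' : VType) (h : Γ[n]? = some A) (h' : Γ'[n]? = some A'),
    HV A A' (γ n A h) (γ' n A' h')

theorem HEnv.cons {Γ Γ' : List VType} {γ : Env Γ} {γ' : Env Γ'} (e : HEnv Γ Γ' γ γ')
    {A A' : VType} {x : VD A} {x' : VD A'} (hx : HV A A' x x') :
    HEnv (A :: Γ) (A' :: Γ') (γ.cons x) (γ'.cons x') := by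
  intro n B B' h h'
  cases n with
  | zero =>
    obtain rfl : A = B := by simpa using h
    obtain rfl : A' = B' := by simpa using h'
    exact hx
  | succ n => exact e n B B' h h'

theorem Den.hSem {Γ Γ' : List VType} {Δ Δ' : Option CType} {t : Tm} {A A' : VType}
    {f : Env Γ → SemT Δ A} {f' : Env Γ' → SemT Δ' A'} (h : Den Γ Δ t A f)
    (h' : Den Γ' Δ' t A' f') {γ : Env Γ} {γ' : Env Γ'} (e : HEnv Γ Γ' γ γ') :
    HSem Δ A (f γ) Δ' A' (f' γ') := by
  induction h generalizing Γ' Δ' A' with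
  | triv =>
    cases Δ' with
    | none => cases A' <;> trivial
    | some => trivial
  | var hn => cases h' with
    | triv => exact hV_comp _ _ _ _
    | var hn' => exact e _ _ _ hn hn'
  | unit => cases h' <;> trivial
  | vpair _ _ ih1 ih2 => cases h' with
    | triv => trivial
    | vpair h1 h2 => exact ⟨ih1 h1 e, ih2 h2 e⟩
  | vfst _ ih => cases h' with
    | triv => exact hV_comp _ _ _ _
    | vfst h => exact (ih h e).1
  | vsnd _ ih => cases h' with
    | triv => exact hV_comp _ _ _ _
    | vsnd h => exact (ih h e).2
  | vlam _ ih => cases h' with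
    | triv => trivial
    | vlam h => exact fun a a' ha => ih h (e.cons ha)
  | vapp _ _ ih1 ih2 => cases h' with
    | triv => exact hV_comp _ _ _ _
    | vapp h1 h2 => exact ih1 h1 e _ _ (ih2 h2 e)
  | llam _ ih => cases h' with
    | triv => trivial
    | llam h => exact ih h e
  | svar => cases h' with
    | triv => trivial
    | svar => exact fun k k' hk => hk
  | cunit => cases h' with
    | triv => trivial
    | cunit => exact fun k => Empty.elim k
  | cpair _ _ ih1 ih2 => cases h' with
    | triv => trivial
    | cpair h1 h2 =>
      rintro (k | k) (k' | k') hk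
      · exact ih1 h1 e k k' hk
      · exact False.elim hk
      · exact False.elim hk
      · exact ih2 h2 e k k' hk
  | cfst _ ih => cases h' with
    | triv => trivial
    | cfst h => exact fun k k' hk => ih h e (.inl k) (.inl k') hk
  | csnd _ ih => cases h' with
    | triv => trivial
    | csnd h => exact fun k k' hk => ih h e (.inr k) (.inr k') hk
  | clam _ ih => cases h' with
    | triv => trivial
    | clam h => exact fun k k' hk => ih h (e.cons hk.1) k.2 k'.2 hk.2
  | capp _ _ ih1 ih2 => cases h' with
    | triv => trivial
    | capp h1 h2 => exact fun k k' hk => ih1 h1 e (_, k) (_, k') ⟨ih2 h2 e, hk⟩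
  | ilet _ _ ih => cases h' with
    | triv => trivial
    | ilet h => exact fun k k' hk => ih h e () () trivial
  | banglet _ _ ih => cases h' with
    | triv => trivial
    | banglet h => exact fun k k' hk => ih h e () () trivial
  | copow _ _ ih1 ih2 => cases h' with
    | triv => trivial
    | copow h1 h2 => exact fun k k' hk => ih2 h2 e _ _ (hk _ _ (ih1 h1 e))
  | copowlet _ _ ih1 ih2 => cases h' with
    | triv => trivial
    | copowlet h1 h2 =>
      exact fun k k' hk => ih1 h1 e _ _ fun a a' ha => ih2 h2 (e.cons ha) k k' hk
  | cimage _ ih => cases h' with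
    | triv => trivial
    | cimage h => exact fun k k' hk => ih h e () () trivial
  | cinl _ ih => cases h' with
    | triv => trivial
    | cinl h => exact fun k k' hk => ih h e _ _ hk.1
  | cinr _ ih => cases h' with
    | triv => trivial
    | cinr h => exact fun k k' hk => ih h e _ _ hk.2
  | ccase _ _ _ ih1 ih2 ih3 => cases h' with
    | triv => trivial
    | ccase h1 h2 h3 =>
      exact fun k k' hk => ih1 h1 e _ _ ⟨ih2 h2 e k k' hk, ih3 h3 e k k' hk⟩
  | lapp _ _ ih1 ih2 => cases h' with
    | triv => trivial
    | lapp h1 h2 => exact fun k k' hk => ih2 h2 e _ _ (ih1 h1 e k k' hk)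

theorem Den.unique {Γ : List VType} {Δ : Option CType} {t : Tm} {A : VType}
    {f g : Env Γ → SemT Δ A} (hf : Den Γ Δ t A f) (hg : Den Γ Δ t A g) : f = g := by
  funext γ
  have h := hf.hSem hg (γ := γ) (γ' := γ) fun n A A' h h' => by
    obtain rfl : A = A' := Option.some.inj (h.symm.trans h')
    exact (hV_iff A _ _).2 rfl
  match Δ, A with
  | none, A => exact (hV_iff A _ _).1 h
  | some C, .comp B =>
    exact funext fun k => (hC_iff C _ _).1 (h k k ((hC_iff B _ _).2 rfl))
  | some _, .base _ | some _, .unit | some _, .prod _ _ | some _, .arr _ _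
  | some _, .lin _ _ => rfl

theorem EEq.triv {Γ : List VType} {t u : Tm} {A : CType} (h : EEq Γ none t u (.comp A)) :
    ∃ f, Den Γ none t (.comp A) f ∧ Den Γ none u (.comp A) f :=
  ⟨_, .triv h.has.1, .triv h.has.2⟩

/-- Soundness of the model: equal terms have a common denotation. -/
theorem EEq.den {Γ : List VType} {Δ : Option CType} {t u : Tm} {A : VType}
    (h : EEq Γ Δ t u A) : ∃ f, Den Γ Δ t A f ∧ Den Γ Δ u A f := by
  have key := h
  induction h with
  | refl d => exact (exists_den d).elim fun f hf => ⟨f, hf, hf⟩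
  | symm h ih => exact (ih h).elim fun f hf => ⟨f, hf.2, hf.1⟩
  | trans h1 h2 ih1 ih2 =>
    obtain ⟨f, hf, hf'⟩ := ih1 h1
    obtain ⟨g, hg, hg'⟩ := ih2 h2
    exact ⟨g, hf'.unique hg ▸ hf, hg'⟩
  | vpair_cong h1 h2 ih1 ih2 =>
    obtain ⟨f, hf, hf'⟩ := ih1 h1
    obtain ⟨g, hg, hg'⟩ := ih2 h2
    exact ⟨_, .vpair hf hg, .vpair hf' hg'⟩
  | vfst_cong h ih => exact (ih h).elim fun f hf => ⟨_, .vfst hf.1, .vfst hf.2⟩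
  | vsnd_cong h ih => exact (ih h).elim fun f hf => ⟨_, .vsnd hf.1, .vsnd hf.2⟩
  | vlam_cong h ih => exact (ih h).elim fun f hf => ⟨_, .vlam hf.1, .vlam hf.2⟩
  | vapp_cong h1 h2 ih1 ih2 =>
    obtain ⟨f, hf, hf'⟩ := ih1 h1
    obtain ⟨g, hg, hg'⟩ := ih2 h2
    exact ⟨_, .vapp hf hg, .vapp hf' hg'⟩
  | @cpair_cong Γ Δ _ _ _ _ _ _ h1 h2 ih1 ih2 =>
    cases Δ with
    | none => exact key.triv
    | some C =>
      obtain ⟨f, hf, hf'⟩ := ih1 h1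
      obtain ⟨g, hg, hg'⟩ := ih2 h2
      exact ⟨_, .cpair hf hg, .cpair hf' hg'⟩
  | @cfst_cong Γ Δ _ _ _ _ h ih =>
    cases Δ with
    | none => exact key.triv
    | some C => exact (ih h).elim fun f hf => ⟨_, .cfst hf.1, .cfst hf.2⟩
  | @csnd_cong Γ Δ _ _ _ _ h ih =>
    cases Δ with
    | none => exact key.triv
    | some C => exact (ih h).elim fun f hf => ⟨_, .csnd hf.1, .csnd hf.2⟩
  | @clam_cong Γ Δ _ _ _ _ h ih =>
    cases Δ with
    | none => exact key.triv
    | some C => exact (ih h).elim fun f hf => ⟨_, .clam hf.1, .clam hf.2⟩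
  | @capp_cong Γ Δ _ _ _ _ _ _ h1 h2 ih1 ih2 =>
    cases Δ with
    | none => exact key.triv
    | some C =>
      obtain ⟨f, hf, hf'⟩ := ih1 h1
      obtain ⟨g, hg, hg'⟩ := ih2 h2
      exact ⟨_, .capp hf hg, .capp hf' hg'⟩
  | @ilet_cong Γ Δ _ _ _ _ _ h1 h2 ih1 ih2 =>
    cases Δ with
    | none => exact key.triv
    | some C =>
      exact (ih1 h1).elim fun f hf => ⟨_, .ilet hf.1 h2.has.1, .ilet hf.2 h2.has.2⟩
  | bang_cong => exact key.triv
  | @banglet_cong Γ Δ _ _ _ _ _ _ h1 h2 ih1 ih2 =>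
    cases Δ with
    | none => exact key.triv
    | some C =>
      exact (ih1 h1).elim fun f hf => ⟨_, .banglet hf.1 h2.has.1, .banglet hf.2 h2.has.2⟩
  | @copow_cong Γ Δ _ _ _ _ _ _ h1 h2 ih1 ih2 =>
    cases Δ with
    | none => exact key.triv
    | some C =>
      obtain ⟨f, hf, hf'⟩ := ih1 h1
      obtain ⟨g, hg, hg'⟩ := ih2 h2
      exact ⟨_, .copow hf hg, .copow hf' hg'⟩
  | @copowlet_cong Γ Δ _ _ _ _ _ _ _ h1 h2 ih1 ih2 =>
    cases Δ with
    | none => exact key.triv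
    | some C =>
      obtain ⟨f, hf, hf'⟩ := ih1 h1
      obtain ⟨g, hg, hg'⟩ := ih2 h2
      exact ⟨_, .copowlet hf hg, .copowlet hf' hg'⟩
  | @cimage_cong Γ Δ _ _ _ h ih =>
    cases Δ with
    | none => exact key.triv
    | some C => exact (ih h).elim fun f hf => ⟨_, .cimage hf.1, .cimage hf.2⟩
  | @cinl_cong Γ Δ _ _ _ _ h ih =>
    cases Δ with
    | none => exact key.triv
    | some C => exact (ih h).elim fun f hf => ⟨_, .cinl hf.1, .cinl hf.2⟩
  | @cinr_cong Γ Δ _ _ _ _ h ih =>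
    cases Δ with
    | none => exact key.triv
    | some C => exact (ih h).elim fun f hf => ⟨_, .cinr hf.1, .cinr hf.2⟩
  | @ccase_cong Γ Δ _ _ _ _ _ _ _ _ _ h1 h2 h3 ih1 ih2 ih3 =>
    cases Δ with
    | none => exact key.triv
    | some C =>
      obtain ⟨f, hf, hf'⟩ := ih1 h1
      obtain ⟨g, hg, hg'⟩ := ih2 h2
      obtain ⟨k, hk, hk'⟩ := ih3 h3
      exact ⟨_, .ccase hf hg hk, .ccase hf' hg' hk'⟩
  | llam_cong h ih => exact (ih h).elim fun f hf => ⟨_, .llam hf.1, .llam hf.2⟩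
  | @lapp_cong Γ Δ _ _ _ _ _ _ h1 h2 ih1 ih2 =>
    cases Δ with
    | none => exact key.triv
    | some C =>
      obtain ⟨f, hf, hf'⟩ := ih1 h1
      obtain ⟨g, hg, hg'⟩ := ih2 h2
      exact ⟨_, .lapp hf hg, .lapp hf' hg'⟩
  | unit_eta d => exact (exists_den d).elim fun f hf => ⟨_, hf, .unit⟩
  | vfst_beta d1 d2 =>
    obtain ⟨f, hf⟩ := exists_den d1
    obtain ⟨g, hg⟩ := exists_den d2
    exact ⟨f, .vfst (.vpair hf hg), hf⟩
  | vsnd_beta d1 d2 =>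
    obtain ⟨f, hf⟩ := exists_den d1
    obtain ⟨g, hg⟩ := exists_den d2
    exact ⟨g, .vsnd (.vpair hf hg), hg⟩
  | vpair_eta d => exact (exists_den d).elim fun f hf => ⟨f, .vpair (.vfst hf) (.vsnd hf), hf⟩
  | vlam_beta d1 d2 =>
    obtain ⟨f, hf⟩ := exists_den d1
    obtain ⟨g, hg⟩ := exists_den d2
    exact ⟨_, .vapp (.vlam hf) hg, hf.subst0 hg⟩
  | vlam_eta d =>
    obtain ⟨f, hf⟩ := exists_den d
    exact ⟨f, .vlam (.vapp (hf.shift _) (.var rfl)), hf⟩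
  | @cunit_eta Γ Δ t d =>
    cases Δ with
    | none => exact key.triv
    | some C =>
      obtain ⟨f, hf⟩ := exists_den d
      exact ⟨f, hf, Den.cunit.congr (funext fun _ => funext fun k => Empty.elim k)⟩
  | @cfst_beta Γ Δ _ _ _ _ d1 d2 =>
    cases Δ with
    | none => exact key.triv
    | some C =>
      obtain ⟨f, hf⟩ := exists_den d1
      obtain ⟨g, hg⟩ := exists_den d2
      exact ⟨f, .cfst (.cpair hf hg), hf⟩
  | @csnd_beta Γ Δ _ _ _ _ d1 d2 =>
    cases Δ with
    | none => exact key.triv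
    | some C =>
      obtain ⟨f, hf⟩ := exists_den d1
      obtain ⟨g, hg⟩ := exists_den d2
      exact ⟨g, .csnd (.cpair hf hg), hg⟩
  | @cpair_eta Γ Δ _ _ _ d =>
    cases Δ with
    | none => exact key.triv
    | some C =>
      obtain ⟨f, hf⟩ := exists_den d
      exact ⟨f, (Den.cpair (.cfst hf) (.csnd hf)).congr
        (funext fun γ => funext fun k => by cases k <;> rfl), hf⟩
  | @clam_beta Γ Δ _ _ _ _ d1 d2 =>
    cases Δ with
    | none => exact key.triv
    | some C =>
      obtain ⟨f, hf⟩ := exists_den d1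
      obtain ⟨g, hg⟩ := exists_den d2
      exact ⟨_, .capp (.clam hf) hg, hf.subst0 hg⟩
  | @clam_eta Γ Δ _ _ _ d =>
    cases Δ with
    | none => exact key.triv
    | some C =>
      obtain ⟨f, hf⟩ := exists_den d
      exact ⟨f, .clam (.capp (hf.shift _) (.var rfl)), hf⟩
  | ilet_beta => exact key.triv
  | @ilet_eta Γ Δ _ _ _ d1 d2 =>
    cases Δ with
    | none => exact key.triv
    | some C =>
      obtain ⟨f, hf⟩ := exists_den d1
      obtain ⟨g, hg⟩ := exists_den d2
      exact ⟨_, .ilet hf (Has.ssubst ⟨d2⟩ ⟨.top _⟩), hg.ssubst hf⟩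
  | bang_beta => exact key.triv
  | @bang_eta Γ Δ _ _ _ _ d1 d2 =>
    cases Δ with
    | none => exact key.triv
    | some C =>
      obtain ⟨f, hf⟩ := exists_den d1
      obtain ⟨g, hg⟩ := exists_den d2
      exact ⟨_, .banglet hf (Has.ssubst (hg.shift _).has ⟨.bang _ _ _ (.var _ _ _ rfl)⟩),
        hg.ssubst hf⟩
  | @copow_beta Γ Δ _ _ _ _ _ _ d1 d2 d3 =>
    cases Δ with
    | none => exact key.triv
    | some C =>
      obtain ⟨f, hf⟩ := exists_den d1
      obtain ⟨g, hg⟩ := exists_den d2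
      obtain ⟨k, hk⟩ := exists_den d3
      exact ⟨_, .copowlet (.copow hf hg) hk, (hk.subst0 hf).ssubst hg⟩
  | @copow_eta Γ Δ _ _ _ _ _ d1 d2 =>
    cases Δ with
    | none => exact key.triv
    | some C =>
      obtain ⟨f, hf⟩ := exists_den d1
      obtain ⟨g, hg⟩ := exists_den d2
      exact ⟨_, .copowlet hf ((hg.shift _).ssubst (.copow (.var rfl) .svar)), hg.ssubst hf⟩
  | @czero_eta Γ Δ _ _ _ d1 d2 =>
    cases Δ with
    | none => exact key.triv
    | some C =>
      obtain ⟨f, hf⟩ := exists_den d1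
      obtain ⟨g, hg⟩ := exists_den d2
      exact ⟨_, .cimage hf, hg.ssubst hf⟩
  | @csum_beta_inl Γ Δ _ _ _ _ _ _ d1 d2 d3 =>
    cases Δ with
    | none => exact key.triv
    | some C =>
      obtain ⟨f, hf⟩ := exists_den d1
      obtain ⟨g, hg⟩ := exists_den d2
      obtain ⟨k, hk⟩ := exists_den d3
      exact ⟨_, .ccase (.cinl hk) hf hg, hf.ssubst hk⟩
  | @csum_beta_inr Γ Δ _ _ _ _ _ _ d1 d2 d3 =>
    cases Δ with
    | none => exact key.triv
    | some C =>
      obtain ⟨f, hf⟩ := exists_den d1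
      obtain ⟨g, hg⟩ := exists_den d2
      obtain ⟨k, hk⟩ := exists_den d3
      exact ⟨_, .ccase (.cinr hk) hf hg, hg.ssubst hk⟩
  | @csum_eta Γ Δ _ _ _ _ _ d1 d2 =>
    cases Δ with
    | none => exact key.triv
    | some C =>
      obtain ⟨f, hf⟩ := exists_den d1
      obtain ⟨g, hg⟩ := exists_den d2
      exact ⟨_, .ccase hf (hg.ssubst (.cinl .svar)) (hg.ssubst (.cinr .svar)), hg.ssubst hf⟩
  | @llam_beta Γ Δ _ _ _ _ d1 d2 =>
    cases Δ with
    | none => exact key.triv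
    | some C =>
      obtain ⟨f, hf⟩ := exists_den d1
      obtain ⟨g, hg⟩ := exists_den d2
      exact ⟨_, .lapp (.llam hf) hg, hf.ssubst hg⟩
  | @llam_eta Γ t A B d =>
    obtain ⟨f, hf⟩ := exists_den d
    exact ⟨f, .llam (.lapp (g := fun _ (k : CD A) => k) hf .svar), hf⟩

/-! ### Normalisation by evaluation in the model

Continuations of `cbncpsT R σ` are read back as simply-typed terms. Such a term depends on the
number of free variables, newer variables having larger indices. -/

mutual
  /-- Reading back a continuation as a term. -/
  def down {R : CType} (r : CD R) : (σ : STy) → CD (cbncpsT R σ) → ℕ → LTm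
    | .base _, x, n => x n
    | .unit, _, _ => .unit
    | .prod σ τ, x, n => .pair (down r σ x.1 n) (down r τ x.2 n)
    | .arr σ τ, x, n =>
      .lam σ ((down r τ (x fun _ => up r σ fun _ => .var n) (n + 1)).rename (closeRen n))
  /-- Turning a term into a continuation. -/
  def up {R : CType} (r : CD R) : (σ : STy) → (ℕ → LTm) → CD (cbncpsT R σ)
    | .base _, u => u
    | .unit, _ => ()
    | .prod σ τ, u => (up r σ fun n => .fst (u n), up r τ fun n => .snd (u n))
    | .arr σ τ, u => fun g => up r τ fun n => .app (u n) (down r σ (g r) n)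
end

/-- The continuation `x` realizes the term `M` of type `σ`. -/
def Realizes {R : CType} (r : CD R) :
    (σ : STy) → List STy → LTm → CD (cbncpsT R σ) → Prop
  | .base a, Θ, M, x => ∀ Θ', Θ <+: Θ' → LBetaEta Θ' M (x Θ'.length) (.base a)
  | .unit, Θ, M, _ => LHas Θ M .unit
  | .prod σ τ, Θ, M, x =>
    LHas Θ M (.prod σ τ) ∧ Realizes r σ Θ (.fst M) x.1 ∧ Realizes r τ Θ (.snd M) x.2
  | .arr σ τ, Θ, M, x =>
    LHas Θ M (.arr σ τ) ∧ ∀ Θ' N (g : CD R → CD (cbncpsT R σ)), Θ <+: Θ' →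
      Realizes r σ Θ' N (g r) → Realizes r τ Θ' (.app M N) (x g)

section
variable {R : CType} {r : CD R}

theorem Realizes.has {σ : STy} {Θ : List STy} {M : LTm} {x : CD (cbncpsT R σ)}
    (h : Realizes r σ Θ M x) : LHas Θ M σ := by
  cases σ with
  | base _ => exact (h Θ (List.prefix_refl _)).has.1
  | unit => exact h
  | prod _ _ => exact h.1
  | arr _ _ => exact h.1

theorem Realizes.mono {σ : STy} {Θ Θ' : List STy} {M : LTm} {x : CD (cbncpsT R σ)}
    (h : Realizes r σ Θ M x) (hp : Θ <+: Θ') : Realizes r σ Θ' M x := by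
  induction σ generalizing M with
  | base a => exact fun Ξ hq => h Ξ (hp.trans hq)
  | unit => exact LHas.mono h hp
  | prod σ τ ih1 ih2 => exact ⟨h.1.mono hp, ih1 h.2.1, ih2 h.2.2⟩
  | arr σ τ _ _ => exact ⟨h.1.mono hp, fun Ξ N g hq hN => h.2 Ξ N g (hp.trans hq) hN⟩

theorem Realizes.of_betaEta {σ : STy} {Θ : List STy} {M M' : LTm} {x : CD (cbncpsT R σ)}
    (h : Realizes r σ Θ M x) (e : LBetaEta Θ M' M σ) : Realizes r σ Θ M' x := by
  induction σ generalizing Θ M M' with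
  | base a => exact fun Ξ hq => (e.mono hq).trans (h Ξ hq)
  | unit => exact e.has.1
  | prod σ τ ih1 ih2 => exact ⟨e.has.1, ih1 h.2.1 e.fst_cong, ih2 h.2.2 e.snd_cong⟩
  | arr σ τ _ ih2 =>
    refine ⟨e.has.1, fun Ξ N g hq hN => ih2 (h.2 Ξ N g hq hN) ?_⟩
    obtain ⟨dN⟩ := hN.has
    exact (e.mono hq).app_cong (.refl dN)

/-- Realizers can be read back, and terms have realizers. -/
theorem reify_and_reflect (r : CD R) (σ : STy) :
    (∀ (Θ : List STy) (M : LTm) (x : CD (cbncpsT R σ)), Realizes r σ Θ M x →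
      LBetaEta Θ M (down r σ x Θ.length) σ) ∧
    (∀ (Θ : List STy) (M : LTm) (u : ℕ → LTm),
      (∀ Θ', Θ <+: Θ' → LBetaEta Θ' M (u Θ'.length) σ) → Realizes r σ Θ M (up r σ u)) := by
  induction σ with
  | base a => exact ⟨fun Θ M x h => h Θ (List.prefix_refl _), fun Θ M u h => h⟩
  | unit =>
    exact ⟨fun Θ M x h => h.elim .unit_eta, fun Θ M u h => (h Θ (List.prefix_refl _)).has.1⟩
  | prod σ τ ih1 ih2 =>
    refine ⟨fun Θ M x h => ?_, fun Θ M u h => ?_⟩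
    · obtain ⟨d⟩ := h.1
      exact (LBetaEta.pair_eta d).symm.trans
        ((ih1.1 _ _ _ h.2.1).pair_cong (ih2.1 _ _ _ h.2.2))
    · exact ⟨(h Θ (List.prefix_refl _)).has.1,
        ih1.2 _ _ _ fun Ξ hq => (h Ξ hq).fst_cong, ih2.2 _ _ _ fun Ξ hq => (h Ξ hq).snd_cong⟩
  | arr σ τ ih1 ih2 =>
    refine ⟨fun Θ M x h => ?_, fun Θ M u h => ?_⟩
    · have hp : Θ <+: Θ ++ [σ] := List.prefix_append _ _
      have hv : Realizes r σ (Θ ++ [σ]) (.var Θ.length) (up r σ fun _ => .var Θ.length) := by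
        refine ih1.2 _ _ _ fun Ξ hq => .mono (.refl (.var _ _ _ ?_)) hq
        simp
      have e := (ih2.1 _ _ _ (h.2 _ _ (fun _ => up r σ fun _ => .var Θ.length) hp hv)).rename
        (isRen_closeRen Θ σ)
      have hM : M.rename (closeRen Θ.length) = M.shift :=
        h.1.rename_congr fun n hn => if_neg (Nat.ne_of_lt hn)
      have h0 : closeRen Θ.length Θ.length = 0 := if_pos rfl
      simp only [LTm.rename, hM, h0, List.length_append, List.length_singleton] at e
      obtain ⟨d⟩ := h.1
      exact (LBetaEta.eta d).symm.trans e.lam_cong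
    · exact ⟨(h Θ (List.prefix_refl _)).has.1, fun Ξ N g hq hN =>
        ih2.2 _ _ _ fun Ξ' hq' =>
          (h Ξ' (hq.trans hq')).app_cong (ih1.1 _ _ _ (hN.mono hq'))⟩

theorem exists_den_realizes (r : CD R) {Θ₀ : List STy} {M : LTm} {σ : STy}
    (d : LDeriv Θ₀ M σ) :
    ∃ f : Env (cbncpsCtx R Θ₀) → CD R → CD (cbncpsT R σ),
      Den (cbncpsCtx R Θ₀) none (cbncps R d) (.lin (cbncpsT R σ) R) f ∧
      ∀ (Θ : List STy) (γ : ℕ → LTm) (ρ : Env (cbncpsCtx R Θ₀)),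
        (∀ n τ h, Θ₀[n]? = some τ →
          Realizes r τ Θ (γ n) ((ρ n (.lin (cbncpsT R τ) R) h : CD R → _) r)) →
        Realizes r σ Θ (M.psubst γ) (f ρ r) := by
  induction d with
  | var Θ₀ n σ h =>
    have h' : (cbncpsCtx R Θ₀)[n]? = some (.lin (cbncpsT R σ) R) := by simp [cbncpsCtx, h]
    exact ⟨_, .var h', fun Θ γ ρ hγ => hγ n σ h' h⟩
  | unit Θ₀ => exact ⟨_, .llam (.cimage .svar), fun Θ γ ρ hγ => ⟨.unit _⟩⟩
  | pair Θ₀ M N σ τ dM dN ih1 ih2 =>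
    obtain ⟨f, hf, hf'⟩ := ih1
    obtain ⟨g, hg, hg'⟩ := ih2
    refine ⟨_, .llam (.ccase .svar (.lapp hf .svar) (.lapp hg .svar)), fun Θ γ ρ hγ => ?_⟩
    have h1 := hf' Θ γ ρ hγ
    have h2 := hg' Θ γ ρ hγ
    obtain ⟨d1⟩ := h1.has
    obtain ⟨d2⟩ := h2.has
    exact ⟨⟨.pair _ _ _ _ _ d1 d2⟩, h1.of_betaEta (.fst_beta d1 d2),
      h2.of_betaEta (.snd_beta d1 d2)⟩
  | fst Θ₀ M σ τ dM ih =>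
    obtain ⟨f, hf, hf'⟩ := ih
    exact ⟨_, .llam (.lapp hf (.cinl .svar)), fun Θ γ ρ hγ => (hf' Θ γ ρ hγ).2.1⟩
  | snd Θ₀ M σ τ dM ih =>
    obtain ⟨f, hf, hf'⟩ := ih
    exact ⟨_, .llam (.lapp hf (.cinr .svar)), fun Θ γ ρ hγ => (hf' Θ γ ρ hγ).2.2⟩
  | lam Θ₀ M σ τ dM ih =>
    obtain ⟨f, hf, hf'⟩ := ih
    refine ⟨_, .llam (.copowlet .svar (.lapp hf .svar)), fun Θ γ ρ hγ => ?_⟩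
    have hM : LHas (σ :: Θ) (M.psubst (LTm.liftS γ)) τ := by
      refine LHas.psubst ⟨dM⟩ fun n υ hn => ?_
      cases n with
      | zero => exact ⟨.var _ _ _ hn⟩
      | succ n =>
        have h' : (cbncpsCtx R Θ₀)[n]? = some (.lin (cbncpsT R υ) R) := by
          simpa [cbncpsCtx] using ⟨υ, hn, rfl⟩
        exact (hγ n υ h' hn).has.rename (IsRen.succ _ _)
    refine ⟨hM.elim fun e => ⟨.lam _ _ _ _ e⟩, fun Θ' N g hp hN => ?_⟩
    have key := hf' Θ' (LTm.scons N γ) (ρ.cons (A := .lin (cbncpsT R σ) R) g) ?_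
    · obtain ⟨e⟩ := hM.mono (List.cons_prefix_cons.2 ⟨rfl, hp⟩)
      obtain ⟨dN⟩ := hN.has
      rw [← LTm.subst0_psubst_liftS] at key
      exact key.of_betaEta (.beta e dN)
    · intro n υ h hn
      cases n with
      | zero =>
        obtain rfl : σ = υ := by simpa using hn
        exact hN
      | succ n => exact (hγ n υ h hn).mono hp
  | app Θ₀ M N σ τ dM dN ih1 ih2 =>
    obtain ⟨f, hf, hf'⟩ := ih1
    obtain ⟨g, hg, hg'⟩ := ih2
    exact ⟨_, .llam (.lapp hf (.copow hg .svar)), fun Θ γ ρ hγ =>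
      (hf' Θ γ ρ hγ).2 Θ _ (g ρ) (List.prefix_refl _) (hg' Θ γ ρ hγ)⟩

theorem exists_env_realizes (r : CD R) (Θ : List STy) :
    ∃ ρ : Env (cbncpsCtx R Θ), ∀ n τ h, Θ[n]? = some τ →
      Realizes r τ Θ (.var n) ((ρ n (.lin (cbncpsT R τ) R) h : CD R → _) r) := by
  have key : ∀ (n : ℕ) (A : VType) (h : (cbncpsCtx R Θ)[n]? = some A),
      ∃ x : VD A, ∀ τ (e : A = .lin (cbncpsT R τ) R), Θ[n]? = some τ →
        Realizes r τ Θ (.var n) ((e ▸ x : VD (.lin (cbncpsT R τ) R)) r) := by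
    intro n A h
    obtain ⟨σ, hσ, rfl⟩ : ∃ σ, Θ[n]? = some σ ∧ VType.lin (cbncpsT R σ) R = A := by
      simpa [cbncpsCtx] using h
    refine ⟨(fun _ => up r σ fun _ => .var n : CD R → CD (cbncpsT R σ)), fun τ e hτ => ?_⟩
    obtain rfl : σ = τ := Option.some.inj (hσ.symm.trans hτ)
    exact (reify_and_reflect r σ).2 _ _ _ fun Ξ hq => .mono (.refl (.var _ _ _ hσ)) hq
  choose ρ hρ using key
  exact ⟨ρ, fun n τ h hn => hρ n _ h τ rfl hn⟩

/-- The call-by-name linear-use CPS translation reflects equality as soon as the result type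
has a continuation. -/
theorem cbncps_faithful (r : CD R) {Θ : List STy} {M N : LTm} {τ : STy} (dM : LDeriv Θ M τ)
    (dN : LDeriv Θ N τ)
    (h : EEq (cbncpsCtx R Θ) none (cbncps R dM) (cbncps R dN) (.lin (cbncpsT R τ) R)) :
    LBetaEta Θ M N τ := by
  obtain ⟨f, hf, hf'⟩ := exists_den_realizes r dM
  obtain ⟨g, hg, hg'⟩ := exists_den_realizes r dN
  obtain ⟨k, hk, hk'⟩ := h.den
  obtain rfl := hf.unique hk
  obtain rfl := hg.unique hk'
  obtain ⟨ρ, hρ⟩ := exists_env_realizes r Θ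
  have h1 := (reify_and_reflect r τ).1 _ _ _ (hf' Θ .var ρ hρ)
  have h2 := (reify_and_reflect r τ).1 _ _ _ (hg' Θ .var ρ hρ)
  rw [LTm.psubst_var] at h1 h2
  exact h1.trans h2.symm

end

end EEC

namespace EEC

/-- **Full completeness of the call-by-name linear-use CPS translation**
(Theorem 4.4): suppose `R̲` is either (i) a computation-type constant
different from `α̲` for every simply-typed λ-calculus type constant `α`, or
(ii) the type `I̲`.  Then (1) the translation is complete for `=_{βη}`, and
(2) every `Θⁿᶜ ⊸ R̲ ⊢ t : τⁿᶜ ⊸ R̲` is equal to the translation of some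
simply-typed term `Θ ⊢ M : τ`. -/
theorem cbncps_fully_complete (R : CType)
    (hR : (∃ b : ℕ, R = CType.base b ∧ ∀ a : ℕ, R ≠ assocC a) ∨ R = CType.iunit) :
    (∀ (Θ : List STy) (M N : LTm) (τ : STy) (dM : LDeriv Θ M τ) (dN : LDeriv Θ N τ),
      EEq (cbncpsCtx R Θ) none (cbncps R dM) (cbncps R dN) (.lin (cbncpsT R τ) R) →
      LBetaEta Θ M N τ) ∧
    (∀ (Θ : List STy) (τ : STy) (t : Tm),
      Nonempty (Deriv (cbncpsCtx R Θ) none t (.lin (cbncpsT R τ) R)) →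
      ∃ (M : LTm) (dM : LDeriv Θ M τ),
        EEq (cbncpsCtx R Θ) none (cbncps R dM) t (.lin (cbncpsT R τ) R)) := by
  have hR' : R = .base 0 ∨ R = .iunit := by
    rcases hR with ⟨b, rfl, hb⟩ | hR
    · cases b with
      | zero => exact .inl rfl
      | succ a => exact absurd rfl (hb a)
    · exact .inr hR
  refine ⟨fun Θ M N τ dM dN h => ?_, fun Θ τ t ht => cbncps_full hR' ht⟩
  rcases hR' with rfl | rfl
  · exact cbncps_faithful (R := .base 0) () dM dN h
  · exact cbncps_faithful (R := .iunit) () dM dN h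

end EEC
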